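/- arXiv:1811.05959 — 5 statements merged into one kernel-verified Lean document; each statement's English description precedes it below -/
import Mathlib

section
/- Let X ⊆ ℝ^N be a Borel set with Hausdorff dimension dim_H X < k for some k ∈ ℕ, let μ be a Borel probability measure on X, and let φ : X → ℝ^k be a locally Lipschitz map. Then for Lebesgue almost every linear transformation L : ℝ^N → ℝ^k (identified with a tuple (l_1,…,l_k) ∈ (ℝ^N)^k via Lx = (⟨l_1,x⟩,…,⟨l_k,x⟩), with the Lebesgue measure on (ℝ^N)^k) there exists a Borel set X_L ⊆ X of full μ-measure such that the map φ_L = φ + L is injective on X_L. -/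
open MeasureTheory Set
open scoped InnerProductSpace ENNReal

open Topology Filter in
theorem pe_null {N k : ℕ}
    (X : Set (EuclideanSpace ℝ (Fin N)))
    (hdim : dimH X < (k : ℝ≥0∞))
    (φ : EuclideanSpace ℝ (Fin N) → EuclideanSpace ℝ (Fin k))
    (hφ : ∀ x ∈ X, ∃ U : Set (EuclideanSpace ℝ (Fin N)), IsOpen U ∧ x ∈ U ∧
      ∃ C > (0 : ℝ), ∀ y ∈ U ∩ X, ∀ y' ∈ U ∩ X, ‖φ y - φ y'‖ ≤ C * ‖y - y'‖)
    (x : EuclideanSpace ℝ (Fin N)) (j : Fin N)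
    (L : Fin k → EuclideanSpace ℝ (Fin N)) :
    ∀ᵐ a : Fin k → ℝ, ¬ ∃ y ∈ X, y j - x j ≠ 0 ∧
      ∀ i, φ x i + ⟪L i + a i • EuclideanSpace.single j (1:ℝ), x⟫_ℝ
        = φ y i + ⟪L i + a i • EuclideanSpace.single j (1:ℝ), y⟫_ℝ := by
  set Y : Set (EuclideanSpace ℝ (Fin N)) := {y | y ∈ X ∧ y j - x j ≠ 0} with hY
  let H : EuclideanSpace ℝ (Fin N) → EuclideanSpace ℝ (Fin N) × EuclideanSpace ℝ (Fin k) :=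
    fun y => (y, φ y)
  let G : EuclideanSpace ℝ (Fin N) × EuclideanSpace ℝ (Fin k) → (Fin k → ℝ) :=
    fun p i => -(p.2 i - φ x i + ⟪L i, p.1 - x⟫_ℝ) / (p.1 j - x j)
  have h1 : dimH (H '' Y) ≤ dimH Y := by
    apply dimH_image_le_of_locally_lipschitzOn
    intro y hy
    obtain ⟨U, hU, hyU, C, hC, hL⟩ := hφ y hy.1
    refine ⟨max 1 C.toNNReal, U ∩ Y, ?_, ?_⟩
    · rw [inter_comm]; exact inter_mem_nhdsWithin _ (hU.mem_nhds hyU)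
    · refine LipschitzOnWith.prodMk (LipschitzWith.id.lipschitzOnWith) ?_
      apply LipschitzOnWith.of_dist_le_mul
      intro a ha b hb
      rw [dist_eq_norm, dist_eq_norm, Real.coe_toNNReal _ hC.le]
      exact hL a ⟨ha.1, ha.2.1⟩ b ⟨hb.1, hb.2.1⟩
  have h2 : dimH (G '' (H '' Y)) ≤ dimH (H '' Y) := by
    apply dimH_image_le_of_locally_lipschitzOn
    rintro _ ⟨y, hy, rfl⟩
    have : ContDiffAt ℝ 1 G (H y) := by
      rw [contDiffAt_pi]
      intro i
      have e1 : ContDiff ℝ 1 (fun p : EuclideanSpace ℝ (Fin N) × EuclideanSpace ℝ (Fin k) =>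
          -(p.2 i - φ x i + ⟪L i, p.1 - x⟫_ℝ)) := by
        have e0 : ContDiff ℝ 1 (fun p : EuclideanSpace ℝ (Fin N) × EuclideanSpace ℝ (Fin k) =>
            ⟪L i, p.1 - x⟫_ℝ) := ContDiff.inner ℝ contDiff_const (by fun_prop)
        fun_prop
      have e2 : ContDiff ℝ 1 (fun p : EuclideanSpace ℝ (Fin N) × EuclideanSpace ℝ (Fin k) =>
          p.1 j - x j) := by fun_prop
      exact e1.contDiffAt.div e2.contDiffAt hy.2
    obtain ⟨K, t, ht, hK⟩ := this.exists_lipschitzOnWith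
    exact ⟨K, t, mem_nhdsWithin_of_mem_nhds ht, hK⟩
  have h3 : dimH Y ≤ dimH X := dimH_mono (fun y hy => hy.1)
  have h4 : dimH (G '' (H '' Y)) < ((k : NNReal) : ℝ≥0∞) := by
    refine (h2.trans (h1.trans h3)).trans_lt ?_
    simpa using hdim
  have h5 := hausdorffMeasure_of_dimH_lt h4
  have h6 : (volume : Measure (Fin k → ℝ)) (G '' (H '' Y)) = 0 := by
    rw [← hausdorffMeasure_pi_real]
    simpa using h5
  rw [ae_iff]
  refine measure_mono_null ?_ h6
  intro a ha
  simp only [not_not, mem_ofPred_eq] at ha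
  obtain ⟨y, hy, hne, he⟩ := ha
  refine ⟨H y, ⟨y, ⟨hy, hne⟩, rfl⟩, ?_⟩
  funext i
  have := he i
  simp only [inner_add_left, inner_smul_left, EuclideanSpace.inner_single_left] at this
  simp only [G, H, inner_sub_right]
  rw [div_eq_iff hne]
  simp at this
  linarith

theorem pe_cont {N k : ℕ}
    (X : Set (EuclideanSpace ℝ (Fin N)))
    (φ : EuclideanSpace ℝ (Fin N) → EuclideanSpace ℝ (Fin k))
    (hφ : ∀ x ∈ X, ∃ U : Set (EuclideanSpace ℝ (Fin N)), IsOpen U ∧ x ∈ U ∧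
      ∃ C > (0 : ℝ), ∀ y ∈ U ∩ X, ∀ y' ∈ U ∩ X, ‖φ y - φ y'‖ ≤ C * ‖y - y'‖) :
    ContinuousOn φ X := by
  intro y hy
  obtain ⟨U, hU, hyU, C, hC, hL⟩ := hφ y hy
  have : LipschitzOnWith C.toNNReal φ (U ∩ X) := by
    apply LipschitzOnWith.of_dist_le_mul
    intro a ha b hb
    rw [dist_eq_norm, dist_eq_norm, Real.coe_toNNReal _ hC.le]
    exact hL a ha b hb
  have h := this.continuousOn y ⟨hyU, hy⟩
  rwa [inter_comm, continuousWithinAt_inter (hU.mem_nhds hyU)] at h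

theorem pe_meas {N k : ℕ}
    (K₁ K₂ : Set (EuclideanSpace ℝ (Fin N))) (h₁ : IsCompact K₁) (h₂ : IsCompact K₂)
    (φ : EuclideanSpace ℝ (Fin N) → EuclideanSpace ℝ (Fin k))
    (c₁ : ContinuousOn φ K₁) (c₂ : ContinuousOn φ K₂) (j : Fin N) :
    MeasurableSet {p : EuclideanSpace ℝ (Fin N) × (Fin k → EuclideanSpace ℝ (Fin N)) |
      p.1 ∈ K₁ ∧ ∃ y ∈ K₂, y j - p.1 j ≠ 0 ∧
        ∀ i, φ p.1 i + ⟪p.2 i, p.1⟫_ℝ = φ y i + ⟪p.2 i, y⟫_ℝ} := by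
  let T : ℕ → Set ((EuclideanSpace ℝ (Fin N) × (Fin k → EuclideanSpace ℝ (Fin N))) ×
      EuclideanSpace ℝ (Fin N)) := fun n => (K₁ ×ˢ Metric.closedBall 0 n) ×ˢ K₂
  let h : (EuclideanSpace ℝ (Fin N) × (Fin k → EuclideanSpace ℝ (Fin N))) ×
      EuclideanSpace ℝ (Fin N) → ℝ × (Fin k → ℝ) := fun q =>
      (|q.2 j - q.1.1 j|, fun i => φ q.1.1 i + ⟪q.1.2 i, q.1.1⟫_ℝ - (φ q.2 i + ⟪q.1.2 i, q.2⟫_ℝ))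
  have hT : ∀ n, IsCompact (T n) := fun n =>
    (h₁.prod (isCompact_closedBall _ _)).prod h₂
  have hc : ∀ n, ContinuousOn h (T n) := by
    intro n
    have a1 : ContinuousOn (fun q : (EuclideanSpace ℝ (Fin N) ×
        (Fin k → EuclideanSpace ℝ (Fin N))) × EuclideanSpace ℝ (Fin N) => φ q.1.1) (T n) :=
      c₁.comp (by fun_prop) (fun q hq => hq.1.1)
    have a2 : ContinuousOn (fun q : (EuclideanSpace ℝ (Fin N) ×
        (Fin k → EuclideanSpace ℝ (Fin N))) × EuclideanSpace ℝ (Fin N) => φ q.2) (T n) :=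
      c₂.comp (by fun_prop) (fun q hq => hq.2)
    refine ContinuousOn.prodMk (by fun_prop) ?_
    rw [continuousOn_pi]
    intro i
    have b0 : Continuous (fun v : EuclideanSpace ℝ (Fin k) => v i) := by fun_prop
    have b1 : Continuous (fun q : (EuclideanSpace ℝ (Fin N) ×
        (Fin k → EuclideanSpace ℝ (Fin N))) × EuclideanSpace ℝ (Fin N) => q.1.2 i) :=
      (continuous_apply i).comp (continuous_snd.comp continuous_fst)
    have b2 : Continuous (fun q : (EuclideanSpace ℝ (Fin N) ×
        (Fin k → EuclideanSpace ℝ (Fin N))) × EuclideanSpace ℝ (Fin N) => ⟪q.1.2 i, q.1.1⟫_ℝ) :=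
      b1.inner (continuous_fst.comp continuous_fst)
    have b3 : Continuous (fun q : (EuclideanSpace ℝ (Fin N) ×
        (Fin k → EuclideanSpace ℝ (Fin N))) × EuclideanSpace ℝ (Fin N) => ⟪q.1.2 i, q.2⟫_ℝ) :=
      b1.inner continuous_snd
    exact ((b0.comp_continuousOn a1).add b2.continuousOn).sub
      ((b0.comp_continuousOn a2).add b3.continuousOn)
  have hcl : ∀ n m : ℕ, IsCompact (T n ∩ h ⁻¹' (Ici (1 / ((m : ℝ) + 1)) ×ˢ {0})) := by
    intro n m
    exact (hT n).of_isClosed_subset ((hc n).preimage_isClosed_of_isClosed (hT n).isClosed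
      (isClosed_Ici.prod isClosed_singleton)) inter_subset_left
  have key : {p : EuclideanSpace ℝ (Fin N) × (Fin k → EuclideanSpace ℝ (Fin N)) |
      p.1 ∈ K₁ ∧ ∃ y ∈ K₂, y j - p.1 j ≠ 0 ∧
        ∀ i, φ p.1 i + ⟪p.2 i, p.1⟫_ℝ = φ y i + ⟪p.2 i, y⟫_ℝ} =
      ⋃ n : ℕ, ⋃ m : ℕ, Prod.fst '' (T n ∩ h ⁻¹' (Ici (1 / ((m : ℝ) + 1)) ×ˢ {0})) := by
    ext p
    simp only [mem_ofPred_eq, mem_iUnion]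
    constructor
    · rintro ⟨hp, y, hy, hne, he⟩
      obtain ⟨n, hn⟩ := exists_nat_ge ‖p.2‖
      obtain ⟨m, hm⟩ := exists_nat_one_div_lt (abs_pos.2 hne)
      refine ⟨n, m, (p, y), ⟨⟨⟨hp, by simpa using hn⟩, hy⟩, hm.le, ?_⟩, rfl⟩
      simp only [h, mem_singleton_iff]
      funext i
      simp [he i]
    · rintro ⟨n, m, ⟨q, y⟩, ⟨⟨⟨hq, -⟩, hy⟩, hm, he⟩, rfl⟩
      refine ⟨hq, y, hy, ?_, ?_⟩
      · have : (0:ℝ) < 1 / ((m : ℝ) + 1) := by positivity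
        exact abs_pos.1 (this.trans_le hm)
      · intro i
        have := congrFun he i
        exact sub_eq_zero.1 this
  rw [key]
  exact MeasurableSet.iUnion fun n => MeasurableSet.iUnion fun m =>
    ((hcl n m).image continuous_fst).measurableSet

theorem pe_pair {N k : ℕ}
    (X : Set (EuclideanSpace ℝ (Fin N)))
    (hdim : dimH X < (k : ℝ≥0∞))
    (μ : Measure (EuclideanSpace ℝ (Fin N))) [IsProbabilityMeasure μ]
    (φ : EuclideanSpace ℝ (Fin N) → EuclideanSpace ℝ (Fin k))
    (hφ : ∀ x ∈ X, ∃ U : Set (EuclideanSpace ℝ (Fin N)), IsOpen U ∧ x ∈ U ∧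
      ∃ C > (0 : ℝ), ∀ y ∈ U ∩ X, ∀ y' ∈ U ∩ X, ‖φ y - φ y'‖ ≤ C * ‖y - y'‖)
    (K₁ K₂ : Set (EuclideanSpace ℝ (Fin N))) (h₁ : IsCompact K₁) (h₂ : IsCompact K₂)
    (s₁ : K₁ ⊆ X) (s₂ : K₂ ⊆ X) (j : Fin N) :
    ∀ᵐ L ∂(volume : Measure (Fin k → EuclideanSpace ℝ (Fin N))), ∀ᵐ x ∂μ,
      ¬ (x ∈ K₁ ∧ ∃ y ∈ K₂, y j - x j ≠ 0 ∧
        ∀ i, φ x i + ⟪L i, x⟫_ℝ = φ y i + ⟪L i, y⟫_ℝ) := by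
  have hc := pe_cont X φ hφ
  have hm := pe_meas K₁ K₂ h₁ h₂ φ (hc.mono s₁) (hc.mono s₂) j
  refine (Measure.ae_ae_comm (μ := μ) (p := fun x (L : Fin k → EuclideanSpace ℝ (Fin N)) => ¬ (x ∈ K₁ ∧ ∃ y ∈ K₂, y j - x j ≠ 0 ∧
        ∀ i, φ x i + ⟪L i, x⟫_ℝ = φ y i + ⟪L i, y⟫_ℝ)) hm.compl).1 ?_
  refine Filter.Eventually.of_forall fun x => ?_
  let ι : (Fin k → ℝ) →ₗ[ℝ] (Fin k → EuclideanSpace ℝ (Fin N)) :=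
    { toFun := fun a i => a i • EuclideanSpace.single j (1:ℝ)
      map_add' := by intro a b; funext i; simp [add_smul]
      map_smul' := by intro a b; funext i; simp [mul_smul] }
  have hm2 := (measurable_prodMk_left (x := x)) hm
  refine ae_mem_of_ae_add_linearMap_mem (𝕜 := ℝ) ι volume volume hm2.compl ?_
  intro L
  filter_upwards [pe_null X hdim φ hφ x j L] with a ha
  rintro ⟨-, y, hy, hne, he⟩
  exact ha ⟨y, s₂ hy, hne, he⟩


/-- **Probabilistic embedding theorem (simple version).**
`X ⊆ ℝ^N` Borel with `dim_H X < k`, `μ` a Borel probability measure on `X`,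
`φ : X → ℝ^k` locally Lipschitz. Then for Lebesgue-a.e. linear map
`L = (l₁,…,l_k) ∈ (ℝ^N)^k`, `Lx = (⟪l₁,x⟫,…,⟪l_k,x⟫)`, there is a Borel set
`X_L ⊆ X` of full `μ`-measure on which `φ + L` is injective. -/
theorem probabilistic_embedding_simple {N k : ℕ}
    (X : Set (EuclideanSpace ℝ (Fin N))) (hX : MeasurableSet X)
    (hdim : dimH X < (k : ℝ≥0∞))
    (μ : Measure (EuclideanSpace ℝ (Fin N))) [IsProbabilityMeasure μ]
    (hμX : μ Xᶜ = 0)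
    (φ : EuclideanSpace ℝ (Fin N) → EuclideanSpace ℝ (Fin k))
    (hφ : ∀ x ∈ X, ∃ U : Set (EuclideanSpace ℝ (Fin N)), IsOpen U ∧ x ∈ U ∧
      ∃ C > (0 : ℝ), ∀ y ∈ U ∩ X, ∀ y' ∈ U ∩ X, ‖φ y - φ y'‖ ≤ C * ‖y - y'‖) :
    ∀ᵐ L ∂(volume : Measure (Fin k → EuclideanSpace ℝ (Fin N))),
      ∃ X_L : Set (EuclideanSpace ℝ (Fin N)), X_L ⊆ X ∧ MeasurableSet X_L ∧
        μ (X \ X_L) = 0 ∧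
        Set.InjOn (fun x => fun i : Fin k => φ x i + ⟪L i, x⟫_ℝ) X_L := by

  have hK : ∀ n : ℕ, ∃ K ⊆ X, IsCompact K ∧ μ (X \ K) < ((n : ℝ≥0∞) + 1)⁻¹ := fun n =>
    hX.exists_isCompact_sdiff_lt (measure_ne_top _ _) (by simp)
  choose K hKX hKc hKm using hK
  have hU : μ (X \ ⋃ n, K n) = 0 := by
    by_contra hne
    obtain ⟨n, hn⟩ := ENNReal.exists_inv_nat_lt hne
    have h1 : μ (X \ ⋃ n, K n) ≤ μ (X \ K n) :=
      measure_mono (diff_subset_diff_right (subset_iUnion K n))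
    have h2 : ((n : ℝ≥0∞) + 1)⁻¹ ≤ (n : ℝ≥0∞)⁻¹ := ENNReal.inv_le_inv.2 le_self_add
    exact absurd (h1.trans_lt ((hKm n).trans_le h2)) (not_lt.2 hn.le)
  have hall : ∀ᵐ L ∂(volume : Measure (Fin k → EuclideanSpace ℝ (Fin N))),
      ∀ a b : ℕ, ∀ j : Fin N, ∀ᵐ x ∂μ,
      ¬ (x ∈ K a ∧ ∃ y ∈ K b, y j - x j ≠ 0 ∧
        ∀ i, φ x i + ⟪L i, x⟫_ℝ = φ y i + ⟪L i, y⟫_ℝ) := by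
    simp only [ae_all_iff]
    intro a b j
    exact pe_pair X hdim μ φ hφ (K a) (K b) (hKc a) (hKc b) (hKX a) (hKX b) j
  filter_upwards [hall] with L hL
  simp only [← ae_all_iff] at hL
  rw [ae_iff] at hL
  set B := {x | ¬ ∀ a b : ℕ, ∀ j : Fin N, ¬ (x ∈ K a ∧ ∃ y ∈ K b, y j - x j ≠ 0 ∧
        ∀ i, φ x i + ⟪L i, x⟫_ℝ = φ y i + ⟪L i, y⟫_ℝ)} with hB
  refine ⟨(⋃ n, K n) \ toMeasurable μ B, ?_, ?_, ?_, ?_⟩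
  · exact diff_subset.trans (iUnion_subset hKX)
  · exact (MeasurableSet.iUnion fun n => (hKc n).measurableSet).diff (measurableSet_toMeasurable _ _)
  · refine measure_mono_null (t := (X \ ⋃ n, K n) ∪ toMeasurable μ B) ?_ ?_
    · intro x hx
      by_cases h : x ∈ ⋃ n, K n
      · right
        by_contra h'
        exact hx.2 ⟨h, h'⟩
      · exact Or.inl ⟨hx.1, h⟩
    · rw [measure_union_null_iff]
      exact ⟨hU, by rw [measure_toMeasurable]; exact hL⟩
  · rintro x ⟨hx, hxB⟩ y ⟨hy, -⟩ he
    by_contra hne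
    apply hxB
    apply subset_toMeasurable
    obtain ⟨a, ha⟩ := mem_iUnion.1 hx
    obtain ⟨b, hb⟩ := mem_iUnion.1 hy
    have : ∃ j, y j - x j ≠ 0 := by
      by_contra hcon
      push Not at hcon
      exact hne (PiLp.ext fun j => (sub_eq_zero.1 (hcon j)).symm)
    obtain ⟨j, hj⟩ := this
    exact fun hcon => hcon a b j ⟨ha, y, hb, hj, fun i => congrFun he i⟩
end

section
/- Let X ⊆ ℝ^N be a Borel set and μ a Borel σ-finite measure on X. Take k ∈ ℕ and β ∈ (0,1] such that H^{βk}(X) = 0, and let φ : X → ℝ^k be a locally β-Hölder map. Then for Lebesgue almost every linear transformation L : ℝ^N → ℝ^k (identified with a tuple (l_1,…,l_k) ∈ (ℝ^N)^k via Lx = (⟨l_1,x⟩,…,⟨l_k,x⟩), with the Lebesgue measure on (ℝ^N)^k) there exists a Borel set X_L ⊆ X of full μ-measure such that the map φ_L = φ + L is injective on X_L. -/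
open MeasureTheory Set
open scoped InnerProductSpace ENNReal

open scoped Topology

def LH {E : Type*} [NormedAddCommGroup E] (β : ℝ) (f : E → ℝ) (S : Set E) (y₀ : E) : Prop :=
  ∃ C : ℝ, 0 ≤ C ∧ ∃ u ∈ 𝓝[S] y₀, ∀ y ∈ u, ∀ y' ∈ u, |f y - f y'| ≤ C * ‖y - y'‖ ^ β

theorem LH.add {E : Type*} [NormedAddCommGroup E] {β : ℝ} {f g : E → ℝ} {S : Set E} {y₀ : E}
    (hf : LH β f S y₀) (hg : LH β g S y₀) : LH β (fun y => f y + g y) S y₀ := by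
  obtain ⟨C, hC, u, hu, h⟩ := hf
  obtain ⟨D, hD, v, hv, h'⟩ := hg
  refine ⟨C + D, by positivity, u ∩ v, Filter.inter_mem hu hv, fun y hy y' hy' => ?_⟩
  have h1 := h y hy.1 y' hy'.1
  have h2 := h' y hy.2 y' hy'.2
  have := abs_add_le (f y - f y') (g y - g y')
  rw [show f y + g y - (f y' + g y') = (f y - f y') + (g y - g y') by ring]
  linarith

theorem LH.bdd {E : Type*} [NormedAddCommGroup E] {β : ℝ} (hβ : 0 < β) {f : E → ℝ} {S : Set E}
    {y₀ : E} (h0 : y₀ ∈ S) (hf : LH β f S y₀) : ∃ B : ℝ, 0 ≤ B ∧ ∃ u ∈ 𝓝[S] y₀, ∀ y ∈ u, |f y| ≤ B := by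
  obtain ⟨C, hC, u, hu, h⟩ := hf
  refine ⟨|f y₀| + C, by positivity, u ∩ Metric.ball y₀ 1,
    Filter.inter_mem hu (mem_nhdsWithin_of_mem_nhds (Metric.ball_mem_nhds _ one_pos)),
    fun y hy => ?_⟩
  have h1 := h y hy.1 y₀ (mem_of_mem_nhdsWithin h0 hu)
  have h2 : ‖y - y₀‖ ^ β ≤ 1 := by
    apply Real.rpow_le_one (norm_nonneg _) _ hβ.le
    have := hy.2
    rw [Metric.mem_ball, dist_eq_norm] at this
    exact this.le
  have h3 : |f y| ≤ |f y₀| + |f y - f y₀| := by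
    have := abs_add_le (f y₀) (f y - f y₀)
    simpa using this
  nlinarith

theorem LH.mul {E : Type*} [NormedAddCommGroup E] {β : ℝ} (hβ : 0 < β) {f g : E → ℝ} {S : Set E}
    {y₀ : E} (h0 : y₀ ∈ S)
    (hf : LH β f S y₀) (hg : LH β g S y₀) : LH β (fun y => f y * g y) S y₀ := by
  obtain ⟨A, hA, a, ha, ha'⟩ := hf.bdd hβ h0
  obtain ⟨B, hB, b, hb, hb'⟩ := hg.bdd hβ h0
  obtain ⟨C, hC, u, hu, h⟩ := hf
  obtain ⟨D, hD, v, hv, h'⟩ := hg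
  refine ⟨C * B + A * D, by positivity, (u ∩ v) ∩ (a ∩ b),
    Filter.inter_mem (Filter.inter_mem hu hv) (Filter.inter_mem ha hb), fun y hy y' hy' => ?_⟩
  have h1 := h y hy.1.1 y' hy'.1.1
  have h2 := h' y hy.1.2 y' hy'.1.2
  have h3 := ha' y' hy'.2.1
  have h4 := hb' y hy.2.2
  have h5 : (0:ℝ) ≤ ‖y - y'‖ ^ β := by positivity
  rw [show f y * g y - f y' * g y' = (f y - f y') * g y + f y' * (g y - g y') by ring]
  calc _ ≤ |(f y - f y') * g y| + |f y' * (g y - g y')| := abs_add_le _ _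
    _ = |f y - f y'| * |g y| + |f y'| * |g y - g y'| := by rw [abs_mul, abs_mul]
    _ ≤ (C * ‖y - y'‖ ^ β) * B + A * (D * ‖y - y'‖ ^ β) := by gcongr
    _ = _ := by ring

theorem LH.of_contDiffAt {E : Type*} [NormedAddCommGroup E] [NormedSpace ℝ E] {β : ℝ}
    (hβ : β ∈ Set.Ioc (0 : ℝ) 1) {f : E → ℝ} {S : Set E}
    {y₀ : E} (hf : ContDiffAt ℝ 1 f y₀) : LH β f S y₀ := by
  obtain ⟨K, t, ht, h⟩ := hf.exists_lipschitzOnWith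
  refine ⟨K, K.2, t ∩ Metric.ball y₀ (1/2), mem_nhdsWithin_of_mem_nhds
    (Filter.inter_mem ht (Metric.ball_mem_nhds _ (by norm_num))), fun y hy y' hy' => ?_⟩
  have h1 := h.dist_le_mul y hy.1 y' hy'.1
  rw [Real.dist_eq, dist_eq_norm] at h1
  have h2 : ‖y - y'‖ ≤ 1 := by
    rw [← dist_eq_norm]
    have a := hy.2
    have b := hy'.2
    rw [Metric.mem_ball] at a b
    have := dist_triangle_right y y' y₀
    linarith
  have h3 : ‖y - y'‖ ≤ ‖y - y'‖ ^ β :=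
    Real.self_le_rpow_of_le_one (norm_nonneg _) h2 hβ.2
  exact h1.trans (by gcongr)

theorem null_image {N k : ℕ} {β : ℝ} (hβ : β ∈ Set.Ioc (0 : ℝ) 1)
    {S : Set (EuclideanSpace ℝ (Fin N))} (hS : μH[β * k] S = 0)
    (G : EuclideanSpace ℝ (Fin N) → Fin k → ℝ)
    (hG : ∀ y ∈ S, ∀ i, LH β (fun y => G y i) S y) : volume (G '' S) = 0 := by
  have := measure_null_of_locally_null
    (μ := OuterMeasure.comap G (volume : Measure (Fin k → ℝ)).toOuterMeasure) S ?_
  · simpa using this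
  intro x hx
  choose C hC u hu h using hG x hx
  refine ⟨(⋂ i, u i) ∩ S, Filter.inter_mem (Filter.iInter_mem.2 hu) self_mem_nhdsWithin, ?_⟩
  have hol : HolderOnWith (∑ i, (C i).toNNReal) β.toNNReal G ((⋂ i, u i) ∩ S) := by
    intro y hy y' hy'
    rw [edist_pi_def]
    refine Finset.sup_le fun i _ => ?_
    have h1 := h i y (mem_iInter.1 hy.1 i) y' (mem_iInter.1 hy'.1 i)
    rw [edist_dist, Real.dist_eq, edist_dist, dist_eq_norm, Real.coe_toNNReal _ hβ.1.le,
      ENNReal.ofReal_rpow_of_nonneg (norm_nonneg _) hβ.1.le]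
    refine (ENNReal.ofReal_le_ofReal h1).trans ?_
    rw [ENNReal.ofReal_mul (hC i)]
    gcongr
    refine ENNReal.coe_le_coe.2 ?_
    exact Finset.single_le_sum (f := fun i => (C i).toNNReal) (fun _ _ => zero_le) (Finset.mem_univ i)
  have h2 := hol.hausdorffMeasure_image_le (d := k) (by simpa using hβ.1) (by positivity)
  rw [Real.coe_toNNReal _ hβ.1.le, measure_mono_null inter_subset_right hS, mul_zero] at h2
  have h3 := hausdorffMeasure_pi_real (ι := Fin k)
  rw [Fintype.card_fin] at h3
  rw [h3] at h2
  simpa using h2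

/-- the bad set -/
def bad {N k : ℕ} (φ : EuclideanSpace ℝ (Fin N) → EuclideanSpace ℝ (Fin k))
    (K : Set (EuclideanSpace ℝ (Fin N))) (j : Fin N) :
    Set (EuclideanSpace ℝ (Fin N) × (Fin k → EuclideanSpace ℝ (Fin N))) :=
  {p | p.1 ∈ K ∧ ∃ y ∈ K, y j ≠ p.1 j ∧
    ∀ i, φ p.1 i + ⟪p.2 i, p.1⟫_ℝ = φ y i + ⟪p.2 i, y⟫_ℝ}

theorem bad_measurable {N k : ℕ} (φ : EuclideanSpace ℝ (Fin N) → EuclideanSpace ℝ (Fin k))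
    (K : ℕ → Set (EuclideanSpace ℝ (Fin N))) (hK : ∀ n, IsCompact (K n))
    (hφ : ∀ n, ContinuousOn φ (K n)) (j : Fin N) : MeasurableSet (bad φ (⋃ n, K n) j) := by
  let T : ℕ → ℕ → ℕ → Set (EuclideanSpace ℝ (Fin N) × EuclideanSpace ℝ (Fin N) ×
      (Fin k → EuclideanSpace ℝ (Fin N))) := fun n m r =>
    K n ×ˢ K m ×ˢ Metric.closedBall 0 r
  let F : EuclideanSpace ℝ (Fin N) × EuclideanSpace ℝ (Fin N) ×
      (Fin k → EuclideanSpace ℝ (Fin N)) → (Fin k → ℝ) × ℝ := fun p =>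
    (fun i => (φ p.1 i + ⟪p.2.2 i, p.1⟫_ℝ) - (φ p.2.1 i + ⟪p.2.2 i, p.2.1⟫_ℝ),
      |p.2.1 j - p.1 j|)
  have hT : ∀ n m r, IsCompact (T n m r) := fun n m r =>
    (hK n).prod ((hK m).prod (isCompact_closedBall _ _))
  have hF : ∀ n m r, ContinuousOn F (T n m r) := by
    intro n m r
    have c1 : ContinuousOn (fun p : EuclideanSpace ℝ (Fin N) × EuclideanSpace ℝ (Fin N) ×
      (Fin k → EuclideanSpace ℝ (Fin N)) => φ p.1) (T n m r) :=
      (hφ n).comp continuousOn_fst (fun p hp => hp.1)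
    have c2 : ContinuousOn (fun p : EuclideanSpace ℝ (Fin N) × EuclideanSpace ℝ (Fin N) ×
      (Fin k → EuclideanSpace ℝ (Fin N)) => φ p.2.1) (T n m r) :=
      (hφ m).comp (by fun_prop) (fun p hp => hp.2.1)
    refine ContinuousOn.prodMk (continuousOn_pi.2 fun i => ?_) (Continuous.continuousOn (by fun_prop))
    have d1 := (EuclideanSpace.proj i : EuclideanSpace ℝ (Fin k) →L[ℝ] ℝ).continuous.comp_continuousOn c1
    have d2 := (EuclideanSpace.proj i : EuclideanSpace ℝ (Fin k) →L[ℝ] ℝ).continuous.comp_continuousOn c2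
    have d3 : Continuous (fun p : EuclideanSpace ℝ (Fin N) × EuclideanSpace ℝ (Fin N) ×
      (Fin k → EuclideanSpace ℝ (Fin N)) => ⟪p.2.2 i, p.1⟫_ℝ) :=
      Continuous.inner ((continuous_apply i).comp (continuous_snd.comp continuous_snd)) continuous_fst
    have d4 : Continuous (fun p : EuclideanSpace ℝ (Fin N) × EuclideanSpace ℝ (Fin N) ×
      (Fin k → EuclideanSpace ℝ (Fin N)) => ⟪p.2.2 i, p.2.1⟫_ℝ) :=
      Continuous.inner ((continuous_apply i).comp (continuous_snd.comp continuous_snd))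
        (continuous_fst.comp continuous_snd)
    exact (d1.add d3.continuousOn).sub (d2.add d4.continuousOn)
  have key : bad φ (⋃ n, K n) j = ⋃ n, ⋃ m, ⋃ r : ℕ, ⋃ s : ℕ,
      (fun p => (p.1, p.2.2)) '' (T n m r ∩ F ⁻¹' ({0} ×ˢ Ici (1 / (s + 1 : ℝ)))) := by
    ext ⟨x, L⟩
    simp only [bad, mem_ofPred_eq, mem_iUnion]
    constructor
    · rintro ⟨⟨n, hn⟩, y, ⟨m, hm⟩, hne, he⟩
      obtain ⟨r, hr⟩ := exists_nat_ge ‖L‖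
      obtain ⟨s, hs⟩ := exists_nat_one_div_lt (abs_pos.2 (sub_ne_zero.2 hne))
      refine ⟨n, m, r, s, (x, y, L), ⟨⟨hn, hm, by simpa using hr⟩, ?_, hs.le⟩, rfl⟩
      simp only [F, mem_singleton_iff]
      ext i
      simp [he i]
    · rintro ⟨n, m, r, s, ⟨x', y, L'⟩, ⟨⟨hn, hm, -⟩, h0, hs⟩, heq⟩
      simp only [Prod.mk.injEq] at heq
      obtain ⟨rfl, rfl⟩ := heq
      refine ⟨⟨n, hn⟩, y, ⟨m, hm⟩, ?_, fun i => ?_⟩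
      · intro h
        have : (1 / (s + 1 : ℝ)) ≤ |y j - x' j| := hs
        rw [h, sub_self, abs_zero] at this
        have : (0:ℝ) < 1 / (s + 1 : ℝ) := by positivity
        linarith
      · have := congrFun (mem_singleton_iff.1 h0) i
        simpa [F, sub_eq_zero] using this
  rw [key]
  refine .iUnion fun n => .iUnion fun m => .iUnion fun r => .iUnion fun s => ?_
  refine IsCompact.measurableSet (IsCompact.image ?_ (by fun_prop))
  have := (hF n m r).preimage_isClosed_of_isClosed (hT n m r).isClosed
    (isClosed_singleton.prod isClosed_Ici : IsClosed (({0} : Set (Fin k → ℝ)) ×ˢ Ici (1 / (s + 1 : ℝ))))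
  exact (hT n m r).of_isClosed_subset this inter_subset_left

theorem bad_slice {N k : ℕ} {β : ℝ} (hβ : β ∈ Set.Ioc (0 : ℝ) 1)
    (φ : EuclideanSpace ℝ (Fin N) → EuclideanSpace ℝ (Fin k))
    (K : Set (EuclideanSpace ℝ (Fin N))) (hK : μH[β * k] K = 0)
    (hφ : ∀ y ∈ K, ∀ i, LH β (fun y => φ y i) K y) (j : Fin N)
    (hm : MeasurableSet (bad φ K j)) (x : EuclideanSpace ℝ (Fin N)) :
    volume (Prod.mk x ⁻¹' (bad φ K j)) = 0 := by
  let ℓ : (Fin k → ℝ) →ₗ[ℝ] (Fin k → EuclideanSpace ℝ (Fin N)) :=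
    { toFun := fun a i => a i • EuclideanSpace.single j 1
      map_add' := fun a b => by ext1 i; simp [add_smul]
      map_smul' := fun a b => by ext1 i; simp [mul_smul] }
  have hmx : MeasurableSet (Prod.mk x ⁻¹' (bad φ K j)) := measurable_prodMk_left hm
  have := ae_mem_of_ae_add_linearMap_mem ℓ volume volume hmx.compl ?_
  · rw [ae_iff] at this
    refine measure_mono_null (fun L hL => ?_) this
    exact fun h => h hL
  intro L
  let S := K ∩ {y | y j ≠ x j}
  let G : EuclideanSpace ℝ (Fin N) → Fin k → ℝ := fun y i =>
    (φ y i + (⟪L i, y⟫_ℝ - ⟪L i, x⟫_ℝ - φ x i)) * (x j - y j)⁻¹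
  have hG : volume (G '' S) = 0 := by
    refine null_image hβ (measure_mono_null inter_subset_left hK) G fun y hy i => ?_
    have hne : x j - y j ≠ 0 := sub_ne_zero.2 (Ne.symm hy.2)
    refine LH.mul hβ.1 hy (LH.add ?_ (.of_contDiffAt hβ ?_)) (.of_contDiffAt hβ ?_)
    · obtain ⟨C, hC, u, hu, h⟩ := hφ y hy.1 i
      exact ⟨C, hC, u, nhdsWithin_mono _ inter_subset_left hu, h⟩
    · exact ((contDiffAt_const.inner ℝ contDiffAt_id).sub contDiffAt_const).sub contDiffAt_const
    · refine ContDiffAt.inv (by fun_prop) hne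
  rw [ae_iff]
  refine measure_mono_null ?_ hG
  intro a ha
  simp only [mem_compl_iff, mem_preimage, not_not, mem_ofPred_eq, bad] at ha
  obtain ⟨-, y, hy, hne, he⟩ := ha
  refine ⟨y, ⟨hy, hne⟩, ?_⟩
  ext i
  have h1 := he i
  have hne' : x j - y j ≠ 0 := sub_ne_zero.2 (Ne.symm hne)
  simp only [ℓ, LinearMap.coe_mk, AddHom.coe_mk, Pi.add_apply, inner_add_left,
    real_inner_smul_left, EuclideanSpace.inner_single_left, map_one, one_mul] at h1
  simp only [G]
  rw [← div_eq_mul_inv, div_eq_iff hne']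
  linarith

theorem probabilistic_embedding_extended {N k : ℕ} {β : ℝ}
    (hβ : β ∈ Set.Ioc (0 : ℝ) 1)
    (X : Set (EuclideanSpace ℝ (Fin N))) (hX : MeasurableSet X)
    (μ : Measure (EuclideanSpace ℝ (Fin N))) [SigmaFinite μ]
    (hμX : μ Xᶜ = 0)
    (hXH : μH[β * k] X = 0)
    (φ : EuclideanSpace ℝ (Fin N) → EuclideanSpace ℝ (Fin k))
    (hφ : ∀ x ∈ X, ∃ U : Set (EuclideanSpace ℝ (Fin N)), IsOpen U ∧ x ∈ U ∧
      ∃ C > (0 : ℝ), ∀ y ∈ U ∩ X, ∀ y' ∈ U ∩ X, ‖φ y - φ y'‖ ≤ C * ‖y - y'‖ ^ β) :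
    ∀ᵐ L ∂(volume : Measure (Fin k → EuclideanSpace ℝ (Fin N))),
      ∃ X_L : Set (EuclideanSpace ℝ (Fin N)), X_L ⊆ X ∧ MeasurableSet X_L ∧
        μ (X \ X_L) = 0 ∧
        Set.InjOn (fun x => fun i : Fin k => φ x i + ⟪L i, x⟫_ℝ) X_L := by
  have hLH : ∀ y ∈ X, ∀ i, LH β (fun y => φ y i) X y := by
    intro y hy i
    obtain ⟨U, hU, hyU, C, hC, h⟩ := hφ y hy
    refine ⟨C, hC.le, U ∩ X, Filter.inter_mem (mem_nhdsWithin_of_mem_nhds (hU.mem_nhds hyU))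
      self_mem_nhdsWithin, fun a ha b hb => le_trans ?_ (h a ha b hb)⟩
    simpa using PiLp.norm_apply_le (φ a - φ b) i
  have hcont : ContinuousOn φ X := by
    intro y hy
    obtain ⟨U, hU, hyU, C, hC, h⟩ := hφ y hy
    rw [ContinuousWithinAt, tendsto_iff_norm_sub_tendsto_zero]
    have hlim : Filter.Tendsto (fun z => C * ‖z - y‖ ^ β) (𝓝[X] y) (𝓝 0) := by
      have : Continuous (fun z : EuclideanSpace ℝ (Fin N) => C * ‖z - y‖ ^ β) :=
        continuous_const.mul ((continuous_id.sub continuous_const).norm.rpow_const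
          (fun _ => Or.inr hβ.1.le))
      have h2 := this.tendsto y
      simp only [sub_self, norm_zero, Real.zero_rpow hβ.1.ne', mul_zero] at h2
      exact h2.mono_left nhdsWithin_le_nhds
    refine squeeze_zero' (Filter.Eventually.of_forall fun _ => norm_nonneg _) ?_ hlim
    filter_upwards [self_mem_nhdsWithin, mem_nhdsWithin_of_mem_nhds (hU.mem_nhds hyU)] with z hz hzU
    exact h z ⟨hzU, hz⟩ y ⟨hyU, hy⟩
  have hex : ∀ n : ℕ, ∃ K, K ⊆ X ∧ IsCompact K ∧ μ.toFinite (X \ K) < ENNReal.ofReal (1 / (n + 1)) :=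
    fun n => hX.exists_isCompact_sdiff_lt (measure_ne_top _ _)
      (by simpa using (by positivity : (0:ℝ) < n + 1))
  choose K hKX hKc hKm using hex
  have hsub : (⋃ n, K n) ⊆ X := iUnion_subset hKX
  have hK0 : μ (X \ ⋃ n, K n) = 0 := by
    apply absolutelyContinuous_toFinite μ
    refine le_antisymm ?_ zero_le
    have hl : Filter.Tendsto (fun n : ℕ => ENNReal.ofReal (1 / ((n : ℝ) + 1))) Filter.atTop (𝓝 0) := by
      have := ENNReal.tendsto_ofReal (tendsto_one_div_add_atTop_nhds_zero_nat (𝕜 := ℝ))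
      simpa using this
    refine ge_of_tendsto' hl fun n => ?_
    exact (measure_mono (sdiff_subset_sdiff_right (subset_iUnion K n))).trans (hKm n).le
  have hbm : ∀ j, MeasurableSet (bad φ (⋃ n, K n) j) := fun j =>
    bad_measurable φ K hKc (fun n => hcont.mono (hKX n)) j
  have hnull : ∀ j, ∀ᵐ L ∂(volume : Measure (Fin k → EuclideanSpace ℝ (Fin N))),
      μ ((fun x => (x, L)) ⁻¹' bad φ (⋃ n, K n) j) = 0 := by
    intro j
    have h1 : (μ.prod volume) (bad φ (⋃ n, K n) j) = 0 := by
      rw [Measure.measure_prod_null (hbm j)]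
      refine Filter.Eventually.of_forall fun x => ?_
      refine bad_slice hβ φ _ (measure_mono_null hsub hXH) (fun y hy i => ?_) j (hbm j) x
      obtain ⟨C, hC, u, hu, h⟩ := hLH y (hsub hy) i
      exact ⟨C, hC, u, nhdsWithin_mono _ hsub hu, h⟩
    rw [Measure.prod_apply_symm (hbm j),
      lintegral_eq_zero_iff (measurable_measure_prodMk_right (hbm j))] at h1
    exact h1
  filter_upwards [ae_all_iff.2 hnull] with L hL
  refine ⟨(⋃ n, K n) \ ⋃ j, (fun x => (x, L)) ⁻¹' bad φ (⋃ n, K n) j,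
    sdiff_subset.trans hsub, ?_, ?_, ?_⟩
  · exact (MeasurableSet.iUnion fun n => (hKc n).measurableSet).diff
      (.iUnion fun j => measurable_prodMk_right (hbm j))
  · refine measure_mono_null (t := (X \ ⋃ n, K n) ∪ ⋃ j, (fun x => (x, L)) ⁻¹' bad φ (⋃ n, K n) j)
      ?_ (measure_union_null hK0 (measure_iUnion_null hL))
    intro x hx
    by_cases h : x ∈ ⋃ n, K n
    · right
      by_contra h'
      exact hx.2 ⟨h, h'⟩
    · exact Or.inl ⟨hx.1, h⟩
  · intro x hx y hy hxy
    by_contra hne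
    apply hx.2
    have : ∃ j, y j ≠ x j := by
      by_contra! hc
      exact hne (by ext j; exact (hc j).symm)
    obtain ⟨j, hj⟩ := this
    exact mem_iUnion.2 ⟨j, hx.1, y, hy.1, hj, fun i => congrFun hxy i⟩
end

section
/- Let X ⊆ ℝ^N be a Borel set, μ a Borel σ-finite measure on X, and T : X → X an injective, locally Lipschitz map. Take k ∈ ℕ and β ∈ (0,1] such that H^{βk}(X) = 0, and assume that the restriction μ|_{Per_p(T)} is mutually singular with H^{βp} for every p = 1,…,k−1. Let h : X → ℝ be locally β-Hölder and let h_1,…,h_m : X → ℝ be a 2k-interpolating family on X consisting of locally β-Hölder functions. For α = (α_1,…,α_m) ∈ ℝ^m set h_α = h + Σ_{j=1}^m α_j h_j. Then for Lebesgue almost every α ∈ ℝ^m there exists a Borel set X_α ⊆ X of full μ-measure such that the delay-coordinate map φ_α^T : X → ℝ^k, φ_α^T(x) = (h_α(x), h_α(Tx), …, h_α(T^{k−1}x)), is injective on X_α. -/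
open MeasureTheory Set
open scoped InnerProductSpace ENNReal

/-- `h₁,…,h_m` form a `K`-interpolating family on `X` if for every `l ≤ K` and all distinct
points `x₁,…,x_l ∈ X`, the `l × m` matrix `(h_j(x_i))_{i,j}` has full row rank `l`. -/
def IsInterpolatingFamily {E : Type*} {m : ℕ} (X : Set E) (h : Fin m → E → ℝ) (K : ℕ) : Prop :=
  ∀ l : ℕ, l ≤ K → ∀ x : Fin l → E, (∀ i, x i ∈ X) → Function.Injective x →
    (Matrix.of fun i j => h j (x i)).rank = l

/-- `Per_p(T)` within `X`: points of minimal period `p`. -/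
def PerSet {E : Type*} (T : E → E) (X : Set E) (p : ℕ) : Set E :=
  {x ∈ X | T^[p] x = x ∧ ∀ j : ℕ, 1 ≤ j → j < p → T^[j] x ≠ x}

/-- `f` is locally `β`-Hölder on `X`. -/
def LocallyHolderOn {E F : Type*} [NormedAddCommGroup E] [NormedAddCommGroup F]
    (β : ℝ) (f : E → F) (X : Set E) : Prop :=
  ∀ x ∈ X, ∃ U : Set E, IsOpen U ∧ x ∈ U ∧
    ∃ C > (0 : ℝ), ∀ y ∈ U ∩ X, ∀ y' ∈ U ∩ X, ‖f y - f y'‖ ≤ C * ‖y - y'‖ ^ β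


namespace TakensAux

lemma completion {q m : ℕ} (w : Fin q → Fin m → ℝ) (hw : LinearIndependent ℝ w) :
    ∃ (r : ℕ) (e : Fin q ⊕ Fin r ≃ Fin m) (c : Fin r → Fin m → ℝ),
      (Matrix.of fun k => Sum.elim w c (e.symm k)).det ≠ 0 := by
  have hs : ∀ i, Module.Basis.sumExtend hw (Sum.inl i) = w i := by
    intro i
    simp only [Module.Basis.sumExtend, Module.Basis.reindex_apply, Module.Basis.extend_apply_self]
    rfl
  let b := Module.Basis.sumExtend hw
  have : Finite (Fin q ⊕ Module.Basis.sumExtendIndex hw) := Module.Finite.finite_basis b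
  have : Finite (Module.Basis.sumExtendIndex hw) := Finite.of_injective (Sum.inr : _ → Fin q ⊕ _) Sum.inr_injective
  let f : Fin (Nat.card (Module.Basis.sumExtendIndex hw)) ≃ Module.Basis.sumExtendIndex hw :=
    (Finite.equivFin _).symm
  let b' := b.reindex (Equiv.sumCongr (Equiv.refl _) f.symm)
  let e := b'.indexEquiv (Pi.basisFun ℝ (Fin m))
  refine ⟨_, e, fun s => b' (Sum.inr s), ?_⟩
  have h1 : (fun k => Sum.elim w (fun s => b' (Sum.inr s)) (e.symm k)) = b'.reindex e := by
    funext k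
    simp only [Module.Basis.reindex_apply]
    rcases e.symm k with i | s
    · have h0 : b' (Sum.inl i) = w i := by
        rw [Module.Basis.reindex_apply]
        exact hs i
      rw [h0]
      rfl
    · rfl
  have h2 : LinearIndependent ℝ (b'.reindex e) := (b'.reindex e).linearIndependent
  rw [← h1] at h2
  have h3 := Matrix.linearIndependent_rows_iff_isUnit (A := Matrix.of fun k => Sum.elim w (fun s => b' (Sum.inr s)) (e.symm k))
  have := (h3.1 h2)
  rw [Matrix.isUnit_iff_isUnit_det] at this
  exact this.ne_zero

lemma slab {q m r : ℕ} (w : Fin q → Fin m → ℝ) (e : Fin q ⊕ Fin r ≃ Fin m) (c : Fin r → Fin m → ℝ)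
    (hd : (Matrix.of fun k => Sum.elim w c (e.symm k)).det ≠ 0) (g : Fin q → ℝ) (ε R : ℝ) :
    volume {α : Fin m → ℝ | (∀ i, |g i + ∑ j, α j * w i j| ≤ ε) ∧ ∀ s, |∑ j, α j * c s j| ≤ R} ≤
      ENNReal.ofReal |(Matrix.of fun k => Sum.elim w c (e.symm k)).det⁻¹| *
        (ENNReal.ofReal (2 * ε) ^ q * ENNReal.ofReal (2 * R) ^ r) := by
  set M := (Matrix.of fun k => Sum.elim w c (e.symm k)) with hM
  have hd' : LinearMap.det (Matrix.toLin' M) ≠ 0 := by rwa [LinearMap.det_toLin']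
  let lo : Fin m → ℝ := fun k => Sum.elim (fun i => - g i - ε) (fun _ => -R) (e.symm k)
  let hi : Fin m → ℝ := fun k => Sum.elim (fun i => - g i + ε) (fun _ => R) (e.symm k)
  have hsub : {α : Fin m → ℝ | (∀ i, |g i + ∑ j, α j * w i j| ≤ ε) ∧ ∀ s, |∑ j, α j * c s j| ≤ R} ⊆
      Matrix.toLin' M ⁻¹' Icc lo hi := by
    rintro α ⟨h1, h2⟩
    have key : ∀ k, lo k ≤ Matrix.toLin' M α k ∧ Matrix.toLin' M α k ≤ hi k := by
      intro k
      have : Matrix.toLin' M α k = ∑ j, α j * (Sum.elim w c (e.symm k)) j := by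
        simp [Matrix.mulVec, dotProduct, hM, mul_comm]
      rw [this]
      simp only [lo, hi]
      rcases e.symm k with i | s
      · have := abs_le.1 (h1 i)
        simp only [Sum.elim_inl]
        constructor <;> linarith
      · have := abs_le.1 (h2 s)
        simpa using this
    exact ⟨fun k => (key k).1, fun k => (key k).2⟩
  refine (measure_mono hsub).trans ?_
  rw [Measure.addHaar_preimage_linearMap _ hd', LinearMap.det_toLin', Real.volume_Icc_pi]
  refine le_of_eq ?_
  congr 1
  rw [← e.prod_comp, Fintype.prod_sum_type]
  have e1 : ∀ i : Fin q, hi (e (Sum.inl i)) - lo (e (Sum.inl i)) = 2 * ε := by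
    intro i
    simp only [lo, hi, Equiv.symm_apply_apply, Sum.elim_inl]
    ring
  have e2 : ∀ i : Fin r, hi (e (Sum.inr i)) - lo (e (Sum.inr i)) = 2 * R := by
    intro i
    simp only [lo, hi, Equiv.symm_apply_apply, Sum.elim_inr]
    ring
  simp only [e1, e2, Finset.prod_const, Finset.card_univ, Fintype.card_fin]

lemma LocallyHolderOn.continuousOn {E F : Type*} [NormedAddCommGroup E] [NormedAddCommGroup F]
    {β : ℝ} (hβ : 0 < β) {f : E → F} {X : Set E} (hf : LocallyHolderOn β f X) :
    ContinuousOn f X := by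
  intro x hx
  obtain ⟨U, hU, hxU, C, hC, h⟩ := hf x hx
  rw [ContinuousWithinAt, tendsto_iff_norm_sub_tendsto_zero]
  have h1 : Filter.Tendsto (fun y => C * ‖y - x‖ ^ β) (nhdsWithin x X) (nhds 0) := by
    have : ContinuousAt (fun y => C * ‖y - x‖ ^ β) x := by
      refine continuousAt_const.mul (ContinuousAt.rpow_const (by fun_prop) (Or.inr hβ.le))
    have h2 : Filter.Tendsto (fun y => C * ‖y - x‖ ^ β) (nhds x) (nhds (C * ‖x - x‖ ^ β)) := this
    simp only [sub_self, norm_zero, Real.zero_rpow hβ.ne', mul_zero] at h2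
    exact h2.mono_left nhdsWithin_le_nhds
  refine squeeze_zero' (Filter.Eventually.of_forall fun _ => norm_nonneg _) ?_ h1
  filter_upwards [self_mem_nhdsWithin, mem_nhdsWithin_of_mem_nhds (hU.mem_nhds hxU)] with y hy hyU
  exact h y ⟨hyU, hy⟩ x ⟨hxU, hx⟩

lemma LocallyHolderOn.mono {E F : Type*} [NormedAddCommGroup E] [NormedAddCommGroup F]
    {β : ℝ} {f : E → F} {X Z : Set E} (hf : LocallyHolderOn β f X) (hZ : Z ⊆ X) :
    LocallyHolderOn β f Z := by
  intro x hx
  obtain ⟨U, hU, hxU, C, hC, h⟩ := hf x (hZ hx)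
  exact ⟨U, hU, hxU, C, hC, fun y hy y' hy' => h y ⟨hy.1, hZ hy.2⟩ y' ⟨hy'.1, hZ hy'.2⟩⟩

lemma LocallyHolderOn.sub_const {E F : Type*} [NormedAddCommGroup E] [NormedAddCommGroup F]
    {β : ℝ} {f : E → F} {X : Set E} (hf : LocallyHolderOn β f X) (a : F) :
    LocallyHolderOn β (fun x => f x - a) X := by
  intro x hx
  obtain ⟨U, hU, hxU, C, hC, h⟩ := hf x hx
  refine ⟨U, hU, hxU, C, hC, fun y hy y' hy' => ?_⟩
  simpa using h y hy y' hy'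

lemma LocallyHolderOn.comp_lip {E F : Type*} [NormedAddCommGroup E] [NormedAddCommGroup F]
    {β : ℝ} (hβ : 0 < β) {f : E → F} {T : E → E} {X : Set E} (hf : LocallyHolderOn β f X)
    (hT : LocallyHolderOn 1 T X) (hTX : MapsTo T X X) :
    LocallyHolderOn β (fun x => f (T x)) X := by
  intro x hx
  obtain ⟨U, hU, hxU, C, hC, h⟩ := hf (T x) (hTX hx)
  obtain ⟨V, hV, hxV, D, hD, h'⟩ := hT x hx
  have hc := (LocallyHolderOn.continuousOn one_pos hT) x hx
  have : T ⁻¹' U ∈ nhdsWithin x X := hc (hU.mem_nhds hxU)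
  obtain ⟨W, hW, hxW, hWU⟩ := mem_nhdsWithin.1 this
  refine ⟨V ∩ W, hV.inter hW, ⟨hxV, hxW⟩, C * D ^ β, by positivity, fun y hy y' hy' => ?_⟩
  have h1 := h (T y) ⟨hWU ⟨hy.1.2, hy.2⟩, hTX hy.2⟩ (T y') ⟨hWU ⟨hy'.1.2, hy'.2⟩, hTX hy'.2⟩
  have h2 := h' y ⟨hy.1.1, hy.2⟩ y' ⟨hy'.1.1, hy'.2⟩
  rw [Real.rpow_one] at h2
  calc _ ≤ C * ‖T y - T y'‖ ^ β := h1
    _ ≤ C * (D * ‖y - y'‖) ^ β := by gcongr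
    _ = _ := by rw [Real.mul_rpow hD.le (norm_nonneg _)]; ring

lemma LocallyHolderOn.iter {E F : Type*} [NormedAddCommGroup E] [NormedAddCommGroup F]
    {β : ℝ} (hβ : 0 < β) {f : E → F} {T : E → E} {X : Set E} (hf : LocallyHolderOn β f X)
    (hT : LocallyHolderOn 1 T X) (hTX : MapsTo T X X) (n : ℕ) :
    LocallyHolderOn β (fun x => f (T^[n] x)) X := by
  induction n with
  | zero => simpa using hf
  | succ n ih => simpa [Function.iterate_succ] using LocallyHolderOn.comp_lip hβ ih hT hTX

lemma LocallyHolderOn.finite {E F ι : Type*} [NormedAddCommGroup E] [NormedAddCommGroup F]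
    [Finite ι] {β : ℝ} {f : ι → E → F} {X : Set E} (hf : ∀ i, LocallyHolderOn β (f i) X)
    (x : E) (hx : x ∈ X) : ∃ U : Set E, IsOpen U ∧ x ∈ U ∧
    ∃ C > (0 : ℝ), ∀ i, ∀ y ∈ U ∩ X, ∀ y' ∈ U ∩ X, ‖f i y - f i y'‖ ≤ C * ‖y - y'‖ ^ β := by
  cases nonempty_fintype ι
  choose U hU hxU C hC h using fun i => hf i x hx
  refine ⟨⋂ i, U i, isOpen_iInter_of_finite hU, mem_iInter.2 hxU, 1 + ∑ i, C i, ?_, ?_⟩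
  · have := Finset.sum_nonneg (fun i (_ : i ∈ Finset.univ) => (hC i).le)
    linarith
  · intro i y hy y' hy'
    refine (h i y ⟨mem_iInter.1 hy.1 i, hy.2⟩ y' ⟨mem_iInter.1 hy'.1 i, hy'.2⟩).trans ?_
    have := Finset.single_le_sum (fun i (_ : i ∈ Finset.univ) => (hC i).le) (Finset.mem_univ i)
    have h2 : C i ≤ 1 + ∑ i, C i := by linarith
    gcongr

lemma hausdorff_cover {E : Type*} [NormedAddCommGroup E] [MeasurableSpace E] [BorelSpace E]
    {d : ℝ} {Z : Set E} (hZ : μH[d] Z = 0) {η : ℝ≥0∞} (hη : 0 < η) :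
    ∃ t : ℕ → Set E, Z ⊆ ⋃ n, t n ∧ (∀ n, Metric.ediam (t n) ≤ 1) ∧
      ∑' n, ⨆ _ : (t n).Nonempty, Metric.ediam (t n) ^ d < η := by
  rw [Measure.hausdorffMeasure_apply] at hZ
  have h1 := ENNReal.iSup_eq_zero.1 (ENNReal.iSup_eq_zero.1 hZ 1) one_pos
  rw [← h1] at hη
  simp only [iInf_lt_iff] at hη
  obtain ⟨t, h1, h2, h3⟩ := hη
  exact ⟨t, h1, h2, h3⟩

end TakensAux

namespace TakensAux

lemma key_uniform {E : Type*} [NormedAddCommGroup E] [MeasurableSpace E] [BorelSpace E]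
    {q m r : ℕ} {β : ℝ} (hβ : 0 < β) (Z : Set E) (G : Fin q → E → ℝ) (F : Fin q → Fin m → E → ℝ)
    (e : Fin q ⊕ Fin r ≃ Fin m) (c : Fin r → Fin m → ℝ) (C δ R : ℝ) (hC : 0 < C) (hδ : 0 < δ)
    (hR : 0 ≤ R)
    (hG : ∀ i, ∀ y ∈ Z, ∀ y' ∈ Z, ‖G i y - G i y'‖ ≤ C * ‖y - y'‖ ^ β)
    (hF : ∀ i j, ∀ y ∈ Z, ∀ y' ∈ Z, ‖F i j y - F i j y'‖ ≤ C * ‖y - y'‖ ^ β)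
    (hdet : ∀ y ∈ Z, δ ≤ |(Matrix.of fun k => Sum.elim (fun i j => F i j y) c (e.symm k)).det|)
    (hZ : μH[β * q] Z = 0) :
    volume {α : Fin m → ℝ | (∀ j, |α j| ≤ R) ∧ ∃ y ∈ Z, ∀ i, G i y + ∑ j, α j * F i j y = 0} = 0 := by
  set R' : ℝ := ∑ s, ∑ j, R * |c s j| with hR'
  set C' : ℝ := C + ∑ _j : Fin m, R * C with hC'
  have hC'0 : 0 ≤ C' := by
    have : 0 ≤ ∑ _j : Fin m, R * C := Finset.sum_nonneg fun _ _ => by positivity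
    linarith
  set K : ℝ≥0∞ := ENNReal.ofReal δ⁻¹ * (ENNReal.ofReal (2 * C') ^ q * ENNReal.ofReal (2 * R') ^ r) with hK
  have hKtop : K ≠ ⊤ := by
    refine ENNReal.mul_ne_top ENNReal.ofReal_ne_top (ENNReal.mul_ne_top ?_ ?_) <;>
    exact ENNReal.pow_ne_top ENNReal.ofReal_ne_top
  have piece : ∀ t : Set E, Metric.ediam t ≤ 1 →
      volume {α : Fin m → ℝ | (∀ j, |α j| ≤ R) ∧ ∃ y ∈ Z ∩ t, ∀ i, G i y + ∑ j, α j * F i j y = 0} ≤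
        K * ⨆ _ : t.Nonempty, Metric.ediam t ^ (β * q) := by
    intro t ht
    by_cases hne : (Z ∩ t).Nonempty
    swap
    · have : {α : Fin m → ℝ | (∀ j, |α j| ≤ R) ∧ ∃ y ∈ Z ∩ t, ∀ i, G i y + ∑ j, α j * F i j y = 0} = ∅ := by
        ext α
        simp only [mem_ofPred_eq, mem_empty_iff_false, iff_false]
        rintro ⟨_, y, hy, _⟩
        exact hne ⟨y, hy⟩
      rw [this]; simp
    obtain ⟨y₁, hy₁, hy₁t⟩ := hne
    have htop : Metric.ediam t ≠ ⊤ := ne_top_of_le_ne_top ENNReal.one_ne_top ht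
    have htne : t.Nonempty := ⟨y₁, hy₁t⟩
    simp only [htne, iSup_pos]
    set d : ℝ := (Metric.ediam t).toReal with hd
    have hd0 : 0 ≤ d := ENNReal.toReal_nonneg
    have hdist : ∀ y ∈ t, ‖y₁ - y‖ ≤ d := by
      intro y hy
      rw [← dist_eq_norm, dist_edist]
      exact ENNReal.toReal_mono htop (Metric.edist_le_ediam_of_mem hy₁t hy)
    have hdet1 := hdet y₁ hy₁
    have hne0 : (Matrix.of fun k => Sum.elim (fun i j => F i j y₁) c (e.symm k)).det ≠ 0 := by
      intro h0
      rw [h0, abs_zero] at hdet1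
      linarith
    have hs := slab (fun i j => F i j y₁) e c hne0 (fun i => G i y₁) (C' * d ^ β) R'
    refine (measure_mono ?_).trans (hs.trans ?_)
    · rintro α ⟨hα, y, ⟨hyZ, hyt⟩, hy⟩
      have hdb : ‖y₁ - y‖ ^ β ≤ d ^ β := Real.rpow_le_rpow (norm_nonneg _) (hdist y hyt) hβ.le
      refine ⟨fun i => ?_, fun s => ?_⟩
      · have e1 : G i y₁ + ∑ j, α j * F i j y₁ =
            (G i y₁ - G i y) + ∑ j, α j * (F i j y₁ - F i j y) := by
          simp only [mul_sub, Finset.sum_sub_distrib]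
          linarith [hy i]
        rw [e1]
        refine (abs_add_le _ _).trans ?_
        have g1 : |G i y₁ - G i y| ≤ C * d ^ β :=
          (hG i y₁ hy₁ y hyZ).trans (by gcongr)
        have g2 : |∑ j, α j * (F i j y₁ - F i j y)| ≤ ∑ _j : Fin m, R * (C * d ^ β) := by
          refine (Finset.abs_sum_le_sum_abs _ _).trans (Finset.sum_le_sum fun j _ => ?_)
          rw [abs_mul]
          have : |F i j y₁ - F i j y| ≤ C * d ^ β := (hF i j y₁ hy₁ y hyZ).trans (by gcongr)
          exact mul_le_mul (hα j) this (abs_nonneg _) hR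
        calc _ ≤ C * d ^ β + ∑ _j : Fin m, R * (C * d ^ β) := add_le_add g1 g2
          _ = C' * d ^ β := by
            simp only [hC', Finset.sum_const, nsmul_eq_mul]; ring
      · refine (Finset.abs_sum_le_sum_abs _ _).trans ?_
        calc ∑ j, |α j * c s j| ≤ ∑ j, R * |c s j| := by
              refine Finset.sum_le_sum fun j _ => ?_
              rw [abs_mul]
              exact mul_le_mul_of_nonneg_right (hα j) (abs_nonneg _)
          _ ≤ R' := Finset.single_le_sum (f := fun s => ∑ j, R * |c s j|)
              (fun s _ => Finset.sum_nonneg fun j _ => by positivity) (Finset.mem_univ s)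
    · have hpow : ENNReal.ofReal (2 * (C' * d ^ β)) ^ q =
          ENNReal.ofReal (2 * C') ^ q * Metric.ediam t ^ (β * q) := by
        rw [← mul_assoc, ENNReal.ofReal_mul (by positivity), mul_pow,
          ← ENNReal.ofReal_rpow_of_nonneg hd0 hβ.le, ENNReal.ofReal_toReal htop,
          ENNReal.rpow_mul_natCast]
      rw [hpow, hK]
      have : ENNReal.ofReal |(Matrix.of fun k => Sum.elim (fun i j => F i j y₁) c (e.symm k)).det⁻¹| ≤
          ENNReal.ofReal δ⁻¹ := by
        apply ENNReal.ofReal_le_ofReal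
        rw [abs_inv]
        exact inv_anti₀ hδ hdet1
      calc _ ≤ ENNReal.ofReal δ⁻¹ * (ENNReal.ofReal (2 * C') ^ q * Metric.ediam t ^ (β * q) * ENNReal.ofReal (2 * R') ^ r) := by
            gcongr
        _ = _ := by ring
  refine le_antisymm (le_of_forall_pos_le_add fun η hη => ?_) zero_le
  rw [zero_add]
  have hη' : 0 < η / (K + 1) := ENNReal.div_pos hη.ne' (by simp [hKtop])
  obtain ⟨t, ht1, ht2, ht3⟩ := hausdorff_cover hZ hη'
  calc _ ≤ volume (⋃ n, {α : Fin m → ℝ | (∀ j, |α j| ≤ R) ∧ ∃ y ∈ Z ∩ t n, ∀ i, G i y + ∑ j, α j * F i j y = 0}) := by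
        refine measure_mono ?_
        rintro α ⟨hα, y, hy, hh⟩
        obtain ⟨n, hn⟩ := mem_iUnion.1 (ht1 hy)
        exact mem_iUnion.2 ⟨n, hα, y, ⟨hy, hn⟩, hh⟩
    _ ≤ ∑' n, K * ⨆ _ : (t n).Nonempty, Metric.ediam (t n) ^ (β * q) :=
        (measure_iUnion_le _).trans (ENNReal.tsum_le_tsum fun n => piece _ (ht2 n))
    _ = K * ∑' n, ⨆ _ : (t n).Nonempty, Metric.ediam (t n) ^ (β * q) := ENNReal.tsum_mul_left
    _ ≤ (K + 1) * (η / (K + 1)) := by gcongr; exact le_self_add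
    _ ≤ η := ENNReal.mul_div_le

lemma key {E : Type*} [NormedAddCommGroup E] [MeasurableSpace E] [BorelSpace E]
    [SecondCountableTopology E]
    {q m : ℕ} {β : ℝ} (hβ : 0 < β) (Z : Set E) (G : Fin q → E → ℝ) (F : Fin q → Fin m → E → ℝ)
    (hG : ∀ i, LocallyHolderOn β (G i) Z) (hF : ∀ i j, LocallyHolderOn β (F i j) Z)
    (hli : ∀ y ∈ Z, LinearIndependent ℝ (fun i j => F i j y))
    (hZ : μH[β * q] Z = 0) :
    volume {α : Fin m → ℝ | ∃ y ∈ Z, ∀ i, G i y + ∑ j, α j * F i j y = 0} = 0 := by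
  have loc : ∀ y₀ ∈ Z, ∃ U ∈ nhdsWithin y₀ Z,
      volume {α : Fin m → ℝ | ∃ y ∈ Z ∩ U, ∀ i, G i y + ∑ j, α j * F i j y = 0} = 0 := by
    intro y₀ hy₀
    obtain ⟨r, e, c, hdet⟩ := completion _ (hli y₀ hy₀)
    obtain ⟨U₁, hU₁, hyU₁, C₁, hC₁, h₁⟩ := LocallyHolderOn.finite hG y₀ hy₀
    obtain ⟨U₂, hU₂, hyU₂, C₂, hC₂, h₂⟩ :=
      LocallyHolderOn.finite (ι := Fin q × Fin m) (f := fun p => F p.1 p.2) (fun p => hF p.1 p.2) y₀ hy₀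
    have hcont : ContinuousWithinAt (fun y =>
        |(Matrix.of fun k => Sum.elim (fun i j => F i j y) c (e.symm k)).det|) Z y₀ := by
      simp only [Matrix.det_apply]
      refine ContinuousWithinAt.abs ?_
      refine tendsto_finsetSum _ fun σ _ => ?_
      refine Filter.Tendsto.const_smul ?_ _
      refine tendsto_finsetProd _ fun k _ => ?_
      simp only [Matrix.of_apply]
      rcases e.symm (σ k) with i | s
      · exact LocallyHolderOn.continuousOn hβ (hF i k) y₀ hy₀
      · exact tendsto_const_nhds
    set δ := |(Matrix.of fun k => Sum.elim (fun i j => F i j y₀) c (e.symm k)).det| / 2 with hδ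
    have hδ0 : 0 < δ := half_pos (abs_pos.2 hdet)
    have hev : ∀ᶠ y in nhdsWithin y₀ Z,
        δ < |(Matrix.of fun k => Sum.elim (fun i j => F i j y) c (e.symm k)).det| :=
      hcont.eventually_const_lt (half_lt_self (abs_pos.2 hdet))
    refine ⟨{y | δ < |(Matrix.of fun k => Sum.elim (fun i j => F i j y) c (e.symm k)).det|} ∩ (U₁ ∩ U₂),
      Filter.inter_mem hev (mem_nhdsWithin_of_mem_nhds ((hU₁.inter hU₂).mem_nhds ⟨hyU₁, hyU₂⟩)), ?_⟩
    have hall := fun R : ℕ => key_uniform (r := r) hβ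
      (Z ∩ ({y | δ < |(Matrix.of fun k => Sum.elim (fun i j => F i j y) c (e.symm k)).det|} ∩ (U₁ ∩ U₂)))
      G F e c (C₁ + C₂) δ R (by positivity) hδ0 R.cast_nonneg
      (fun i y hy y' hy' => (h₁ i y ⟨hy.2.2.1, hy.1⟩ y' ⟨hy'.2.2.1, hy'.1⟩).trans
        (by gcongr; linarith))
      (fun i j y hy y' hy' => (h₂ (i, j) y ⟨hy.2.2.2, hy.1⟩ y' ⟨hy'.2.2.2, hy'.1⟩).trans
        (by gcongr; linarith))
      (fun y hy => le_of_lt hy.2.1) (measure_mono_null inter_subset_left hZ)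
    refine measure_mono_null ?_ (measure_iUnion_null hall)
    rintro α ⟨y, hy, hh⟩
    obtain ⟨R, hR⟩ := exists_nat_ge (∑ j, |α j|)
    exact mem_iUnion.2 ⟨R, fun j => (Finset.single_le_sum (f := fun j => |α j|)
      (fun _ _ => abs_nonneg _) (Finset.mem_univ j)).trans hR, y, hy, hh⟩
  choose! U hU hnull using loc
  obtain ⟨t, htZ, htc, hcov⟩ := TopologicalSpace.countable_cover_nhdsWithin hU
  refine measure_mono_null ?_ ((measure_biUnion_null_iff htc).2 fun y hy => hnull y (htZ hy))
  rintro α ⟨y, hy, hh⟩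
  obtain ⟨y₀, hy₀, hyU⟩ := mem_iUnion₂.1 (hcov hy)
  exact mem_iUnion₂.2 ⟨y₀, hy₀, y, ⟨hy, hyU⟩, hh⟩

end TakensAux

namespace TakensAux

lemma interp_indep {E : Type*} {m K : ℕ} {X : Set E} {h : Fin m → E → ℝ}
    (hI : IsInterpolatingFamily X h K) (S : Finset E) (hS : ∀ z ∈ S, z ∈ X) (hc : S.card ≤ K) :
    LinearIndepOn ℝ (fun z j => h j z) (S : Set E) := by
  have h1 := hI S.card hc (fun i => (S.equivFin.symm i : E)) (fun i => hS _ (S.equivFin.symm i).2)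
    (Subtype.val_injective.comp S.equivFin.symm.injective)
  rw [Matrix.rank_eq_finrank_span_row] at h1
  have h2 : LinearIndependent ℝ (Matrix.of fun (i : Fin S.card) j => h j (S.equivFin.symm i : E)).row := by
    rw [linearIndependent_iff_card_eq_finrank_span, Fintype.card_fin]
    exact h1.symm
  have h3 := h2.comp S.equivFin S.equivFin.injective
  have : ((Matrix.of fun (i : Fin S.card) j => h j (S.equivFin.symm i : E)).row ∘ S.equivFin) =
      fun z : S => fun j => h j (z : E) := by
    funext z j
    show h j ((S.equivFin.symm (S.equivFin z) : S) : E) = h j z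
    rw [Equiv.symm_apply_apply]
  rw [this] at h3
  exact h3

lemma diff_indep {E : Type*} {m k q : ℕ} {X : Set E} {h : Fin m → E → ℝ}
    (hI : IsInterpolatingFamily X h (2 * k)) (hq : q ≤ k) (x y : Fin q → E)
    (hx : ∀ i, x i ∈ X) (hy : ∀ i, y i ∈ X) (hyi : Function.Injective y)
    (hxy : ∀ i j, y i ≠ x j) :
    LinearIndependent ℝ (fun i j => h j (y i) - h j (x i)) := by
  classical
  set S : Finset E := Finset.univ.image y ∪ Finset.univ.image x with hSdef
  have hyS : ∀ i, y i ∈ S := fun i => by simp [hSdef]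
  have hxS : ∀ i, x i ∈ S := fun i => by simp [hSdef]
  have hS : ∀ z ∈ S, z ∈ X := by
    intro z hz
    simp only [hSdef, Finset.mem_union, Finset.mem_image, Finset.mem_univ, true_and] at hz
    rcases hz with ⟨i, rfl⟩ | ⟨i, rfl⟩
    · exact hy i
    · exact hx i
  have hcard : S.card ≤ 2 * k := by
    have h1 : (Finset.univ.image y).card ≤ q := Finset.card_image_le.trans (by simp)
    have h2 : (Finset.univ.image x).card ≤ q := Finset.card_image_le.trans (by simp)
    have h3 : S.card ≤ _ := Finset.card_union_le (Finset.univ.image y) (Finset.univ.image x)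
    omega
  have hli := interp_indep hI S hS hcard
  rw [linearIndepOn_finset_iff] at hli
  rw [Fintype.linearIndependent_iff]
  intro g hg i₀
  set f : E → ℝ := fun z => (∑ i, if y i = z then g i else 0) - ∑ i, if x i = z then g i else 0 with hf
  have h0 : ∑ z ∈ S, f z • (fun j => h j z) = 0 := by
    rw [← hg]
    funext j
    simp only [Finset.sum_apply, Pi.smul_apply, smul_eq_mul, hf, sub_mul, mul_sub,
      Finset.sum_sub_distrib, Finset.sum_mul, ite_mul, zero_mul]
    congr 1
    · rw [Finset.sum_comm]
      refine Finset.sum_congr rfl fun i _ => ?_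
      rw [Finset.sum_ite_eq]
      simp [hyS i]
    · rw [Finset.sum_comm]
      refine Finset.sum_congr rfl fun i _ => ?_
      rw [Finset.sum_ite_eq]
      simp [hxS i]
  have h1 := hli f h0 (y i₀) (hyS i₀)
  have h2 : (∑ i, if x i = y i₀ then g i else 0) = 0 :=
    Finset.sum_eq_zero fun i _ => if_neg fun hh => hxy i₀ i hh.symm
  have h3 : (∑ i, if y i = y i₀ then g i else 0) = g i₀ := by
    simp only [hyi.eq_iff]
    simp
  simp only [hf, h2, h3, sub_zero] at h1
  exact h1

section
variable {E : Type*} [NormedAddCommGroup E] [MeasurableSpace E] [BorelSpace E]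
    [SecondCountableTopology E] {k m : ℕ} {β : ℝ} {X : Set E} {T : E → E}
    {h : E → ℝ} {hfam : Fin m → E → ℝ}

lemma aux (hβ : 0 < β) (hTX : Set.MapsTo T X X) (hTlip : LocallyHolderOn 1 T X)
    (hh : LocallyHolderOn β h X) (hinterp : IsInterpolatingFamily X hfam (2 * k))
    (hfamHolder : ∀ j, LocallyHolderOn β (hfam j) X) {x : E} (hx : x ∈ X) {q : ℕ} (hq : q ≤ k)
    {Z : Set E} (hZX : Z ⊆ X) (hZ : μH[β * q] Z = 0)
    (hinj : ∀ y ∈ Z, ∀ i j : ℕ, i < q → j < q → T^[i] y = T^[j] y → i = j)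
    (hdis : ∀ y ∈ Z, ∀ i j : ℕ, i < q → j < q → T^[i] y ≠ T^[j] x) :
    volume {α : Fin m → ℝ | ∃ y ∈ Z, ∀ i < q, h (T^[i] x) + ∑ j, α j * hfam j (T^[i] x) =
      h (T^[i] y) + ∑ j, α j * hfam j (T^[i] y)} = 0 := by
  have hit : ∀ i, ∀ z ∈ X, T^[i] z ∈ X := fun i z hz => hTX.iterate i hz
  have hk := key hβ Z (fun (i : Fin q) y => h (T^[i] y) - h (T^[i] x))
    (fun i j y => hfam j (T^[i] y) - hfam j (T^[i] x))
    (fun i => (LocallyHolderOn.sub_const (LocallyHolderOn.mono (LocallyHolderOn.iter hβ hh hTlip hTX i) hZX) _))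
    (fun i j => (LocallyHolderOn.sub_const (LocallyHolderOn.mono (LocallyHolderOn.iter hβ (hfamHolder j) hTlip hTX i) hZX) _))
    (fun y hy => diff_indep hinterp hq (fun i : Fin q => T^[i] x) (fun i : Fin q => T^[i] y)
      (fun i => hit i x hx) (fun i => hit i y (hZX hy))
      (fun i j hij => Fin.ext (hinj y hy i j i.2 j.2 hij))
      (fun i j => hdis y hy i j i.2 j.2)) hZ
  refine measure_mono_null ?_ hk
  rintro α ⟨y, hy, hα⟩
  refine ⟨y, hy, fun i => ?_⟩
  have := hα i i.2
  simp only [mul_sub, Finset.sum_sub_distrib]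
  linarith

lemma section_null (hβ : 0 < β) (hTX : Set.MapsTo T X X) (hTinj : Set.InjOn T X)
    (hTlip : LocallyHolderOn 1 T X)
    (hh : LocallyHolderOn β h X) (hinterp : IsInterpolatingFamily X hfam (2 * k))
    (hfamHolder : ∀ j, LocallyHolderOn β (hfam j) X) (hXH : μH[β * k] X = 0)
    (Y : ℕ → Set E) (hY : ∀ p, 1 ≤ p → p < k → μH[β * p] (Y p) = 0)
    {W : Set E} (hWX : W ⊆ X)
    (hW : ∀ p, 1 ≤ p → p < k → ∀ y ∈ W, y ∈ PerSet T X p → y ∈ Y p) {x : E} (hx : x ∈ X) :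
    volume {α : Fin m → ℝ | ∃ y ∈ W, x ≠ y ∧ ∀ i < k, h (T^[i] x) + ∑ j, α j * hfam j (T^[i] x) =
      h (T^[i] y) + ∑ j, α j * hfam j (T^[i] y)} = 0 := by
  have hk : 1 ≤ k := by
    by_contra hk
    have hk0 : k = 0 := by omega
    subst hk0
    have h1 := measure_mono_null (singleton_subset_iff.2 hx) hXH
    simp at h1
  have hit : ∀ i, Set.InjOn (T^[i]) X := fun i => hTinj.iterate hTX i
  have hmap : ∀ i, ∀ z ∈ X, T^[i] z ∈ X := fun i z hz => hTX.iterate i hz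
  set O : Set E := {y ∈ X | ∃ a b : ℕ, T^[b] y = T^[a] x} with hO
  have hOc : O.Countable := by
    have : O ⊆ ⋃ a : ℕ, ⋃ b : ℕ, {y ∈ X | T^[b] y = T^[a] x} := by
      rintro y ⟨hy, a, b, hab⟩
      exact mem_iUnion₂.2 ⟨a, b, hy, hab⟩
    refine Countable.mono this (countable_iUnion fun a => countable_iUnion fun b => ?_)
    refine Set.Subsingleton.countable ?_
    rintro y ⟨hy, h1⟩ z ⟨hz, h2⟩
    exact hit b hy hz (h1.trans h2.symm)
  -- the piece of period `q`
  have hinj : ∀ q : ℕ, ∀ y ∈ X, (∀ j, 1 ≤ j → j < q → T^[j] y ≠ y) →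
      ∀ i j : ℕ, i < q → j < q → T^[i] y = T^[j] y → i = j := by
    intro q y hy hp
    have key : ∀ i j : ℕ, i < j → j < q → T^[i] y ≠ T^[j] y := by
      intro i j hij hj heq
      have e1 : T^[j] y = T^[i] (T^[j - i] y) := by
        rw [← Function.iterate_add_apply]; congr 2; omega
      rw [e1] at heq
      exact hp (j - i) (by omega) (by omega) (hit i hy (hmap _ _ hy) heq).symm
    intro i j hi hj heq
    rcases lt_trichotomy i j with hlt | rfl | hlt
    · exact absurd heq (key i j hlt hj)
    · rfl
    · exact absurd heq.symm (key j i hlt hi)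
  have main : ∀ q : ℕ, 1 ≤ q → q ≤ k → ∀ Z : Set E, Z ⊆ X → μH[β * q] Z = 0 →
      (∀ y ∈ Z, ∀ j, 1 ≤ j → j < q → T^[j] y ≠ y) → (∀ y ∈ Z, y ∉ O) →
      volume {α : Fin m → ℝ | ∃ y ∈ Z, ∀ i < k, h (T^[i] x) + ∑ j, α j * hfam j (T^[i] x) =
      h (T^[i] y) + ∑ j, α j * hfam j (T^[i] y)} = 0 := by
    intro q hq1 hqk Z hZX hZ hZp hZO
    refine measure_mono_null ?_ (aux hβ hTX hTlip hh hinterp hfamHolder hx hqk hZX hZ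
      (fun y hy => hinj q y (hZX hy) (hZp y hy))
      (fun y hy i j _ _ heq => hZO y hy ⟨hZX hy, j, i, heq⟩))
    rintro α ⟨y, hy, hα⟩
    exact ⟨y, hy, fun i hi => hα i (hi.trans_le hqk)⟩
  have hsing : ∀ y ∈ O, y ≠ x →
      volume {α : Fin m → ℝ | ∃ z ∈ ({y} : Set E), ∀ i < 1, h (T^[i] x) + ∑ j, α j * hfam j (T^[i] x) =
      h (T^[i] z) + ∑ j, α j * hfam j (T^[i] z)} = 0 := by
    intro y hy hyx
    refine aux hβ hTX hTlip hh hinterp hfamHolder hx hk (singleton_subset_iff.2 hy.1) ?_ ?_ ?_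
    · have := Measure.noAtoms_hausdorff E (d := β * (1 : ℕ)) (by simpa using hβ)
      exact measure_singleton y
    · intro z _ i j hi hj _; omega
    · intro z hz i j hi hj heq
      have hi0 : i = 0 := by omega
      have hj0 : j = 0 := by omega
      subst hi0; subst hj0
      rw [mem_singleton_iff] at hz
      subst hz
      exact hyx heq
  have n1 : volume (⋃ y ∈ O \ {x}, {α : Fin m → ℝ | ∃ z ∈ ({y} : Set E), ∀ i < 1,
      h (T^[i] x) + ∑ j, α j * hfam j (T^[i] x) =
      h (T^[i] z) + ∑ j, α j * hfam j (T^[i] z)}) = 0 :=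
    (measure_biUnion_null_iff (hOc.mono diff_subset)).2 fun y hy => hsing y hy.1 hy.2
  have n2 : volume (⋃ q : ℕ, {α : Fin m → ℝ | ∃ y ∈ {y ∈ X | 1 ≤ q ∧ q < k ∧ y ∈ PerSet T X q ∧ y ∈ Y q ∧ y ∉ O},
      ∀ i < k, h (T^[i] x) + ∑ j, α j * hfam j (T^[i] x) =
      h (T^[i] y) + ∑ j, α j * hfam j (T^[i] y)}) = 0 := by
    refine measure_iUnion_null fun q => ?_
    by_cases hq : 1 ≤ q ∧ q < k
    · refine main q hq.1 hq.2.le _ (fun y hy => hy.1) ?_ ?_ ?_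
      · exact measure_mono_null (fun y hy => hy.2.2.2.2.1) (hY q hq.1 hq.2)
      · exact fun y hy => hy.2.2.2.1.2.2
      · exact fun y hy => hy.2.2.2.2.2
    · refine measure_mono_null ?_ (measure_empty (μ := volume))
      rintro α ⟨y, hy, _⟩
      exact hq ⟨hy.2.1, hy.2.2.1⟩
  have n3 := main k hk le_rfl {y ∈ X | (∀ j, 1 ≤ j → j < k → T^[j] y ≠ y) ∧ y ∉ O}
    (fun y hy => hy.1) (measure_mono_null (fun y hy => hy.1) hXH) (fun y hy => hy.2.1)
    (fun y hy => hy.2.2)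
  refine measure_mono_null ?_ (measure_union_null n1 (measure_union_null n2 n3))
  rintro α ⟨y, hyW, hxy, hα⟩
  have hyX := hWX hyW
  by_cases hyO : y ∈ O
  · left
    exact mem_iUnion₂.2 ⟨y, ⟨hyO, fun hh => hxy hh.symm⟩, y, rfl, fun i hi => hα i (by omega)⟩
  right
  by_cases hp : ∀ j, 1 ≤ j → j < k → T^[j] y ≠ y
  · right
    exact ⟨y, ⟨hyX, hp, hyO⟩, hα⟩
  · left
    push Not at hp
    classical
    have hq := Nat.find_spec hp
    set q := Nat.find hp with hqdef
    have hper : y ∈ PerSet T X q := by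
      refine ⟨hyX, hq.2.2, fun j hj hjq heq => ?_⟩
      exact Nat.find_min hp hjq ⟨hj, hjq.trans hq.2.1, heq⟩
    exact mem_iUnion.2 ⟨q, y, ⟨hyX, hq.1, hq.2.1, hper, hW q hq.1 hq.2.1 y hyW hper, hyO⟩, hα⟩

end

end TakensAux

/-- **Probabilistic Takens delay embedding theorem (extended version).** -/
theorem probabilistic_takens_extended {N k m : ℕ} {β : ℝ}
    (hβ : β ∈ Set.Ioc (0 : ℝ) 1)
    (X : Set (EuclideanSpace ℝ (Fin N))) (hX : MeasurableSet X)
    (μ : Measure (EuclideanSpace ℝ (Fin N))) [SigmaFinite μ]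
    (hμX : μ Xᶜ = 0)
    (T : EuclideanSpace ℝ (Fin N) → EuclideanSpace ℝ (Fin N))
    (hTX : Set.MapsTo T X X) (hTinj : Set.InjOn T X)
    (hTlip : LocallyHolderOn 1 T X)
    (hXH : μH[β * k] X = 0)
    (hper : ∀ p : ℕ, 1 ≤ p → p < k → ∃ Y : Set (EuclideanSpace ℝ (Fin N)),
      MeasurableSet Y ∧ μ (PerSet T X p \ Y) = 0 ∧ μH[β * p] Y = 0)
    (h : EuclideanSpace ℝ (Fin N) → ℝ)
    (hh : LocallyHolderOn β h X)
    (hfam : Fin m → EuclideanSpace ℝ (Fin N) → ℝ)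
    (hinterp : IsInterpolatingFamily X hfam (2 * k))
    (hfamHolder : ∀ j, LocallyHolderOn β (hfam j) X) :
    ∀ᵐ α ∂(volume : Measure (Fin m → ℝ)),
      ∃ X_α : Set (EuclideanSpace ℝ (Fin N)), X_α ⊆ X ∧ MeasurableSet X_α ∧
        μ (X \ X_α) = 0 ∧
        Set.InjOn (fun x => fun i : Fin k =>
          h (T^[(i : ℕ)] x) + ∑ j, α j * hfam j (T^[(i : ℕ)] x)) X_α := by
  have hβ0 : 0 < β := hβ.1
  choose! Y hYm hYμ hYH using hper
  set bad : Set (EuclideanSpace ℝ (Fin N)) :=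
    ⋃ p : ℕ, {y | 1 ≤ p ∧ p < k ∧ y ∈ PerSet T X p \ Y p} with hbad
  have hbad0 : μ bad = 0 := by
    refine measure_iUnion_null fun p => ?_
    by_cases hp : 1 ≤ p ∧ p < k
    · exact measure_mono_null (fun y hy => hy.2.2) (hYμ p hp.1 hp.2)
    · refine measure_mono_null ?_ (measure_empty (μ := μ))
      rintro y hy
      exact hp ⟨hy.1, hy.2.1⟩
  set W := X \ toMeasurable μ bad with hWdef
  have hWm : MeasurableSet W := hX.diff (measurableSet_toMeasurable _ _)
  have hWX : W ⊆ X := diff_subset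
  have hW : ∀ p, 1 ≤ p → p < k → ∀ y ∈ W, y ∈ PerSet T X p → y ∈ Y p := by
    intro p h1 h2 y hy hyp
    by_contra hn
    exact hy.2 (subset_toMeasurable μ bad (mem_iUnion.2 ⟨p, h1, h2, hyp, hn⟩))
  have hXW : μ (X \ W) = 0 := by
    refine measure_mono_null ?_ ((measure_toMeasurable bad).trans hbad0)
    rintro y ⟨hy1, hy2⟩
    by_contra hn
    exact hy2 ⟨hy1, hn⟩
  set ν := μ.toFinite with hν
  have hKex : ∀ n : ℕ, ∃ K ⊆ W, IsCompact K ∧ ν (W \ K) < ((n : ℝ≥0∞) + 1)⁻¹ := fun n =>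
    hWm.exists_isCompact_sdiff_lt (measure_ne_top ν W) (by simp)
  choose K hKW hKc hKν using hKex
  set S := ⋃ n, K n with hS
  have hSW : S ⊆ W := iUnion_subset hKW
  have hSm : MeasurableSet S := MeasurableSet.iUnion fun n => (hKc n).measurableSet
  have hWS : μ (W \ S) = 0 := by
    rw [← toFinite_apply_eq_zero_iff]
    have hb : ∀ n : ℕ, ν (W \ S) ≤ ((n : ℝ≥0∞) + 1)⁻¹ := fun n =>
      (measure_mono (diff_subset_diff_right (subset_iUnion K n))).trans (hKν n).le
    refine le_antisymm (le_of_forall_pos_le_add fun η hη => ?_) zero_le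
    rw [zero_add]
    obtain ⟨n, hn⟩ := ENNReal.exists_inv_nat_lt hη.ne'
    exact (hb n).trans ((ENNReal.inv_le_inv.2 le_self_add).trans hn.le)
  have hXS : μ (X \ S) = 0 := by
    refine measure_mono_null ?_ (measure_union_null hXW hWS)
    rintro y ⟨h1, h2⟩
    by_cases hy : y ∈ W
    · exact Or.inr ⟨hy, h2⟩
    · exact Or.inl ⟨h1, hy⟩
  -- the compact pieces
  let Φ : (Fin m → ℝ) × EuclideanSpace ℝ (Fin N) → Fin k → ℝ := fun p i =>
    h (T^[(i : ℕ)] p.2) + ∑ j, p.1 j * hfam j (T^[(i : ℕ)] p.2)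
  have hΦ : ContinuousOn Φ (univ ×ˢ X) := by
    refine continuousOn_pi.2 fun i => ?_
    have hmaps : MapsTo (Prod.snd : (Fin m → ℝ) × EuclideanSpace ℝ (Fin N) → _) (univ ×ˢ X) X :=
      fun p hp => hp.2
    refine ContinuousOn.add ?_ (continuousOn_finsetSum _ fun j _ => ContinuousOn.mul ?_ ?_)
    · exact (TakensAux.LocallyHolderOn.continuousOn hβ0
        (TakensAux.LocallyHolderOn.iter hβ0 hh hTlip hTX i)).comp continuousOn_snd hmaps
    · exact Continuous.continuousOn (by fun_prop)
    · exact (TakensAux.LocallyHolderOn.continuousOn hβ0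
        (TakensAux.LocallyHolderOn.iter hβ0 (hfamHolder j) hTlip hTX i)).comp continuousOn_snd hmaps
  let D : ℕ → ℕ → ℕ → Set (((Fin m → ℝ) × EuclideanSpace ℝ (Fin N)) × EuclideanSpace ℝ (Fin N)) :=
    fun a b n => (Metric.closedBall 0 n ×ˢ K a) ×ˢ K b
  let B : ℕ → ℕ → ℕ → Set ((Fin m → ℝ) × EuclideanSpace ℝ (Fin N)) := fun a b n =>
    Prod.fst '' (D a b n ∩ (fun p => (dist p.1.2 p.2, Φ p.1 - Φ (p.1.1, p.2))) ⁻¹'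
      (Ici (1 / ((n : ℝ) + 1)) ×ˢ {0}))
  have hB : ∀ a b n, MeasurableSet (B a b n) := by
    intro a b n
    have hDc : IsCompact (D a b n) :=
      ((isCompact_closedBall _ _).prod (hKc a)).prod (hKc b)
    have hcont : ContinuousOn (fun p : ((Fin m → ℝ) × EuclideanSpace ℝ (Fin N)) × EuclideanSpace ℝ (Fin N) =>
        (dist p.1.2 p.2, Φ p.1 - Φ (p.1.1, p.2))) (D a b n) := by
      refine ContinuousOn.prodMk (Continuous.continuousOn (by fun_prop)) (ContinuousOn.sub ?_ ?_)
      · exact hΦ.comp continuousOn_fst fun p hp => ⟨mem_univ _, hWX (hKW a hp.1.2)⟩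
      · exact hΦ.comp (f := fun p : ((Fin m → ℝ) × EuclideanSpace ℝ (Fin N)) × EuclideanSpace ℝ (Fin N) => (p.1.1, p.2))
          (Continuous.continuousOn (by fun_prop)) fun p hp => ⟨mem_univ _, hWX (hKW b hp.2)⟩
    have hcl := hcont.preimage_isClosed_of_isClosed hDc.isClosed
      ((isClosed_Ici (a := 1 / ((n : ℝ) + 1))).prod (isClosed_singleton (x := (0 : Fin k → ℝ))))
    have : IsCompact (B a b n) := (hDc.of_isClosed_subset hcl inter_subset_left).image continuous_fst
    exact this.measurableSet
  have hBnull : ∀ a b n, (volume.prod ν) (B a b n) = 0 := by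
    intro a b n
    rw [Measure.prod_apply_symm (hB a b n)]
    refine (lintegral_congr fun x => ?_).trans lintegral_zero
    by_cases hx : x ∈ X
    · refine measure_mono_null ?_ (TakensAux.section_null hβ0 hTX hTinj hTlip hh hinterp hfamHolder hXH Y
        hYH hWX hW hx)
      rintro α ⟨⟨⟨α', x'⟩, y⟩, ⟨hD, hd, h0⟩, heq⟩
      simp only [Prod.mk.injEq] at heq
      obtain ⟨rfl, rfl⟩ := heq
      refine ⟨y, hKW b hD.2, ?_, fun i hi => ?_⟩
      · rintro rfl
        simp only [dist_self, mem_Ici] at hd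
        have : 0 < 1 / ((n : ℝ) + 1) := by positivity
        linarith
      · exact congrFun (sub_eq_zero.1 h0) ⟨i, hi⟩
    · refine measure_mono_null ?_ (measure_empty (μ := volume))
      rintro α ⟨⟨⟨α', x'⟩, y⟩, ⟨hD, -⟩, heq⟩
      simp only [Prod.mk.injEq] at heq
      obtain ⟨rfl, rfl⟩ := heq
      exact hx (hWX (hKW a hD.1.2))
  have hAnull : (volume.prod ν) (⋃ a, ⋃ b, ⋃ n, B a b n) = 0 :=
    measure_iUnion_null fun a => measure_iUnion_null fun b => measure_iUnion_null fun n => hBnull a b n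
  filter_upwards [Measure.measure_ae_null_of_prod_null hAnull] with α hα
  have hα' : μ (Prod.mk α ⁻¹' (⋃ a, ⋃ b, ⋃ n, B a b n)) = 0 := toFinite_apply_eq_zero_iff.1 hα
  set Q := Prod.mk α ⁻¹' (⋃ a, ⋃ b, ⋃ n, B a b n) with hQ
  refine ⟨S \ toMeasurable μ Q, fun y hy => hWX (hSW hy.1),
    hSm.diff (measurableSet_toMeasurable _ _), ?_, ?_⟩
  · refine measure_mono_null ?_ (measure_union_null hXS ((measure_toMeasurable Q).trans hα'))
    rintro y ⟨h1, h2⟩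
    by_cases hy : y ∈ S
    · right
      by_contra hn
      exact h2 ⟨hy, hn⟩
    · exact Or.inl ⟨h1, hy⟩
  · rintro x ⟨hxS, hxQ⟩ y ⟨hyS, -⟩ hxy
    by_contra hne
    apply hxQ
    apply subset_toMeasurable μ Q
    obtain ⟨a, ha⟩ := mem_iUnion.1 hxS
    obtain ⟨b, hb⟩ := mem_iUnion.1 hyS
    obtain ⟨n₁, hn₁⟩ := exists_nat_ge ‖α‖
    obtain ⟨n₂, hn₂⟩ := exists_nat_one_div_lt (dist_pos.2 hne)
    refine mem_iUnion.2 ⟨a, mem_iUnion.2 ⟨b, mem_iUnion.2 ⟨max n₁ n₂, ((α, x), y), ⟨⟨⟨?_, ha⟩, hb⟩, ?_, ?_⟩, rfl⟩⟩⟩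
    · simp only [mem_closedBall_zero_iff]
      exact hn₁.trans (by exact_mod_cast le_max_left n₁ n₂)
    · simp only [mem_Ici]
      refine le_trans ?_ hn₂.le
      apply one_div_le_one_div_of_le (by positivity)
      have : (n₂ : ℝ) ≤ ((max n₁ n₂ : ℕ) : ℝ) := by exact_mod_cast le_max_right n₁ n₂
      linarith
    · exact sub_eq_zero.2 hxy
end

section
/- Let X ⊆ ℝ^N be a Borel set, μ a Borel σ-finite measure on X, and T : X → X an injective, locally Lipschitz map such that μ is T-invariant (μ(T^{-1}Y) = μ(Y) for all Borel Y ⊆ X). Take k ∈ ℕ and β ∈ (0,1] such that H^{βk}(X) = 0, and assume that μ|_{Per_p(T)} is mutually singular with H^{βp} for every p = 1,…,k−1. Let h : X → ℝ be locally β-Hölder and let h_1,…,h_m : X → ℝ be a 2k-interpolating family on X consisting of locally β-Hölder functions; for α ∈ ℝ^m set h_α = h + Σ_{j=1}^m α_j h_j. Then for Lebesgue almost every α ∈ ℝ^m there exists a Borel set X_α ⊆ X of full μ-measure satisfying T(X_α) ⊆ X_α such that the delay-coordinate map φ_α^T(x) = (h_α(x), h_α(Tx), …, h_α(T^{k−1}x))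 is injective on X_α. -/
open MeasureTheory Set
open scoped InnerProductSpace ENNReal

namespace PTaux

lemma LocallyHolderOn.continuousOn' {E F : Type*} [NormedAddCommGroup E] [NormedAddCommGroup F]
    {β : ℝ} (hβ : 0 < β) {f : E → F} {X : Set E} (hf : LocallyHolderOn β f X) :
    ContinuousOn f X := by
  intro x hx
  obtain ⟨U, hU, hxU, C, hC, H⟩ := hf x hx
  rw [ContinuousWithinAt, tendsto_iff_norm_sub_tendsto_zero]
  have h1 : Filter.Tendsto (fun y => C * ‖y - x‖ ^ β) (nhdsWithin x X) (nhds 0) := by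
    have : ContinuousAt (fun y => C * ‖y - x‖ ^ β) x := by
      refine ContinuousAt.mul continuousAt_const ?_
      refine ContinuousAt.rpow_const (by fun_prop) (Or.inr hβ.le)
    have h2 := this.tendsto
    simp only [sub_self, norm_zero, Real.zero_rpow hβ.ne', mul_zero] at h2
    exact h2.mono_left nhdsWithin_le_nhds
  refine squeeze_zero' (Filter.Eventually.of_forall fun _ => norm_nonneg _) ?_ h1
  filter_upwards [self_mem_nhdsWithin, nhdsWithin_le_nhds (hU.mem_nhds hxU)] with y hy hyU
  exact H y ⟨hyU, hy⟩ x ⟨hxU, hx⟩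

lemma LocallyHolderOn.mono' {E F : Type*} [NormedAddCommGroup E] [NormedAddCommGroup F]
    {β : ℝ} {f : E → F} {X Y : Set E} (hf : LocallyHolderOn β f X) (h : Y ⊆ X) :
    LocallyHolderOn β f Y := by
  intro x hx
  obtain ⟨U, hU, hxU, C, hC, H⟩ := hf x (h hx)
  exact ⟨U, hU, hxU, C, hC, fun y hy y' hy' => H y ⟨hy.1, h hy.2⟩ y' ⟨hy'.1, h hy'.2⟩⟩

lemma LocallyHolderOn.add' {E F : Type*} [NormedAddCommGroup E] [NormedAddCommGroup F]
    {β : ℝ} {f g : E → F} {X : Set E} (hf : LocallyHolderOn β f X) (hg : LocallyHolderOn β g X) :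
    LocallyHolderOn β (fun x => f x + g x) X := by
  intro x hx
  obtain ⟨U, hU, hxU, C, hC, H⟩ := hf x hx
  obtain ⟨U', hU', hxU', C', hC', H'⟩ := hg x hx
  refine ⟨U ∩ U', hU.inter hU', ⟨hxU, hxU'⟩, C + C', by positivity, fun y hy y' hy' => ?_⟩
  have h1 := H y ⟨hy.1.1, hy.2⟩ y' ⟨hy'.1.1, hy'.2⟩
  have h2 := H' y ⟨hy.1.2, hy.2⟩ y' ⟨hy'.1.2, hy'.2⟩
  calc ‖f y + g y - (f y' + g y')‖ = ‖(f y - f y') + (g y - g y')‖ := by congr 1; abel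
    _ ≤ _ := norm_add_le _ _
    _ ≤ (C + C') * ‖y - y'‖ ^ β := by linarith

lemma locallyHolderOn_const {E F : Type*} [NormedAddCommGroup E] [NormedAddCommGroup F]
    {β : ℝ} (c : F) (X : Set E) : LocallyHolderOn β (fun _ : E => c) X := by
  intro x _
  refine ⟨univ, isOpen_univ, mem_univ _, 1, one_pos, fun y _ y' _ => ?_⟩
  simp only [sub_self, norm_zero, one_mul]
  positivity

lemma LocallyHolderOn.sum' {E F ι : Type*} [NormedAddCommGroup E] [NormedAddCommGroup F]
    {β : ℝ} {X : Set E} (s : Finset ι) {f : ι → E → F} (hf : ∀ i, LocallyHolderOn β (f i) X) :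
    LocallyHolderOn β (fun x => ∑ i ∈ s, f i x) X := by
  classical
  induction s using Finset.induction_on with
  | empty => simpa using locallyHolderOn_const (0 : F) X
  | insert a s ha ih =>
    simp only [Finset.sum_insert ha]
    exact LocallyHolderOn.add' (hf a) ih

lemma LocallyHolderOn.smul_const' {E F : Type*} [NormedAddCommGroup E] [NormedAddCommGroup F]
    [NormedSpace ℝ F]
    {β : ℝ} {f : E → ℝ} {X : Set E} (hf : LocallyHolderOn β f X) (v : F) :
    LocallyHolderOn β (fun x => f x • v) X := by
  intro x hx
  obtain ⟨U, hU, hxU, C, hC, H⟩ := hf x hx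
  refine ⟨U, hU, hxU, C * (‖v‖ + 1), by positivity, fun y hy y' hy' => ?_⟩
  have h1 := H y hy y' hy'
  rw [← sub_smul, norm_smul]
  calc _ ≤ (C * ‖y - y'‖ ^ β) * (‖v‖ + 1) := by gcongr; linarith
    _ = _ := by ring

lemma LocallyHolderOn.comp' {E F : Type*} [NormedAddCommGroup E] [NormedAddCommGroup F]
    {β : ℝ} (hβ : 0 < β) {f : E → F} {g : E → E} {X : Set E} (hf : LocallyHolderOn β f X)
    (hg : LocallyHolderOn 1 g X) (hm : MapsTo g X X) :
    LocallyHolderOn β (fun x => f (g x)) X := by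
  intro x hx
  obtain ⟨U, hU, hxU, C, hC, H⟩ := hf (g x) (hm hx)
  obtain ⟨U', hU', hxU', C', hC', H'⟩ := hg x hx
  have hcont := LocallyHolderOn.continuousOn' one_pos hg
  obtain ⟨O, hO, hxO, hOs⟩ := mem_nhdsWithin.1 ((hcont x hx) (hU.mem_nhds hxU))
  refine ⟨O ∩ U', hO.inter hU', ⟨hxO, hxU'⟩, C * C' ^ β, by positivity, fun y hy y' hy' => ?_⟩
  have h1 := H (g y) ⟨hOs ⟨hy.1.1, hy.2⟩, hm hy.2⟩ (g y') ⟨hOs ⟨hy'.1.1, hy'.2⟩, hm hy'.2⟩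
  have h2 := H' y ⟨hy.1.2, hy.2⟩ y' ⟨hy'.1.2, hy'.2⟩
  rw [Real.rpow_one] at h2
  calc _ ≤ C * ‖g y - g y'‖ ^ β := h1
    _ ≤ C * (C' * ‖y - y'‖) ^ β := by gcongr
    _ = _ := by rw [Real.mul_rpow hC'.le (norm_nonneg _)]; ring

lemma LocallyHolderOn.iterate' {E : Type*} [NormedAddCommGroup E]
    {T : E → E} {X : Set E} (hT : LocallyHolderOn 1 T X) (hm : MapsTo T X X) (n : ℕ) :
    LocallyHolderOn 1 (T^[n]) X := by
  induction n with
  | zero =>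
    intro x _
    exact ⟨univ, isOpen_univ, mem_univ _, 1, one_pos, fun y _ y' _ => by simp⟩
  | succ n ih => exact LocallyHolderOn.comp' (f := T^[n]) one_pos ih hT hm

lemma inner_null {E : Type*} [NormedAddCommGroup E] [MeasurableSpace E] [BorelSpace E]
    {β : ℝ} (hβ : 0 < β) {r : ℕ} {L : Set E}
    {M : E → (Fin r → ℝ) →L[ℝ] (Fin r → ℝ)} {c : E → Fin r → ℝ} {C D B : ℝ}
    (hC : 0 ≤ C) (hD : 0 ≤ D) (hB : 0 ≤ B)
    (hM : ∀ y ∈ L, ∀ y' ∈ L, ‖M y - M y'‖ ≤ C * ‖y - y'‖ ^ β)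
    (hc : ∀ y ∈ L, ∀ y' ∈ L, ‖c y - c y'‖ ≤ D * ‖y - y'‖ ^ β)
    (hM1 : ∀ y ∈ L, ‖M y - 1‖ ≤ 1 / 2) (hcB : ∀ y ∈ L, ‖c y‖ ≤ B)
    (hH : μH[β * r] L = 0) :
    (volume : Measure (Fin r → ℝ)) {t | ∃ y ∈ L, M y t + c y = 0} = 0 := by
  have low : ∀ y ∈ L, ∀ t, ‖t‖ ≤ 2 * ‖M y t‖ := by
    intro y hy t
    have h1 : t = M y t - (M y - 1) t := by simp
    have h2 : ‖(M y - 1) t‖ ≤ 1 / 2 * ‖t‖ :=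
      ((M y - 1).le_opNorm t).trans (by gcongr; exact hM1 y hy)
    have h3 : ‖t‖ ≤ ‖M y t‖ + ‖(M y - 1) t‖ := by
      conv_lhs => rw [h1]
      exact norm_sub_le _ _
    linarith
  set L' := {y ∈ L | ∃ t, M y t + c y = 0} with hL'
  have : ∃ G : E → (Fin r → ℝ), ∀ y ∈ L', M y (G y) + c y = 0 := by
    refine ⟨fun y => by classical exact if h : y ∈ L' then h.2.choose else 0, fun y hy => ?_⟩
    simp only [hy, dite_true]
    exact hy.2.choose_spec
  obtain ⟨G, hG⟩ := this
  have bd : ∀ y ∈ L', ‖G y‖ ≤ 2 * B := by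
    intro y hy
    have h1 := low y hy.1 (G y)
    have h2 : M y (G y) = - c y := eq_neg_of_add_eq_zero_left (hG y hy)
    rw [h2, norm_neg] at h1
    linarith [hcB y hy.1]
  have hsub : {t | ∃ y ∈ L, M y t + c y = 0} ⊆ G '' L' := by
    rintro t ⟨y, hy, ht⟩
    have hy' : y ∈ L' := ⟨hy, t, ht⟩
    refine ⟨y, hy', ?_⟩
    have h1 := low y hy (G y - t)
    have h2 : M y (G y - t) = 0 := by
      rw [map_sub, sub_eq_zero]
      exact add_right_cancel ((hG y hy').trans ht.symm)
    rw [h2, norm_zero, mul_zero] at h1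
    exact sub_eq_zero.1 (norm_le_zero_iff.1 h1)
  have hhold : HolderOnWith (Real.toNNReal (2 * (D + C * (2 * B)))) (Real.toNNReal β) G L' := by
    intro y hy y' hy'
    have h1 := low y hy.1 (G y - G y')
    have h2 : M y (G y - G y') = -(c y - c y') - (M y - M y') (G y') := by
      have e1 : M y (G y) = - c y := eq_neg_of_add_eq_zero_left (hG y hy)
      have e2 : M y' (G y') = - c y' := eq_neg_of_add_eq_zero_left (hG y' hy')
      rw [map_sub, sub_apply, e1, e2]; abel
    have h3 : ‖M y (G y - G y')‖ ≤ D * ‖y - y'‖ ^ β + (C * ‖y - y'‖ ^ β) * (2 * B) := by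
      rw [h2]
      refine (norm_sub_le _ _).trans ?_
      rw [norm_neg]
      refine add_le_add (hc y hy.1 y' hy'.1) ?_
      refine ((M y - M y').le_opNorm _).trans ?_
      gcongr
      · exact hM y hy.1 y' hy'.1
      · exact bd y' hy'
    have h4 : dist (G y) (G y') ≤ 2 * (D + C * (2 * B)) * dist y y' ^ β := by
      rw [dist_eq_norm, dist_eq_norm]; nlinarith
    rw [edist_dist, edist_dist, Real.coe_toNNReal _ hβ.le,
      ENNReal.ofReal_rpow_of_nonneg dist_nonneg hβ.le, show ((Real.toNNReal (2 * (D + C * (2 * B))) : NNReal) : ℝ≥0∞) =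
        ENNReal.ofReal (2 * (D + C * (2 * B))) from rfl,
      ← ENNReal.ofReal_mul (by positivity)]
    exact ENNReal.ofReal_le_ofReal h4
  have himg := hhold.hausdorffMeasure_image_le (by simpa using hβ) (d := (r : ℝ)) (by positivity)
  rw [Real.coe_toNNReal _ hβ.le] at himg
  have hz : μH[β * r] L' = 0 := measure_mono_null (fun y hy => hy.1) hH
  rw [hz, mul_zero] at himg
  have hv : (volume : Measure (Fin r → ℝ)) = μH[(r : ℝ)] := by
    have := hausdorffMeasure_pi_real (ι := Fin r)
    rw [Fintype.card_fin] at this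
    exact this.symm
  rw [hv]
  exact measure_mono_null hsub (le_antisymm himg bot_le)

lemma closed_proj {P E Q : Type*} [TopologicalSpace P] [TopologicalSpace E] [T2Space E]
    [TopologicalSpace Q]
    {C : Set P} (hC : IsClosed C) {L : Set E} (hL : IsCompact L) {f : P × E → Q}
    (hf : ContinuousOn f (C ×ˢ L)) {S : Set Q} (hS : IsClosed S) :
    IsClosed {p | p ∈ C ∧ ∃ y ∈ L, f (p, y) ∈ S} := by
  have h1 : IsClosed ((C ×ˢ L) ∩ f ⁻¹' S) :=
    hf.preimage_isClosed_of_isClosed (hC.prod hL.isClosed) hS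
  have : CompactSpace L := isCompact_iff_compactSpace.1 hL
  have h2 : IsClosed ((fun z : P × L => ((z.1, (z.2 : E)) : P × E)) ⁻¹' ((C ×ˢ L) ∩ f ⁻¹' S)) :=
    h1.preimage (by fun_prop)
  have h3 := isClosedMap_fst_of_compactSpace _ h2
  convert h3 using 1
  ext p
  constructor
  · rintro ⟨hp, y, hy, h⟩
    exact ⟨(p, ⟨y, hy⟩), ⟨⟨hp, hy⟩, h⟩, rfl⟩
  · rintro ⟨⟨p', y⟩, ⟨⟨hp, hy⟩, h⟩, rfl⟩
    exact ⟨hp, y, hy, h⟩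

lemma key_null {E : Type*} [NormedAddCommGroup E] [SecondCountableTopology E]
    [MeasurableSpace E] [BorelSpace E]
    {V : Type*} [NormedAddCommGroup V] [NormedSpace ℝ V] [FiniteDimensional ℝ V]
    [MeasurableSpace V] [BorelSpace V] (ν : Measure V) [ν.IsAddHaarMeasure]
    {β : ℝ} (hβ : 0 < β) {r : ℕ} {K : Set E} (hK : IsCompact K)
    {A : E → V →L[ℝ] (Fin r → ℝ)} {b : E → Fin r → ℝ}
    (hA : LocallyHolderOn β A K) (hb : LocallyHolderOn β b K) (hH : μH[β * r] K = 0) :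
    ν {α | ∃ y ∈ K, Function.Surjective (A y) ∧ A y α + b y = 0} = 0 := by
  have hAc := LocallyHolderOn.continuousOn' hβ hA
  have hbc := LocallyHolderOn.continuousOn' hβ hb
  have local_null : ∀ y₀ ∈ K, Function.Surjective (A y₀) → ∃ ρ > (0 : ℝ),
      ν {α | ∃ y ∈ K ∩ Metric.closedBall y₀ ρ, A y α + b y = 0} = 0 := by
    intro y₀ hy₀ hsurj
    obtain ⟨S₀, hS₀⟩ := (A y₀ : V →ₗ[ℝ] (Fin r → ℝ)).exists_rightInverse_of_surjective
      (LinearMap.range_eq_top.2 hsurj)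
    set S : (Fin r → ℝ) →L[ℝ] V := LinearMap.toContinuousLinearMap S₀ with hS
    have hS1 : (A y₀).comp S = 1 := by
      ext1 t
      exact LinearMap.congr_fun hS₀ t
    obtain ⟨U, hU, hxU, C, hC, H⟩ := hA y₀ hy₀
    obtain ⟨U', hU', hxU', C', hC', H'⟩ := hb y₀ hy₀
    have hcontS : ContinuousOn (fun y => (A y).comp S) K :=
      hAc.clm_comp continuousOn_const
    have hnear : ∀ᶠ y in nhdsWithin y₀ K, ‖(A y).comp S - 1‖ < 1 / 2 := by
      have := (hcontS y₀ hy₀).tendsto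
      rw [hS1] at this
      have := (tendsto_iff_norm_sub_tendsto_zero.1 this)
      exact this.eventually_lt_const (by norm_num)
    obtain ⟨O, hO, hxO, hOs⟩ := mem_nhdsWithin.1 hnear
    obtain ⟨ρ, hρ, hρs⟩ := Metric.nhds_basis_closedBall.mem_iff.1
      (((hU.inter hU').inter hO).mem_nhds ⟨⟨hxU, hxU'⟩, hxO⟩)
    refine ⟨ρ, hρ, ?_⟩
    set L := K ∩ Metric.closedBall y₀ ρ with hL
    have hLc : IsCompact L := hK.inter_right Metric.isClosed_closedBall
    have hLK : L ⊆ K := inter_subset_left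
    have hclosed : IsClosed {α : V | ∃ y ∈ L, A y α + b y = 0} := by
      have := closed_proj (P := V) (C := univ) isClosed_univ hLc
        (f := fun z => A z.2 z.1 + b z.2) (S := {0}) ?_ isClosed_singleton
      · simpa using this
      · refine ContinuousOn.add (ContinuousOn.clm_apply ?_ continuousOn_fst) ?_
        · exact hAc.comp continuousOn_snd (fun z hz => hLK hz.2)
        · exact hbc.comp continuousOn_snd (fun z hz => hLK hz.2)
    have := ae_mem_of_ae_add_linearMap_mem (S : (Fin r → ℝ) →ₗ[ℝ] V) volume ν
      hclosed.measurableSet.compl ?_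
    · rw [ae_iff] at this
      simpa using this
    · intro α
      rw [ae_iff]
      have hc0 : ContinuousOn (fun y => A y α + b y) L :=
        ((hAc.mono hLK).clm_apply continuousOn_const).add (hbc.mono hLK)
      obtain ⟨B, hB⟩ := hLc.exists_bound_of_continuousOn hc0
      have := inner_null hβ (L := L) (M := fun y => (A y).comp S) (c := fun y => A y α + b y)
        (C := C * ‖S‖) (D := C * ‖α‖ + C') (B := |B|) (by positivity) (by positivity)
        (by positivity) ?_ ?_ ?_ ?_ (measure_mono_null hLK hH)
      · refine measure_mono_null ?_ this
        intro t ht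
        simp only [mem_compl_iff, mem_ofPred_eq, not_not] at ht
        obtain ⟨y, hy, h⟩ := ht
        refine ⟨y, hy, ?_⟩
        rw [← h]
        simp only [ContinuousLinearMap.comp_apply, ContinuousLinearMap.coe_coe, map_add]
        abel
      · intro y hy y' hy'
        have := H y ⟨(hρs hy.2).1.1, hy.1⟩ y' ⟨(hρs hy'.2).1.1, hy'.1⟩
        beta_reduce
        rw [← ContinuousLinearMap.sub_comp]
        calc _ ≤ ‖A y - A y'‖ * ‖S‖ := ContinuousLinearMap.opNorm_comp_le _ _
          _ ≤ (C * ‖y - y'‖ ^ β) * ‖S‖ := by gcongr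
          _ = _ := by ring
      · intro y hy y' hy'
        have h1 := H y ⟨(hρs hy.2).1.1, hy.1⟩ y' ⟨(hρs hy'.2).1.1, hy'.1⟩
        have h2 := H' y ⟨(hρs hy.2).1.2, hy.1⟩ y' ⟨(hρs hy'.2).1.2, hy'.1⟩
        calc ‖A y α + b y - (A y' α + b y')‖ = ‖(A y - A y') α + (b y - b y')‖ := by
              congr 1; rw [sub_apply]; abel
          _ ≤ ‖A y - A y'‖ * ‖α‖ + ‖b y - b y'‖ :=
              (norm_add_le _ _).trans (by gcongr; exact ContinuousLinearMap.le_opNorm _ _)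
          _ ≤ (C * ‖y - y'‖ ^ β) * ‖α‖ + C' * ‖y - y'‖ ^ β := by gcongr
          _ = _ := by ring
      · intro y hy
        exact (hOs ⟨(hρs hy.2).2, hy.1⟩).le
      · intro y hy
        exact (hB y hy).trans (le_abs_self B)
  choose! ρ hρ hnull using local_null
  obtain ⟨t, hts, htc, htcov⟩ := TopologicalSpace.countable_cover_nhdsWithin
    (f := fun y => Metric.closedBall y (ρ y)) (s := {y ∈ K | Function.Surjective (A y)})
    (fun y hy => nhdsWithin_le_nhds (Metric.closedBall_mem_nhds y (hρ y hy.1 hy.2)))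
  refine measure_mono_null ?_ ((measure_biUnion_null_iff htc).2
    (fun y hy => hnull y (hts hy).1 (hts hy).2))
  rintro α ⟨y, hy, hs, h⟩
  obtain ⟨z, hz, hyz⟩ := mem_iUnion₂.1 (htcov ⟨hy, hs⟩)
  exact mem_iUnion₂.2 ⟨z, hz, y, ⟨hy, hyz⟩, h⟩

lemma interp_exists {E : Type*} {m K : ℕ} {X : Set E} {h : Fin m → E → ℝ}
    (hi : IsInterpolatingFamily X h K) (s : Finset E) (hs : ∀ z ∈ s, z ∈ X) (hc : s.card ≤ K)
    (g : E → ℝ) : ∃ α : Fin m → ℝ, ∀ z ∈ s, ∑ j, α j * h j z = g z := by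
  have e := s.equivFin
  have hr := hi s.card hc (fun i => (e.symm i : E)) (fun i => hs _ (e.symm i).2)
    (Subtype.val_injective.comp e.symm.injective)
  set Mx : Matrix (Fin s.card) (Fin m) ℝ := Matrix.of fun i j => h j (e.symm i) with hMx
  have hsurj : Function.Surjective Mx.mulVecLin := by
    rw [← LinearMap.range_eq_top]
    apply Submodule.eq_top_of_finrank_eq
    rw [Module.finrank_fin_fun]
    exact hr
  obtain ⟨α, hα⟩ := hsurj (fun i => g (e.symm i))
  refine ⟨α, fun z hz => ?_⟩
  have := congrFun hα (e ⟨z, hz⟩)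
  simp only [Matrix.mulVecLin_apply, Matrix.mulVec, dotProduct, hMx, Matrix.of_apply,
    Equiv.symm_apply_apply] at this
  rw [← this]
  exact Finset.sum_congr rfl fun j _ => mul_comm _ _

lemma exists_sigma_compact {E : Type*} [NormedAddCommGroup E] [NormedSpace ℝ E]
    [FiniteDimensional ℝ E] [MeasurableSpace E] [BorelSpace E] (μ : Measure E) [SigmaFinite μ]
    {M : Set E} (hM : MeasurableSet M) :
    ∃ K : ℕ → Set E, (∀ n, IsCompact (K n)) ∧ (∀ n, K n ⊆ M) ∧ μ (M \ ⋃ n, K n) = 0 := by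
  have : ProperSpace E := FiniteDimensional.proper ℝ E
  have h1 : ∀ n : ℕ, ∃ K, K ⊆ M ∧ IsCompact K ∧
      μ.toFinite M < μ.toFinite K + ((n : ℝ≥0∞) + 1)⁻¹ := fun n =>
    hM.exists_isCompact_lt_add (measure_ne_top _ _) (by simp)
  choose K hKM hK hlt using h1
  refine ⟨K, hK, hKM, ?_⟩
  apply absolutelyContinuous_toFinite μ
  have h2 : ∀ n : ℕ, μ.toFinite (M \ ⋃ n, K n) ≤ ((n : ℝ≥0∞) + 1)⁻¹ := by
    intro n
    calc _ ≤ μ.toFinite (M \ K n) := measure_mono (sdiff_subset_sdiff_right (subset_iUnion K n))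
      _ = μ.toFinite M - μ.toFinite (K n) :=
        measure_sdiff (hKM n) (hK n).measurableSet.nullMeasurableSet (measure_ne_top _ _)
      _ ≤ _ := by
        rw [tsub_le_iff_left]; exact (hlt n).le
  have h3 : Filter.Tendsto (fun n : ℕ => ((n : ℝ≥0∞) + 1)⁻¹) Filter.atTop (nhds 0) := by
    have := ENNReal.tendsto_inv_nat_nhds_zero.comp (Filter.tendsto_add_atTop_nat 1)
    simpa [Function.comp_def] using this
  exact le_antisymm (ge_of_tendsto' h3 h2) bot_le

lemma fiber_null {E : Type*} [NormedAddCommGroup E] [SecondCountableTopology E]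
    [MeasurableSpace E] [BorelSpace E] {k m : ℕ} {β : ℝ} (hβ : 0 < β) {X : Set E}
    {T : E → E} (hTX : MapsTo T X X) (hTlip : LocallyHolderOn 1 T X)
    {h : E → ℝ} (hh : LocallyHolderOn β h X) {hfam : Fin m → E → ℝ}
    (hinterp : IsInterpolatingFamily X hfam (2 * k))
    (hfamHolder : ∀ j, LocallyHolderOn β (hfam j) X)
    {x : E} (hx : x ∈ X) {r : ℕ} (hr : r ≤ k) {K : Set E} (hK : IsCompact K) (hKX : K ⊆ X)
    (hH : μH[β * r] K = 0) :
    (volume : Measure (Fin m → ℝ)) {α | ∃ y ∈ K,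
      (∀ i j : Fin r, T^[(i : ℕ)] y = T^[(j : ℕ)] y → i = j) ∧
      (∀ i j : Fin r, T^[(i : ℕ)] y ≠ T^[(j : ℕ)] x) ∧
      ∀ i : Fin r, h (T^[(i : ℕ)] x) + ∑ j, α j * hfam j (T^[(i : ℕ)] x) =
        h (T^[(i : ℕ)] y) + ∑ j, α j * hfam j (T^[(i : ℕ)] y)} = 0 := by
  classical
  have hit : ∀ n, MapsTo (T^[n]) X X := fun n => hTX.iterate n
  let Bs : Fin r → Fin m → (Fin m → ℝ) →L[ℝ] (Fin r → ℝ) := fun i j =>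
    (ContinuousLinearMap.single ℝ (fun _ : Fin r => ℝ) i).comp (ContinuousLinearMap.proj j)
  let A : E → (Fin m → ℝ) →L[ℝ] (Fin r → ℝ) := fun y =>
    ∑ i : Fin r, ∑ j, (hfam j (T^[(i : ℕ)] x) + (-1) • hfam j (T^[(i : ℕ)] y)) • Bs i j
  let b : E → (Fin r → ℝ) := fun y =>
    ∑ i : Fin r, (h (T^[(i : ℕ)] x) + (-1) • h (T^[(i : ℕ)] y)) • (Pi.single i 1 : Fin r → ℝ)
  have neg_h : ∀ (f : E → ℝ), LocallyHolderOn β f X → ∀ (c : ℝ) (n : ℕ),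
      LocallyHolderOn β (fun y => c + (-1) • f (T^[n] y)) K := by
    intro f hf c n
    refine LocallyHolderOn.mono' ?_ hKX
    refine LocallyHolderOn.add' (locallyHolderOn_const c X) ?_
    have h1 := LocallyHolderOn.comp' hβ hf (LocallyHolderOn.iterate' hTlip hTX n) (hit n)
    have := LocallyHolderOn.smul_const' h1 (-1 : ℝ)
    simpa using this
  have hA : LocallyHolderOn β A K :=
    LocallyHolderOn.sum' _ fun i => LocallyHolderOn.sum' _ fun j =>
      LocallyHolderOn.smul_const' (neg_h _ (hfamHolder j) _ _) _
  have hb : LocallyHolderOn β b K :=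
    LocallyHolderOn.sum' _ fun i => LocallyHolderOn.smul_const' (neg_h _ hh _ _) _
  have Aapp : ∀ y α i, A y α i =
      ∑ j, α j * hfam j (T^[(i : ℕ)] x) - ∑ j, α j * hfam j (T^[(i : ℕ)] y) := by
    intro y α i
    have : A y α i = ∑ i' : Fin r, ∑ j, (hfam j (T^[(i' : ℕ)] x) + (-1) • hfam j (T^[(i' : ℕ)] y)) *
        (Pi.single i' (α j) : Fin r → ℝ) i := by
      simp [A, Bs, ContinuousLinearMap.sum_apply, Finset.sum_apply]
    rw [this, Finset.sum_eq_single i]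
    · rw [← Finset.sum_sub_distrib]
      refine Finset.sum_congr rfl fun j _ => ?_
      rw [Pi.single_eq_same]
      simp only [neg_smul, one_smul]
      ring
    · intro i' _ hne
      refine Finset.sum_eq_zero fun j _ => ?_
      rw [Pi.single_eq_of_ne hne.symm, mul_zero]
    · simp
  have bapp : ∀ y i, b y i = h (T^[(i : ℕ)] x) - h (T^[(i : ℕ)] y) := by
    intro y i
    simp [b, Finset.sum_apply, Pi.single_apply, sub_eq_add_neg]
  refine measure_mono_null ?_ (key_null (volume : Measure (Fin m → ℝ)) hβ hK hA hb hH)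
  rintro α ⟨y, hy, hinj, hdis, heq⟩
  refine ⟨y, hy, ?_, ?_⟩
  · intro v
    let q : Fin r → E := fun i => T^[(i : ℕ)] y
    let p : Fin r → E := fun i => T^[(i : ℕ)] x
    have hq : Function.Injective q := fun i j hij => hinj i j hij
    obtain ⟨a, ha⟩ := interp_exists hinterp (Finset.univ.image p ∪ Finset.univ.image q)
      (by
        intro z hz
        simp only [Finset.mem_union, Finset.mem_image, Finset.mem_univ, true_and] at hz
        rcases hz with ⟨i, rfl⟩ | ⟨i, rfl⟩
        · exact hit _ hx
        · exact hit _ (hKX hy))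
      (by
        refine (Finset.card_union_le _ _).trans ?_
        have h1 := Finset.card_image_le (s := (Finset.univ : Finset (Fin r))) (f := p)
        have h2 := Finset.card_image_le (s := (Finset.univ : Finset (Fin r))) (f := q)
        simp only [Finset.card_univ, Fintype.card_fin] at h1 h2
        omega)
      (Function.extend q (fun i => - v i) (fun _ => 0))
    refine ⟨a, ?_⟩
    ext i
    rw [Aapp]
    have e1 := ha (p i) (by simp)
    have e2 := ha (q i) (by simp)
    rw [hq.extend_apply] at e2
    rw [Function.extend_apply' _ _ _ (by rintro ⟨j, hj⟩; exact hdis j i hj)] at e1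
    simp only [p, q] at e1 e2
    rw [e1, e2]; ring
  · ext i
    rw [Pi.add_apply, Aapp, bapp]
    have := heq i
    simp only [Pi.zero_apply]
    linarith

lemma meas_aux {E F : Type*} [TopologicalSpace E] [MeasurableSpace E] [BorelSpace E]
    [TopologicalSpace F] [MeasurableSpace F] [BorelSpace F] {X : Set E} (hX : MeasurableSet X)
    {f : E → F} (hf : ContinuousOn f X) {S : Set F} (hS : MeasurableSet S) :
    MeasurableSet (X ∩ f ⁻¹' S) := by
  have h1 : Measurable (X.domRestrict f) := (continuousOn_iff_continuous_domRestrict.1 hf).measurable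
  have h2 := hX.subtype_image (h1 hS)
  convert h2 using 1
  ext z
  constructor
  · rintro ⟨hz, hs⟩
    exact ⟨⟨z, hz⟩, hs, rfl⟩
  · rintro ⟨⟨w, hw⟩, hs, rfl⟩
    exact ⟨hw, hs⟩

lemma meas_fix {E : Type*} [NormedAddCommGroup E] [MeasurableSpace E] [BorelSpace E]
    {X : Set E} (hX : MeasurableSet X)
    {f : E → E} (hf : ContinuousOn f X) :
    MeasurableSet {x ∈ X | f x = x} := by
  have := meas_aux hX (hf.sub continuousOn_id) (measurableSet_singleton (0 : E))
  convert this using 1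
  ext z
  simp [sub_eq_zero]

/-- Decomposition into pieces. -/
lemma exists_pieces {E : Type*} [NormedAddCommGroup E] [MeasurableSpace E] [BorelSpace E]
    {k : ℕ} {β : ℝ} {X : Set E} (hX : MeasurableSet X) (μ : Measure E)
    {T : E → E} (hTX : MapsTo T X X) (hTlip : LocallyHolderOn 1 T X)
    (hXH : μH[β * k] X = 0)
    (hper : ∀ p : ℕ, 1 ≤ p → p < k → ∃ Y : Set E,
      MeasurableSet Y ∧ μ (PerSet T X p \ Y) = 0 ∧ μH[β * p] Y = 0) :
    ∃ M : ℕ → Set E, (∀ r, MeasurableSet (M r)) ∧ (∀ r, M r ⊆ X) ∧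
      (∀ r, 1 ≤ r → r ≤ k → μH[β * r] (M r) = 0) ∧ (∀ r, 1 ≤ r → r ≤ k → ∀ y ∈ M r,
        ∀ d, 1 ≤ d → d < r → T^[d] y ≠ y) ∧ μ (X \ ⋃ r ∈ Icc 1 k, M r) = 0 := by
  classical
  choose! Y hYm hYμ hYH using hper
  have hc : ∀ n, ContinuousOn (T^[n]) X := fun n =>
    LocallyHolderOn.continuousOn' one_pos (LocallyHolderOn.iterate' hTlip hTX n)
  have hfix : ∀ n, MeasurableSet {x ∈ X | T^[n] x = x} := fun n => meas_fix hX (hc n)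
  have hno : ∀ r, MeasurableSet {x ∈ X | ∀ d, 1 ≤ d → d < r → T^[d] x ≠ x} := by
    intro r
    have : {x ∈ X | ∀ d, 1 ≤ d → d < r → T^[d] x ≠ x} =
        X \ ⋃ d ∈ Ico 1 r, {x ∈ X | T^[d] x = x} := by
      ext z
      simp only [mem_ofPred_eq, mem_sdiff, mem_iUnion, mem_Ico, not_exists]
      constructor
      · rintro ⟨hz, H⟩
        exact ⟨hz, fun d hd h => H d hd.1 hd.2 h.2⟩
      · rintro ⟨hz, H⟩
        exact ⟨hz, fun d h1 h2 h => H d ⟨h1, h2⟩ ⟨hz, h⟩⟩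
    rw [this]
    exact hX.diff (MeasurableSet.biUnion (to_countable _) fun d _ => hfix d)
  have hPer : ∀ p, MeasurableSet (PerSet T X p) := by
    intro p
    have : PerSet T X p = {x ∈ X | T^[p] x = x} ∩
        {x ∈ X | ∀ d, 1 ≤ d → d < p → T^[d] x ≠ x} := by
      ext z
      simp only [PerSet, mem_ofPred_eq, mem_inter_iff]
      tauto
    rw [this]
    exact (hfix p).inter (hno p)
  refine ⟨fun r => if 1 ≤ r ∧ r < k then PerSet T X r ∩ Y r else
    {x ∈ X | ∀ d, 1 ≤ d → d < r → T^[d] x ≠ x}, ?_, ?_, ?_, ?_, ?_⟩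
  · intro r
    beta_reduce
    split_ifs with h
    · exact (hPer r).inter (hYm r h.1 h.2)
    · exact hno r
  · intro r
    beta_reduce
    split_ifs with h
    · exact fun z hz => hz.1.1
    · exact fun z hz => hz.1
  · intro r h1 h2
    beta_reduce
    split_ifs with h
    · exact measure_mono_null inter_subset_right (hYH r h.1 h.2)
    · have : r = k := by omega
      subst this
      exact measure_mono_null (fun z hz => hz.1) hXH
  · intro r h1 h2 y hy d hd1 hd2
    beta_reduce at hy
    split_ifs at hy with h
    · exact hy.1.2.2 d hd1 hd2
    · exact hy.2 d hd1 hd2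
  · rcases Nat.eq_zero_or_pos k with rfl | hk
    · have : X = ∅ := by
        by_contra hne
        obtain ⟨z, hz⟩ := nonempty_iff_ne_empty.2 hne
        have h1 : μH[β * ((0 : ℕ) : ℝ)] {z} = 0 := measure_mono_null (singleton_subset_iff.2 hz) hXH
        simp at h1
      simp [this]
    · refine measure_mono_null (t := ⋃ p ∈ Ico 1 k, (PerSet T X p \ Y p)) ?_
        ((measure_biUnion_null_iff (to_countable _)).2 fun p hp => hYμ p hp.1 hp.2)
      rintro z ⟨hz, hzn⟩
      simp only [mem_iUnion, not_exists] at hzn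
      have hk1 : z ∉ {x ∈ X | ∀ d, 1 ≤ d → d < k → T^[d] x ≠ x} := by
        have := hzn k ⟨hk, le_rfl⟩
        simpa using this
      have hex : ∃ d, 1 ≤ d ∧ d < k ∧ T^[d] z = z := by
        by_contra hcon
        push Not at hcon
        exact hk1 ⟨hz, hcon⟩
      let d := Nat.find hex
      obtain ⟨hd1, hd2, hd3⟩ := Nat.find_spec hex
      have hP : z ∈ PerSet T X (Nat.find hex) :=
        ⟨hz, hd3, fun j hj1 hj2 hj3 => Nat.find_min hex hj2 ⟨hj1, hj2.trans hd2, hj3⟩⟩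
      have h3 := hzn (Nat.find hex) ⟨hd1, hd2.le⟩
      rw [if_pos ⟨hd1, hd2⟩] at h3
      exact mem_iUnion₂.2 ⟨_, ⟨hd1, hd2⟩, hP, fun hY => h3 ⟨hP, hY⟩⟩


end PTaux

/-- **Probabilistic Takens delay embedding theorem, invariant measure case (a):**
if moreover `μ` is `T`-invariant, then `X_α` can be chosen with `T(X_α) ⊆ X_α`. -/
theorem probabilistic_takens_invariant_subset {N k m : ℕ} {β : ℝ}
    (hβ : β ∈ Set.Ioc (0 : ℝ) 1)
    (X : Set (EuclideanSpace ℝ (Fin N))) (hX : MeasurableSet X)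
    (μ : Measure (EuclideanSpace ℝ (Fin N))) [SigmaFinite μ]
    (hμX : μ Xᶜ = 0)
    (T : EuclideanSpace ℝ (Fin N) → EuclideanSpace ℝ (Fin N))
    (hTX : Set.MapsTo T X X) (hTinj : Set.InjOn T X)
    (hTlip : LocallyHolderOn 1 T X)
    (hXH : μH[β * k] X = 0)
    (hper : ∀ p : ℕ, 1 ≤ p → p < k → ∃ Y : Set (EuclideanSpace ℝ (Fin N)),
      MeasurableSet Y ∧ μ (PerSet T X p \ Y) = 0 ∧ μH[β * p] Y = 0)
    (h : EuclideanSpace ℝ (Fin N) → ℝ)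
    (hh : LocallyHolderOn β h X)
    (hfam : Fin m → EuclideanSpace ℝ (Fin N) → ℝ)
    (hinterp : IsInterpolatingFamily X hfam (2 * k))
    (hfamHolder : ∀ j, LocallyHolderOn β (hfam j) X)
    (hinv : ∀ Y : Set (EuclideanSpace ℝ (Fin N)), MeasurableSet Y → Y ⊆ X →
      μ (X ∩ T ⁻¹' Y) = μ Y) :
    ∀ᵐ α ∂(volume : Measure (Fin m → ℝ)),
      ∃ X_α : Set (EuclideanSpace ℝ (Fin N)), X_α ⊆ X ∧ MeasurableSet X_α ∧
        μ (X \ X_α) = 0 ∧ Set.MapsTo T X_α X_α ∧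
        Set.InjOn (fun x => fun i : Fin k =>
          h (T^[(i : ℕ)] x) + ∑ j, α j * hfam j (T^[(i : ℕ)] x)) X_α := by
  classical
  have hβ0 := hβ.1
  have hit : ∀ n, MapsTo (T^[n]) X X := fun n => hTX.iterate n
  have hTc : ∀ n, ContinuousOn (T^[n]) X := fun n =>
    PTaux.LocallyHolderOn.continuousOn' one_pos (PTaux.LocallyHolderOn.iterate' hTlip hTX n)
  have hiinj : ∀ n, InjOn (T^[n]) X := fun n => hTinj.iterate hTX n
  obtain ⟨M, hMm, hMX, hMH, hMper, hMfull⟩ := PTaux.exists_pieces hX μ hTX hTlip hXH hper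
  choose K hKc hKM hKfull using fun r => PTaux.exists_sigma_compact μ (hMm r)
  let KK : (Icc 1 k : Set ℕ) × ℕ → Set (EuclideanSpace ℝ (Fin N)) := fun i => K i.1 i.2
  have hKKc : ∀ i, IsCompact (KK i) := fun i => hKc _ _
  have hKKX : ∀ i, KK i ⊆ X := fun i => (hKM _ _).trans (hMX _)
  set W := ⋃ i, KK i with hW
  have hWX : W ⊆ X := iUnion_subset hKKX
  have hWm : MeasurableSet W := MeasurableSet.iUnion fun i => (hKKc i).measurableSet
  have hWfull : μ (X \ W) = 0 := by
    refine measure_mono_null (t := (X \ ⋃ r ∈ Icc 1 k, M r) ∪ ⋃ r, (M r \ ⋃ n, K r n)) ?_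
      (measure_union_null hMfull (measure_iUnion_null fun r => hKfull r))
    rintro z ⟨hz, hzW⟩
    by_cases hzM : z ∈ ⋃ r ∈ Icc 1 k, M r
    · right
      obtain ⟨r, hr, hzr⟩ := mem_iUnion₂.1 hzM
      refine mem_iUnion.2 ⟨r, hzr, fun hzK => hzW ?_⟩
      obtain ⟨n, hn⟩ := mem_iUnion.1 hzK
      exact mem_iUnion.2 ⟨(⟨r, hr⟩, n), hn⟩
    · exact Or.inl ⟨hz, hzM⟩
  let Φ : (Fin m → ℝ) → EuclideanSpace ℝ (Fin N) → Fin k → ℝ := fun α x i =>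
    h (T^[(i : ℕ)] x) + ∑ j, α j * hfam j (T^[(i : ℕ)] x)
  have hhc := PTaux.LocallyHolderOn.continuousOn' hβ0 hh
  have hfc := fun j => PTaux.LocallyHolderOn.continuousOn' hβ0 (hfamHolder j)
  have hΦc : ContinuousOn (fun z : (Fin m → ℝ) × EuclideanSpace ℝ (Fin N) => Φ z.1 z.2)
      (univ ×ˢ X) := by
    refine continuousOn_pi.2 fun i => ?_
    have hTi : ContinuousOn (fun z : (Fin m → ℝ) × EuclideanSpace ℝ (Fin N) => T^[(i : ℕ)] z.2)
      (univ ×ˢ X) := (hTc i).comp continuousOn_snd fun z hz => hz.2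
    refine ContinuousOn.add (hhc.comp hTi fun z hz => hit _ hz.2) ?_
    refine continuousOn_finsetSum _ fun j _ => ?_
    refine ContinuousOn.mul (by fun_prop) ((hfc j).comp hTi fun z hz => hit _ hz.2)
  let Bs : (Icc 1 k : Set ℕ) × ℕ → (Icc 1 k : Set ℕ) × ℕ → ℕ →
      Set (EuclideanSpace ℝ (Fin N) × (Fin m → ℝ)) := fun i i' n =>
    {z | z ∈ KK i ×ˢ (univ : Set (Fin m → ℝ)) ∧ ∃ y ∈ KK i',
      (dist z.1 y, Φ z.2 z.1 - Φ z.2 y) ∈ Ici (1 / ((n : ℝ) + 1)) ×ˢ ({0} : Set (Fin k → ℝ))}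
  have hBs : ∀ i i' n, IsClosed (Bs i i' n) := by
    intro i i' n
    refine PTaux.closed_proj ((hKKc i).isClosed.prod isClosed_univ) (hKKc i')
      (f := fun w : (EuclideanSpace ℝ (Fin N) × (Fin m → ℝ)) × EuclideanSpace ℝ (Fin N) =>
        (dist w.1.1 w.2, Φ w.1.2 w.1.1 - Φ w.1.2 w.2)) ?_ (isClosed_Ici.prod isClosed_singleton)
    refine ContinuousOn.prodMk (by fun_prop) (ContinuousOn.sub ?_ ?_)
    · exact hΦc.comp (f := fun w : (EuclideanSpace ℝ (Fin N) × (Fin m → ℝ)) ×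
        EuclideanSpace ℝ (Fin N) => (w.1.2, w.1.1)) (by fun_prop)
        (fun w hw => ⟨mem_univ _, hKKX _ hw.1.1⟩)
    · exact hΦc.comp (f := fun w : (EuclideanSpace ℝ (Fin N) × (Fin m → ℝ)) ×
        EuclideanSpace ℝ (Fin N) => (w.1.2, w.2)) (by fun_prop)
        (fun w hw => ⟨mem_univ _, hKKX _ hw.2⟩)
  set B := ⋃ i, ⋃ i', ⋃ n, Bs i i' n with hB
  have hBm : MeasurableSet B := MeasurableSet.iUnion fun i => MeasurableSet.iUnion fun i' =>
    MeasurableSet.iUnion fun n => (hBs i i' n).measurableSet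
  have memB : ∀ x α, (x, α) ∈ B ↔ x ∈ W ∧ ∃ y ∈ W, x ≠ y ∧ Φ α x = Φ α y := by
    intro x α
    simp only [hB, hW, mem_iUnion]
    constructor
    · rintro ⟨i, i', n, ⟨hx, -⟩, y, hy, hd, hs⟩
      refine ⟨⟨i, hx⟩, y, ⟨i', hy⟩, ?_, sub_eq_zero.1 hs⟩
      have h1 : 1 / ((n : ℝ) + 1) ≤ dist x y := hd
      have h2 : (0 : ℝ) < 1 / ((n : ℝ) + 1) := by positivity
      exact dist_pos.1 (h2.trans_le h1)
    · rintro ⟨⟨i, hx⟩, y, ⟨i', hy⟩, hne, hs⟩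
      obtain ⟨n, hn⟩ := exists_nat_one_div_lt (dist_pos.2 hne)
      exact ⟨i, i', n, ⟨hx, mem_univ _⟩, y, hy, hn.le, sub_eq_zero.2 hs⟩
  have fib : ∀ x, ∀ᵐ α ∂(volume : Measure (Fin m → ℝ)), (x, α) ∉ B := by
    intro x
    by_cases hxW : x ∈ W
    swap
    · exact Filter.Eventually.of_forall fun α hα => hxW ((memB x α).1 hα).1
    have hx : x ∈ X := hWX hxW
    have hk : 1 ≤ k := by
      obtain ⟨i, -⟩ := mem_iUnion.1 hxW
      exact i.1.2.1.trans i.1.2.2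
    have S := fun (r : ℕ) (hr : r ≤ k) (L : Set (EuclideanSpace ℝ (Fin N))) (hL : IsCompact L) =>
      PTaux.fiber_null (K := L) hβ0 hTX hTlip hh hinterp hfamHolder hx hr hL
    set Orb := ⋃ i : ℕ, ⋃ j : ℕ, {y ∈ X | y ≠ x ∧ T^[i] y = T^[j] x} with hOrb
    have hOc : Orb.Countable := by
      refine countable_iUnion fun i => countable_iUnion fun j => Set.Subsingleton.countable ?_
      rintro y ⟨hy, -, h1⟩ y' ⟨hy', -, h2⟩
      exact hiinj i hy hy' (h1.trans h2.symm)
    have hOX : ∀ y ∈ Orb, y ∈ X ∧ y ≠ x := by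
      intro y hy
      simp only [hOrb, mem_iUnion] at hy
      obtain ⟨i, j, h1, h2, -⟩ := hy
      exact ⟨h1, h2⟩
    rw [ae_iff]
    refine measure_mono_null ?_ (measure_union_null
      (measure_iUnion_null fun i : (Icc 1 k : Set ℕ) × ℕ =>
        S i.1 i.1.2.2 (KK i) (hKKc i) (hKKX i)
          (measure_mono_null (hKM _ _) (hMH _ i.1.2.1 i.1.2.2)))
      ((measure_biUnion_null_iff hOc).2 fun y hy =>
        S 1 hk {y} isCompact_singleton (singleton_subset_iff.2 (hOX y hy).1) ?_))
    swap
    · haveI := Measure.noAtoms_hausdorff (EuclideanSpace ℝ (Fin N))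
        (d := β * ((1 : ℕ) : ℝ)) (by simpa using hβ0)
      exact measure_singleton _
    intro α hα
    simp only [mem_ofPred_eq, not_not] at hα
    obtain ⟨-, y, hyW, hne, heq⟩ := (memB x α).1 hα
    by_cases hyO : y ∈ Orb
    · right
      refine mem_iUnion₂.2 ⟨y, hyO, y, rfl, ?_, ?_, ?_⟩
      · intro i j _
        exact Subsingleton.elim _ _
      · intro i j
        have hi : (i : ℕ) = 0 := by omega
        have hj : (j : ℕ) = 0 := by omega
        rw [hi, hj]
        exact hne.symm
      · intro i
        exact congrFun heq ⟨i, by omega⟩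
    · left
      obtain ⟨i, hyi⟩ := mem_iUnion.1 hyW
      have hper' := hMper _ i.1.2.1 i.1.2.2 y (hKM _ _ hyi)
      have hyX := hWX hyW
      have aux : ∀ a b : ℕ, a < b → b < i.1 → T^[a] y ≠ T^[b] y := by
        intro a b hab hb hE
        refine hper' (b - a) (by omega) (by omega) ?_
        have : T^[b] y = T^[a] (T^[b - a] y) := by
          rw [← Function.iterate_add_apply]; congr 1; omega
        rw [this] at hE
        exact (hiinj a hyX (hit _ hyX) hE).symm
      refine mem_iUnion.2 ⟨i, y, hyi, ?_, ?_, ?_⟩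
      · intro a b hab
        rcases lt_trichotomy (a : ℕ) (b : ℕ) with hlt | he | hlt
        · exact absurd hab (aux a b hlt b.2)
        · exact Fin.ext he
        · exact absurd hab.symm (aux b a hlt a.2)
      · intro a b hab
        exact hyO (mem_iUnion₂.2 ⟨a, b, hyX, hne.symm, hab⟩)
      · intro a
        exact congrFun heq ⟨a, a.2.trans_le i.1.2.2⟩
  have hswap : ∀ᵐ α ∂(volume : Measure (Fin m → ℝ)), ∀ᵐ x ∂μ, (x, α) ∉ B := by
    refine (Measure.ae_ae_comm (μ := μ) (ν := (volume : Measure (Fin m → ℝ)))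
      (p := fun x α => (x, α) ∉ B) hBm.compl).1 (Filter.Eventually.of_forall fib)
  filter_upwards [hswap] with α hα
  set G := W ∩ (fun x => (x, α)) ⁻¹' Bᶜ with hG
  have hGm : MeasurableSet G := hWm.inter (measurable_prodMk_right hBm.compl)
  have hGX : G ⊆ X := inter_subset_left.trans hWX
  have hGfull : μ (X \ G) = 0 := by
    rw [ae_iff] at hα
    refine measure_mono_null ?_ (measure_union_null hWfull hα)
    rintro z ⟨hz, hzG⟩
    by_cases hzW : z ∈ W
    · exact Or.inr fun hzB => hzG ⟨hzW, hzB⟩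
    · exact Or.inl ⟨hz, hzW⟩
  have hGinj : InjOn (Φ α) G := by
    intro x hx y hy hxy
    by_contra hne
    exact hx.2 ((memB x α).2 ⟨hx.1, y, hy.1, hne, hxy⟩)
  have hpre : ∀ n, μ (X ∩ T^[n] ⁻¹' (X \ G)) = 0 := by
    intro n
    induction n with
    | zero => exact measure_mono_null inter_subset_right hGfull
    | succ n ih =>
      have hm : MeasurableSet (X ∩ T^[n] ⁻¹' (X \ G)) :=
        PTaux.meas_aux hX (hTc n) (hX.diff hGm)
      have := hinv _ hm inter_subset_left
      rw [ih] at this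
      refine measure_mono_null ?_ this
      rintro z ⟨hz, hz2⟩
      exact ⟨hz, hTX hz, hz2⟩
  refine ⟨X ∩ ⋂ n, (X ∩ T^[n] ⁻¹' G), inter_subset_left, hX.inter
    (MeasurableSet.iInter fun n => PTaux.meas_aux hX (hTc n) hGm), ?_, ?_, ?_⟩
  · refine measure_mono_null ?_ (measure_iUnion_null hpre)
    rintro z ⟨hz, hzn⟩
    by_contra hcon
    refine hzn ⟨hz, mem_iInter.2 fun n => ⟨hz, ?_⟩⟩
    by_contra hn
    exact hcon (mem_iUnion.2 ⟨n, hz, hit n hz, hn⟩)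
  · rintro z ⟨hz, hzn⟩
    refine ⟨hTX hz, mem_iInter.2 fun n => ⟨hTX hz, ?_⟩⟩
    exact (mem_iInter.1 hzn (n + 1)).2
  · refine hGinj.mono ?_
    rintro z ⟨hz, hzn⟩
    exact (mem_iInter.1 hzn 0).2
end

section
/- Let X ⊆ ℝ^N be a Borel set, μ a finite Borel measure on X, and T : X → X an injective, locally Lipschitz map such that μ is T-invariant (μ(T^{-1}Y) = μ(Y) for all Borel Y ⊆ X). Take k ∈ ℕ and β ∈ (0,1] such that H^{βk}(X) = 0, and assume that μ|_{Per_p(T)} is mutually singular with H^{βp} for every p = 1,…,k−1. Let h : X → ℝ be locally β-Hölder and let h_1,…,h_m : X → ℝ be a 2k-interpolating family on X consisting of locally β-Hölder functions; for α ∈ ℝ^m set h_α = h + Σ_{j=1}^m α_j h_j. Then for Lebesgue almost every α ∈ ℝ^m there exists a Borel set X_α ⊆ X of full μ-measure satisfying T(X_α) = X_α such that the delay-coordinate map φ_α^T(x) = (h_α(x), h_α(Tx), …, h_α(T^{k−1}x)) is injective on X_α. -/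
open MeasureTheory Set
open scoped InnerProductSpace ENNReal


theorem exists_rows {p m : ℕ} (a : Fin p → Fin m → ℝ) (ha : LinearIndependent ℝ a) :
    ∃ (κ : Type) (_ : Fintype κ) (e : Fin p ⊕ κ ≃ Fin m) (v : κ → Fin m → ℝ),
      (Matrix.of fun (i : Fin m) => (Sum.elim a v (e.symm i) : Fin m → ℝ)).det ≠ 0 := by
  classical
  let B := Module.Basis.sumExtend ha
  have : Fintype (Fin p ⊕ Module.Basis.sumExtendIndex ha) := FiniteDimensional.fintypeBasisIndex B
  have hB : ∀ i, B (Sum.inl i) = a i := by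
    intro i
    simp [B, Module.Basis.sumExtend]
    rfl
  have : Fintype (Module.Basis.sumExtendIndex ha) := Fintype.ofInjective (Sum.inr (α := Fin p)) Sum.inr_injective
  have hc : Fintype.card (Fin p ⊕ Module.Basis.sumExtendIndex ha) = Fintype.card (Fin m) := by
    have := Module.finrank_eq_card_basis B
    simp at this
    simp [this]
  let e := Fintype.equivOfCardEq hc
  refine ⟨Module.Basis.sumExtendIndex ha, inferInstance, e, fun k => B (Sum.inr k), ?_⟩
  have h1 : Sum.elim a (fun k => B (Sum.inr k)) = B := by
    ext1 s; rcases s with i | k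
    · simp [hB]
    · rfl
  rw [h1]
  have : LinearIndependent ℝ (fun i : Fin m => B (e.symm i)) := B.linearIndependent.comp _ e.symm.injective
  have h2 := (Matrix.linearIndependent_rows_iff_isUnit (A := Matrix.of fun (i : Fin m) => B (e.symm i))).1 this
  exact ((Matrix.isUnit_iff_isUnit_det _).1 h2).ne_zero

theorem indep_of_rank {l m : ℕ} (A : Matrix (Fin l) (Fin m) ℝ) (h : A.rank = l) :
    LinearIndependent ℝ (fun i => A i) := by
  rw [linearIndependent_iff_card_eq_finrank_span]
  rw [Matrix.rank_eq_finrank_span_row] at h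
  simp only [Fintype.card_fin, Set.finrank]
  exact h.symm

theorem slab_volume {m : ℕ} (M : Matrix (Fin m) (Fin m) ℝ) (hM : M.det ≠ 0) (lo hi : Fin m → ℝ) :
    volume {α : Fin m → ℝ | ∀ i, M.mulVec α i ∈ Icc (lo i) (hi i)} =
      ENNReal.ofReal |M.det⁻¹| * ∏ i, ENNReal.ofReal (hi i - lo i) := by
  have h := Real.map_matrix_volume_pi_eq_smul_volume_pi hM
  have h2 := congrArg (fun ν => ν (Set.pi univ fun i => Icc (lo i) (hi i))) h
  rw [Measure.map_apply, Measure.smul_apply, volume_pi_pi] at h2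
  · simp only [Real.volume_Icc, smul_eq_mul] at h2
    rw [← h2]; congr 1; ext α; simp [Pi.le_def, forall_and]
  · exact (LinearMap.continuous_of_finiteDimensional _).measurable
  · exact MeasurableSet.univ_pi fun i => measurableSet_Icc

theorem slab_piece {E : Type*} [NormedAddCommGroup E]
    {p m : ℕ} {β : ℝ} (hβ : 0 < β) (S : Set E)
    (a : Fin p → E → Fin m → ℝ) (b : Fin p → E → ℝ) (C : ℝ) (hC : 0 ≤ C)
    (ha : ∀ i j, ∀ y ∈ S, ∀ y' ∈ S, |a i y j - a i y' j| ≤ C * ‖y - y'‖ ^ β)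
    (hb : ∀ i, ∀ y ∈ S, ∀ y' ∈ S, |b i y - b i y'| ≤ C * ‖y - y'‖ ^ β)
    {κ : Type} [Fintype κ] (e : Fin p ⊕ κ ≃ Fin m) (v : κ → Fin m → ℝ) (c : ℝ) (hc : 0 < c)
    (hdet : ∀ y ∈ S, c ≤ |(Matrix.of fun (i : Fin m) =>
      (Sum.elim (fun i => a i y) v (e.symm i) : Fin m → ℝ)).det|)
    (R : ℝ) (hR : 0 ≤ R) (t : Set E) (ht : Metric.ediam t ≤ 1) :
    volume {α : Fin m → ℝ | (∀ j, |α j| ≤ R) ∧ ∃ y ∈ S ∩ t, ∀ i, b i y + ∑ j, α j * a i y j = 0} ≤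
     (ENNReal.ofReal c⁻¹ * ((ENNReal.ofReal (2 * (C * (1 + m * R))) ^ p) *
      (ENNReal.ofReal (2 * (R * ∑ k, ∑ j, |v k j|)) ^ (Fintype.card κ)))) *
      ⨆ _ : t.Nonempty, Metric.ediam t ^ (β * p) := by
  rcases (S ∩ t).eq_empty_or_nonempty with h0 | ⟨y0, hy0S, hy0t⟩
  · simp [h0]
  have htn : t.Nonempty := ⟨y0, hy0t⟩
  rw [ciSup_pos htn]
  have htop : Metric.ediam t ≠ ⊤ := ne_top_of_le_ne_top ENNReal.one_ne_top ht
  set d := Metric.diam t with hd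
  have hd0 : 0 ≤ d := Metric.diam_nonneg
  have hde : Metric.ediam t = ENNReal.ofReal d := by
    rw [hd, Metric.diam, ENNReal.ofReal_toReal htop]
  set M := Matrix.of fun (i : Fin m) =>
      (Sum.elim (fun i => a i y0) v (e.symm i) : Fin m → ℝ) with hM
  have hMd := hdet y0 hy0S
  rw [← hM] at hMd
  have hM0 : M.det ≠ 0 := by
    intro h; rw [h] at hMd; simp at hMd; linarith
  set δ := C * (1 + m * R) * d ^ β with hδ
  set Rv := R * ∑ k, ∑ j, |v k j| with hRv
  let lo : Fin m → ℝ := fun i => Sum.elim (fun i => - b i y0 - δ) (fun _ => -Rv) (e.symm i)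
  let hi : Fin m → ℝ := fun i => Sum.elim (fun i => - b i y0 + δ) (fun _ => Rv) (e.symm i)
  have hsub : {α : Fin m → ℝ | (∀ j, |α j| ≤ R) ∧ ∃ y ∈ S ∩ t, ∀ i, b i y + ∑ j, α j * a i y j = 0}
      ⊆ {α : Fin m → ℝ | ∀ i, M.mulVec α i ∈ Icc (lo i) (hi i)} := by
    rintro α ⟨hα, y, ⟨hyS, hyt⟩, hy⟩ i
    obtain ⟨s, rfl⟩ := e.surjective i
    rcases s with i | k
    · simp only [lo, hi, Equiv.symm_apply_apply, Sum.elim_inl, hM, Matrix.mulVec, dotProduct,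
        Matrix.of_apply]
      have hdist : ‖y - y0‖ ^ β ≤ d ^ β := by
        apply Real.rpow_le_rpow (norm_nonneg _) _ hβ.le
        rw [← dist_eq_norm]
        exact Metric.dist_le_diam_of_mem' htop hyt hy0t
      have key : |b i y0 + ∑ j, α j * a i y0 j| ≤ δ := by
        have : b i y0 + ∑ j, α j * a i y0 j =
            (b i y0 - b i y) + ∑ j, α j * (a i y0 j - a i y j) := by
          have := hy i
          simp only [mul_sub, Finset.sum_sub_distrib]
          linarith
        rw [this]
        calc _ ≤ |b i y0 - b i y| + |∑ j, α j * (a i y0 j - a i y j)| := abs_add_le _ _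
          _ ≤ C * d ^ β + ∑ j : Fin m, R * (C * d ^ β) := by
            gcongr
            · rw [abs_sub_comm]
              exact (hb i y hyS y0 hy0S).trans (by gcongr)
            · refine (Finset.abs_sum_le_sum_abs _ _).trans (Finset.sum_le_sum fun j _ => ?_)
              rw [abs_mul]
              gcongr
              · exact hα j
              · rw [abs_sub_comm]
                exact (ha i j y hyS y0 hy0S).trans (by gcongr)
          _ = δ := by simp [hδ]; ring
      have e1 : ∑ j, a i y0 j * α j = ∑ j, α j * a i y0 j :=
        Finset.sum_congr rfl fun j _ => mul_comm _ _
      rw [e1]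
      have := abs_le.1 key
      constructor <;> linarith [this.1, this.2]
    · simp only [lo, hi, Equiv.symm_apply_apply, Sum.elim_inr, hM, Matrix.mulVec, dotProduct,
        Matrix.of_apply]
      rw [mem_Icc, ← abs_le]
      calc |∑ j, v k j * α j| ≤ ∑ j, |v k j| * R := by
            refine (Finset.abs_sum_le_sum_abs _ _).trans (Finset.sum_le_sum fun j _ => ?_)
            rw [abs_mul]
            gcongr
            exact hα j
        _ = R * ∑ j, |v k j| := by rw [← Finset.sum_mul, mul_comm]
        _ ≤ Rv := by
          rw [hRv]
          gcongr
          exact Finset.single_le_sum (f := fun k => ∑ j, |v k j|)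
            (fun _ _ => Finset.sum_nonneg fun _ _ => abs_nonneg _) (Finset.mem_univ k)
  refine (measure_mono hsub).trans ?_
  rw [slab_volume M hM0]
  have hprod : ∏ i, ENNReal.ofReal (hi i - lo i) =
      ENNReal.ofReal (2 * δ) ^ p * ENNReal.ofReal (2 * Rv) ^ (Fintype.card κ) := by
    rw [← e.prod_comp, Fintype.prod_sum_type]
    simp only [lo, hi, Equiv.symm_apply_apply, Sum.elim_inl, Sum.elim_inr]
    congr 1
    · have : ∀ i : Fin p, -b i y0 + δ - (-b i y0 - δ) = 2 * δ := fun i => by ring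
      simp only [this, Finset.prod_const, Finset.card_univ, Fintype.card_fin]
    · rw [Finset.prod_const, Finset.card_univ, sub_neg_eq_add, ← two_mul]
  rw [hprod]
  have hδe : ENNReal.ofReal (2 * δ) ^ p =
      ENNReal.ofReal (2 * (C * (1 + m * R))) ^ p * Metric.ediam t ^ (β * p) := by
    rw [ENNReal.rpow_mul, ENNReal.rpow_natCast, ← mul_pow, hde, ENNReal.ofReal_rpow_of_nonneg hd0 hβ.le,
      ← ENNReal.ofReal_mul (by positivity)]
    congr 2; rw [hδ]; ring
  rw [hδe]
  have hdd : ENNReal.ofReal |M.det⁻¹| ≤ ENNReal.ofReal c⁻¹ := by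
    apply ENNReal.ofReal_le_ofReal
    rw [abs_inv]
    gcongr
  calc _ ≤ ENNReal.ofReal c⁻¹ * (ENNReal.ofReal (2 * (C * (1 + ↑m * R))) ^ p * Metric.ediam t ^ (β * ↑p) * ENNReal.ofReal (2 * Rv) ^ Fintype.card κ) := by gcongr
    _ = _ := by ring

theorem null_core {E : Type*} [NormedAddCommGroup E] [MeasurableSpace E] [BorelSpace E]
    {p m : ℕ} {β : ℝ} (hβ : 0 < β) (S : Set E) (hS : μH[β * p] S = 0)
    (a : Fin p → E → Fin m → ℝ) (b : Fin p → E → ℝ) (C : ℝ) (hC : 0 ≤ C)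
    (ha : ∀ i j, ∀ y ∈ S, ∀ y' ∈ S, |a i y j - a i y' j| ≤ C * ‖y - y'‖ ^ β)
    (hb : ∀ i, ∀ y ∈ S, ∀ y' ∈ S, |b i y - b i y'| ≤ C * ‖y - y'‖ ^ β)
    {κ : Type} [Fintype κ] (e : Fin p ⊕ κ ≃ Fin m) (v : κ → Fin m → ℝ) (c : ℝ) (hc : 0 < c)
    (hdet : ∀ y ∈ S, c ≤ |(Matrix.of fun (i : Fin m) =>
      (Sum.elim (fun i => a i y) v (e.symm i) : Fin m → ℝ)).det|)
    (R : ℝ) (hR : 0 ≤ R) :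
    volume {α : Fin m → ℝ | (∀ j, |α j| ≤ R) ∧ ∃ y ∈ S, ∀ i, b i y + ∑ j, α j * a i y j = 0} = 0 := by
  set K := (ENNReal.ofReal c⁻¹ * ((ENNReal.ofReal (2 * (C * (1 + m * R))) ^ p) *
      (ENNReal.ofReal (2 * (R * ∑ k, ∑ j, |v k j|)) ^ (Fintype.card κ)))) with hK
  have hKtop : K ≠ ⊤ := by
    rw [hK]
    exact ENNReal.mul_ne_top ENNReal.ofReal_ne_top (ENNReal.mul_ne_top
      (ENNReal.pow_ne_top ENNReal.ofReal_ne_top) (ENNReal.pow_ne_top ENNReal.ofReal_ne_top))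
  rw [Measure.hausdorffMeasure_apply] at hS
  have h1 : (⨅ (t : ℕ → Set E) (_ : S ⊆ ⋃ n, t n) (_ : ∀ n, Metric.ediam (t n) ≤ 1),
          ∑' n, ⨆ _ : (t n).Nonempty, Metric.ediam (t n) ^ (β * p)) = 0 := by
    have := ENNReal.iSup_eq_zero.1 hS 1
    exact ENNReal.iSup_eq_zero.1 this one_pos
  by_contra hne
  obtain ⟨ε, hε, hεlt⟩ := ENNReal.exists_nnreal_pos_mul_lt hKtop hne
  have h2 := h1.trans_lt (ENNReal.coe_pos.2 hε)
  simp only [iInf_lt_iff] at h2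
  obtain ⟨t, hcov, hdiam, hsum⟩ := h2
  refine absurd hεlt (not_lt.2 ?_)
  calc _ ≤ volume (⋃ n, {α : Fin m → ℝ | (∀ j, |α j| ≤ R) ∧ ∃ y ∈ S ∩ t n,
            ∀ i, b i y + ∑ j, α j * a i y j = 0}) := by
        apply measure_mono
        rintro α ⟨hα, y, hy, hyy⟩
        obtain ⟨n, hn⟩ := mem_iUnion.1 (hcov hy)
        exact mem_iUnion.2 ⟨n, hα, y, ⟨hy, hn⟩, hyy⟩
    _ ≤ ∑' n, K * ⨆ _ : (t n).Nonempty, Metric.ediam (t n) ^ (β * p) := by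
        refine (measure_iUnion_le _).trans (ENNReal.tsum_le_tsum fun n => ?_)
        exact slab_piece hβ S a b C hC ha hb e v c hc hdet R hR (t n) (hdiam n)
    _ = K * ∑' n, ⨆ _ : (t n).Nonempty, Metric.ediam (t n) ^ (β * p) := ENNReal.tsum_mul_left
    _ ≤ K * ε := by gcongr
    _ = ε * K := mul_comm _ _

theorem LocallyHolderOn.mono' {E F : Type*} [NormedAddCommGroup E] [NormedAddCommGroup F]
    {β : ℝ} {f : E → F} {X S : Set E} (hf : LocallyHolderOn β f X) (hS : S ⊆ X) :
    LocallyHolderOn β f S := by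
  intro x hx
  obtain ⟨U, hU, hxU, C, hC, h⟩ := hf x (hS hx)
  exact ⟨U, hU, hxU, C, hC, fun y hy y' hy' => h y ⟨hy.1, hS hy.2⟩ y' ⟨hy'.1, hS hy'.2⟩⟩

theorem LocallyHolderOn.continuousOn' {E F : Type*} [NormedAddCommGroup E] [NormedAddCommGroup F]
    {β : ℝ} (hβ : 0 < β) {f : E → F} {X : Set E} (hf : LocallyHolderOn β f X) :
    ContinuousOn f X := by
  intro x hx
  obtain ⟨U, hU, hxU, C, hC, h⟩ := hf x hx
  rw [ContinuousWithinAt, tendsto_iff_norm_sub_tendsto_zero]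
  have h1 : Filter.Tendsto (fun y => C * ‖y - x‖ ^ β) (nhdsWithin x X) (nhds 0) := by
    have : ContinuousAt (fun y => C * ‖y - x‖ ^ β) x := by
      apply ContinuousAt.mul continuousAt_const
      exact ContinuousAt.rpow_const (by fun_prop) (Or.inr hβ.le)
    have h2 := this.tendsto
    simp only [sub_self, norm_zero, Real.zero_rpow hβ.ne', mul_zero] at h2
    exact h2.mono_left nhdsWithin_le_nhds
  refine squeeze_zero' (Filter.Eventually.of_forall fun _ => norm_nonneg _) ?_ h1
  filter_upwards [self_mem_nhdsWithin, mem_nhdsWithin_of_mem_nhds (hU.mem_nhds hxU)] with y hy hyU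
  exact h y ⟨hyU, hy⟩ x ⟨hxU, hx⟩

theorem LocallyHolderOn.comp' {E F : Type*} [NormedAddCommGroup E] [NormedAddCommGroup F]
    {β : ℝ} (hβ : 0 < β) {f : E → F} {g : E → E} {X : Set E} (hf : LocallyHolderOn β f X)
    (hg : LocallyHolderOn 1 g X) (hgX : MapsTo g X X) :
    LocallyHolderOn β (fun x => f (g x)) X := by
  intro x hx
  obtain ⟨U, hU, hxU, C, hC, h⟩ := hf (g x) (hgX hx)
  obtain ⟨V, hV, hxV, D, hD, h'⟩ := hg x hx
  have hc : g ⁻¹' U ∈ nhdsWithin x X := hg.continuousOn' one_pos x hx (hU.mem_nhds hxU)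
  obtain ⟨W, hW, hxW, hWU⟩ := mem_nhdsWithin.1 hc
  refine ⟨V ∩ W, hV.inter hW, ⟨hxV, hxW⟩, C * D ^ β, by positivity, ?_⟩
  intro y hy y' hy'
  calc ‖f (g y) - f (g y')‖ ≤ C * ‖g y - g y'‖ ^ β :=
        h _ ⟨hWU ⟨hy.1.2, hy.2⟩, hgX hy.2⟩ _ ⟨hWU ⟨hy'.1.2, hy'.2⟩, hgX hy'.2⟩
    _ ≤ C * (D * ‖y - y'‖) ^ β := by
        gcongr
        simpa using h' y ⟨hy.1.1, hy.2⟩ y' ⟨hy'.1.1, hy'.2⟩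
    _ = C * D ^ β * ‖y - y'‖ ^ β := by
        rw [Real.mul_rpow hD.le (norm_nonneg _)]; ring

theorem LocallyHolderOn.iterate' {E : Type*} [NormedAddCommGroup E]
    {T : E → E} {X : Set E} (hT : LocallyHolderOn 1 T X) (hTX : MapsTo T X X) (n : ℕ) :
    LocallyHolderOn 1 (T^[n]) X := by
  induction n with
  | zero =>
    intro x _
    refine ⟨univ, isOpen_univ, mem_univ _, 1, one_pos, fun y _ y' _ => by simp⟩
  | succ n ih =>
    have := LocallyHolderOn.comp' (f := T^[n]) one_pos ih hT hTX
    exact this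

theorem LocallyHolderOn.sub_left' {E F : Type*} [NormedAddCommGroup E] [NormedAddCommGroup F]
    {β : ℝ} {f : E → F} {X : Set E} (hf : LocallyHolderOn β f X) (c : F) :
    LocallyHolderOn β (fun y => c - f y) X := by
  intro x hx
  obtain ⟨U, hU, hxU, C, hC, h⟩ := hf x hx
  refine ⟨U, hU, hxU, C, hC, fun y hy y' hy' => ?_⟩
  rw [sub_sub_sub_cancel_left, norm_sub_rev]
  exact h y hy y' hy'

/-- finitely many locally Hölder functions have a common neighbourhood and constant -/
theorem LocallyHolderOn.common {E : Type*} [NormedAddCommGroup E] {ι : Type*} [Finite ι]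
    {β : ℝ} {f : ι → E → ℝ} {X : Set E} (hf : ∀ i, LocallyHolderOn β (f i) X) (x : E) (hx : x ∈ X) :
    ∃ U : Set E, IsOpen U ∧ x ∈ U ∧ ∃ C ≥ (0 : ℝ), ∀ i, ∀ y ∈ U ∩ X, ∀ y' ∈ U ∩ X,
      |f i y - f i y'| ≤ C * ‖y - y'‖ ^ β := by
  have := Fintype.ofFinite ι
  choose U hU hxU C hC h using fun i => hf i x hx
  refine ⟨⋂ i, U i, isOpen_iInter_of_finite hU, mem_iInter.2 hxU, ∑ i, C i,
    Finset.sum_nonneg fun i _ => (hC i).le, fun i y hy y' hy' => ?_⟩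
  refine (h i y ⟨mem_iInter.1 hy.1 i, hy.2⟩ y' ⟨mem_iInter.1 hy'.1 i, hy'.2⟩).trans ?_
  gcongr
  exact Finset.single_le_sum (f := C) (fun i _ => (hC i).le) (Finset.mem_univ i)

theorem null_indep {E : Type*} [NormedAddCommGroup E] [MeasurableSpace E] [BorelSpace E]
    [SecondCountableTopology E]
    {p m : ℕ} {β : ℝ} (hβ : 0 < β) (S : Set E) (hS : μH[β * p] S = 0)
    (a : Fin p → E → Fin m → ℝ) (b : Fin p → E → ℝ)
    (ha : ∀ i j, LocallyHolderOn β (fun y => a i y j) S)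
    (hb : ∀ i, LocallyHolderOn β (b i) S)
    (hind : ∀ y ∈ S, LinearIndependent ℝ (fun i => a i y)) :
    volume {α : Fin m → ℝ | ∃ y ∈ S, ∀ i, b i y + ∑ j, α j * a i y j = 0} = 0 := by
  have hloc : ∀ x ∈ S, ∃ V ∈ nhdsWithin x S, 
      volume {α : Fin m → ℝ | ∃ y ∈ S ∩ V, ∀ i, b i y + ∑ j, α j * a i y j = 0} = 0 := by
    intro x hx
    obtain ⟨κ, _, e, v, hdet⟩ := exists_rows _ (hind x hx)
    obtain ⟨U, hU, hxU, C, hC, h⟩ := LocallyHolderOn.common (ι := (Fin p × Fin m) ⊕ Fin p)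
      (f := Sum.elim (fun ij y => a ij.1 y ij.2) b)
      (by rintro (⟨i, j⟩ | i); exacts [ha i j, hb i]) x hx
    let D : E → ℝ := fun y => |(Matrix.of fun (i : Fin m) =>
      (Sum.elim (fun i => a i y) v (e.symm i) : Fin m → ℝ)).det|
    have hD : ContinuousOn D S := by
      apply ContinuousOn.abs
      rw [continuousOn_iff_continuous_domRestrict]
      apply Continuous.matrix_det
      apply continuous_pi; intro i; apply continuous_pi; intro j
      obtain ⟨s, rfl⟩ := e.surjective i
      rcases s with i | k
      · simp only [Matrix.of_apply, Equiv.symm_apply_apply, Sum.elim_inl]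
        exact continuousOn_iff_continuous_domRestrict.1 ((ha i j).continuousOn' hβ)
      · simp only [Matrix.of_apply, Equiv.symm_apply_apply, Sum.elim_inr]
        exact continuous_const
    have hDx : 0 < D x := abs_pos.2 hdet
    have hV : {y | D x / 2 < D y} ∈ nhdsWithin x S :=
      hD x hx (Ioi_mem_nhds (by linarith))
    refine ⟨U ∩ {y | D x / 2 < D y}, Filter.inter_mem (mem_nhdsWithin_of_mem_nhds (hU.mem_nhds hxU)) hV, ?_⟩
    have hnull : ∀ n : ℕ, volume {α : Fin m → ℝ | (∀ j, |α j| ≤ (n : ℝ)) ∧ 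
       ∃ y ∈ S ∩ (U ∩ {y | D x / 2 < D y}), ∀ i, b i y + ∑ j, α j * a i y j = 0} = 0 := by
      intro n
      refine null_core hβ _ (measure_mono_null inter_subset_left hS) a b C hC ?_ ?_ e v (D x / 2)
        (by linarith) (fun y hy => hy.2.2.le) n (Nat.cast_nonneg n)
      · intro i j y hy y' hy'
        exact h (Sum.inl (i, j)) y ⟨hy.2.1, hy.1⟩ y' ⟨hy'.2.1, hy'.1⟩
      · intro i y hy y' hy'
        exact h (Sum.inr i) y ⟨hy.2.1, hy.1⟩ y' ⟨hy'.2.1, hy'.1⟩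
    refine measure_mono_null ?_ (measure_iUnion_null hnull)
    rintro α ⟨y, hy, hyy⟩
    obtain ⟨n, hn⟩ := exists_nat_ge ‖α‖
    exact mem_iUnion.2 ⟨n, fun j => (norm_le_pi_norm α j).trans hn, y, hy, hyy⟩
  choose! V hV hVn using hloc
  obtain ⟨t, htS, htc, hcov⟩ := TopologicalSpace.countable_cover_nhdsWithin hV
  refine measure_mono_null ?_ ((measure_biUnion_null_iff htc).2 fun x hx => hVn x (htS hx))
  rintro α ⟨y, hy, hyy⟩
  obtain ⟨x, hx, hyx⟩ := mem_iUnion₂.1 (hcov hy)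
  exact mem_iUnion₂.2 ⟨x, hx, y, ⟨hy, hyx⟩, hyy⟩

theorem indep_sub {P m : ℕ} (w : Fin P ⊕ Fin P → Fin m → ℝ) (hw : LinearIndependent ℝ w) :
    LinearIndependent ℝ (fun i => w (Sum.inl i) - w (Sum.inr i)) := by
  rw [Fintype.linearIndependent_iff] at hw ⊢
  intro c hc i
  have := hw (Sum.elim c (fun i => - c i)) (by
    rw [Fintype.sum_sum_type, ← hc, ← Finset.sum_add_distrib]
    refine Finset.sum_congr rfl fun i _ => ?_
    simp [sub_eq_add_neg]) (Sum.inl i)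
  simpa using this

section
variable {E : Type*} [NormedAddCommGroup E]

theorem interp_indep {P m k : ℕ} {X : Set E} {hfam : Fin m → E → ℝ}
    (hinterp : IsInterpolatingFamily X hfam (2 * k)) (hP : P ≤ k)
    (z : Fin P ⊕ Fin P → E) (hz : ∀ s, z s ∈ X) (hinj : Function.Injective z) :
    LinearIndependent ℝ (fun s => fun j => hfam j (z s)) := by
  have h1 := hinterp (P + P) (by omega) (fun i => z (finSumFinEquiv.symm i)) (fun i => hz _)
    (hinj.comp finSumFinEquiv.symm.injective)
  have h2 := (indep_of_rank _ h1).comp finSumFinEquiv finSumFinEquiv.injective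
  convert h2 using 1
  ext s j
  simp

theorem iterate_inj {T : E → E} {X : Set E} (hTX : MapsTo T X X) (hTinj : InjOn T X) (n : ℕ) :
    InjOn (T^[n]) X := by
  induction n with
  | zero => intro x _ y _ h; simpa using h
  | succ n ih =>
    intro x hx y hy h
    exact hTinj hx hy (ih (hTX hx) (hTX hy) h)

theorem orbit_inj {T : E → E} {X : Set E} (hTX : MapsTo T X X) (hTinj : InjOn T X) {p : ℕ}
    {x : E} (hx : x ∈ X) (hxp : ∀ j : ℕ, 1 ≤ j → j < p → T^[j] x ≠ x) {i j : ℕ} (hi : i < p)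
    (hj : j < p) (h : T^[i] x = T^[j] x) : i = j := by
  have key : ∀ i j : ℕ, i < j → j < p → T^[i] x = T^[j] x → False := by
    intro i j hij hj h
    have : T^[i] x = T^[i] (T^[j - i] x) := by
      rw [← Function.iterate_add_apply, Nat.add_sub_cancel' hij.le, h]
    exact hxp (j - i) (by omega) (by omega)
      (iterate_inj hTX hTinj i hx ((hTX.iterate _) hx) this).symm
  rcases lt_trichotomy i j with hij | hij | hij
  · exact (key i j hij hj h).elim
  · exact hij
  · exact (key j i hij hi h.symm).elim

variable [MeasurableSpace E] [BorelSpace E] [SecondCountableTopology E]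

theorem pair_null0 {k m : ℕ} {β : ℝ} (hβ : 0 < β) {X : Set E} {T : E → E}
    (hTX : MapsTo T X X) (hTlip : LocallyHolderOn 1 T X)
    {h : E → ℝ} (hh : LocallyHolderOn β h X) {hfam : Fin m → E → ℝ}
    (hinterp : IsInterpolatingFamily X hfam (2 * k))
    (hfamHolder : ∀ j, LocallyHolderOn β (hfam j) X)
    {P : ℕ} (hP : P ≤ k) {x : E} (hx : x ∈ X) {S : Set E} (hS : S ⊆ X)
    (hSH : μH[β * P] S = 0)
    (hdist : ∀ y ∈ S, Function.Injective
      (Sum.elim (fun i : Fin P => T^[(i : ℕ)] x) (fun i : Fin P => T^[(i : ℕ)] y))) :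
    volume {α : Fin m → ℝ | ∃ y ∈ S, ∀ i : Fin k,
      h (T^[(i : ℕ)] x) + ∑ j, α j * hfam j (T^[(i : ℕ)] x) =
      h (T^[(i : ℕ)] y) + ∑ j, α j * hfam j (T^[(i : ℕ)] y)} = 0 := by
  have hH : ∀ f : E → ℝ, LocallyHolderOn β f X → ∀ (n : ℕ) (c : ℝ),
      LocallyHolderOn β (fun y => c - f (T^[n] y)) S := by
    intro f hf n c
    exact (LocallyHolderOn.sub_left' (LocallyHolderOn.comp' hβ hf (hTlip.iterate' hTX n)
      (hTX.iterate n)) c).mono' hS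
  have := null_indep hβ S hSH
    (fun (i : Fin P) y j => hfam j (T^[(i : ℕ)] x) - hfam j (T^[(i : ℕ)] y))
    (fun (i : Fin P) y => h (T^[(i : ℕ)] x) - h (T^[(i : ℕ)] y))
    (fun i j => hH _ (hfamHolder j) _ _) (fun i => hH _ hh _ _) (by
      intro y hy
      exact indep_sub _ (interp_indep hinterp hP _ (by
        rintro (i | i)
        · exact (hTX.iterate _) hx
        · exact (hTX.iterate _) (hS hy)) (hdist y hy)))
  refine measure_mono_null ?_ this
  rintro α ⟨y, hy, hyy⟩
  refine ⟨y, hy, fun i => ?_⟩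
  have := hyy ⟨i, i.2.trans_le hP⟩
  simp only [mul_sub, Finset.sum_sub_distrib]
  simp only at this
  linarith

theorem pair_null {k m : ℕ} {β : ℝ} (hβ : 0 < β) {X : Set E} {T : E → E}
    (hTX : MapsTo T X X) (hTinj : InjOn T X) (hTlip : LocallyHolderOn 1 T X)
    {h : E → ℝ} (hh : LocallyHolderOn β h X) {hfam : Fin m → E → ℝ}
    (hinterp : IsInterpolatingFamily X hfam (2 * k))
    (hfamHolder : ∀ j, LocallyHolderOn β (hfam j) X)
    {p : ℕ} (hp1 : 1 ≤ p) (hp : p ≤ k) {x : E} (hx : x ∈ X)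
    (hxp : ∀ j : ℕ, 1 ≤ j → j < p → T^[j] x ≠ x) {Z : Set E} (hZ : Z ⊆ X)
    (hZp : ∀ y ∈ Z, ∀ j : ℕ, 1 ≤ j → j < p → T^[j] y ≠ y)
    (hZH : μH[β * p] Z = 0) :
    volume {α : Fin m → ℝ | ∃ y ∈ Z, y ≠ x ∧ ∀ i : Fin k,
      h (T^[(i : ℕ)] x) + ∑ j, α j * hfam j (T^[(i : ℕ)] x) =
      h (T^[(i : ℕ)] y) + ∑ j, α j * hfam j (T^[(i : ℕ)] y)} = 0 := by
  let F : Set E := ⋃ i : Fin p, ⋃ j : Fin p, {y | y ∈ X ∧ T^[(j : ℕ)] y = T^[(i : ℕ)] x}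
  have hF : F.Countable := by
    refine countable_iUnion fun i => countable_iUnion fun j => Set.Subsingleton.countable ?_
    intro y hy y' hy'
    exact iterate_inj hTX hTinj j hy.1 hy'.1 (hy.2.trans hy'.2.symm)
  have h1 := pair_null0 hβ hTX hTlip hh hinterp hfamHolder (P := 1) (hp1.trans hp) hx
    (S := (Z ∩ F) \ {x}) (fun y hy => hZ hy.1.1) (by
      have : NullSingletonClass (μH[β * (1 : ℕ)] : Measure E) := Measure.nullSingletonClass_hausdorff E (by simpa using hβ)
      exact (hF.mono (fun y hy => hy.1.2)).measure_zero _) (by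
      intro y hy
      have hyx : y ≠ x := hy.2
      rintro (i | i) (j | j) hij
      · congr 1; exact Subsingleton.elim _ _
      · exact (hyx (by simpa using hij.symm)).elim
      · exact (hyx (by simpa using hij)).elim
      · congr 1; exact Subsingleton.elim _ _)
  have h2 := pair_null0 hβ hTX hTlip hh hinterp hfamHolder (P := p) hp hx
    (S := Z \ F) (fun y hy => hZ hy.1) (measure_mono_null sdiff_subset hZH) (by
      intro y hy
      have hne : ∀ i j : Fin p, T^[(j : ℕ)] y ≠ T^[(i : ℕ)] x := fun i j hc =>
        hy.2 (mem_iUnion.2 ⟨i, mem_iUnion.2 ⟨j, hZ hy.1, hc⟩⟩)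
      rintro (i | i) (j | j) hij
      · congr 1; exact Fin.ext (orbit_inj hTX hTinj hx hxp i.2 j.2 hij)
      · exact (hne _ _ hij.symm).elim
      · exact (hne _ _ hij).elim
      · congr 1; exact Fin.ext (orbit_inj hTX hTinj (hZ hy.1) (hZp y hy.1) i.2 j.2 hij))
  refine measure_mono_null ?_ (measure_union_null h1 h2)
  rintro α ⟨y, hy, hyx, hyy⟩
  by_cases hyF : y ∈ F
  · exact Or.inl ⟨y, ⟨⟨hy, hyF⟩, hyx⟩, hyy⟩
  · exact Or.inr ⟨y, ⟨hy, hyF⟩, hyy⟩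

/-- compact pieces: the bad set is closed. -/
theorem bad_closed {k m : ℕ} {X : Set E} (g : Fin k → E → ℝ) (f : Fin k → Fin m → E → ℝ)
    (hg : ∀ i, ContinuousOn (g i) X) (hf : ∀ i j, ContinuousOn (f i j) X)
    {K K' : Set E} (hK : IsCompact K) (hK' : IsCompact K') (hKX : K ⊆ X) (hKX' : K' ⊆ X) (δ : ℝ) :
    IsClosed {z : E × (Fin m → ℝ) | z.1 ∈ K ∧ ∃ y ∈ K', δ ≤ dist z.1 y ∧
      ∀ i, g i z.1 + ∑ j, z.2 j * f i j z.1 = g i y + ∑ j, z.2 j * f i j y} := by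
  have : CompactSpace K := isCompact_iff_compactSpace.1 hK
  have : CompactSpace K' := isCompact_iff_compactSpace.1 hK'
  have cg : ∀ {L : Set E}, L ⊆ X → ∀ i, Continuous (fun y : L => g i y) := fun hL i =>
    continuousOn_iff_continuous_domRestrict.1 ((hg i).mono hL)
  have cf : ∀ {L : Set E}, L ⊆ X → ∀ i j, Continuous (fun y : L => f i j y) := fun hL i j =>
    continuousOn_iff_continuous_domRestrict.1 ((hf i j).mono hL)
  let A : Set ((K × (Fin m → ℝ)) × K') := {w | δ ≤ dist (w.1.1 : E) w.2 ∧
      ∀ i, g i w.1.1 + ∑ j, w.1.2 j * f i j w.1.1 = g i w.2 + ∑ j, w.1.2 j * f i j w.2}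
  have hA : IsClosed A := by
    have hAe : A = {w | δ ≤ dist (w.1.1 : E) w.2} ∩ ⋂ i, {w | g i w.1.1 + ∑ j, w.1.2 j * f i j w.1.1
        = g i w.2 + ∑ j, w.1.2 j * f i j w.2} := by
      ext w
      rw [mem_inter_iff, mem_iInter]
      rfl
    rw [hAe]
    apply IsClosed.inter
    · exact isClosed_le (f := fun _ => δ) (g := fun w : (K × (Fin m → ℝ)) × K' =>
        dist (w.1.1 : E) w.2) continuous_const (by fun_prop)
    · refine isClosed_iInter fun i => ?_
      have c1 := cg hKX i
      have c2 := cg hKX' i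
      have c3 := cf hKX i
      have c4 := cf hKX' i
      have d1 : Continuous fun w : (K × (Fin m → ℝ)) × K' => g i w.1.1 := c1.comp (by fun_prop)
      have d2 : Continuous fun w : (K × (Fin m → ℝ)) × K' => g i w.2 := c2.comp (by fun_prop)
      have d3 : ∀ j, Continuous fun w : (K × (Fin m → ℝ)) × K' => f i j w.1.1 :=
        fun j => (c3 j).comp (by fun_prop)
      have d4 : ∀ j, Continuous fun w : (K × (Fin m → ℝ)) × K' => f i j w.2 :=
        fun j => (c4 j).comp (by fun_prop)
      have d5 : ∀ j : Fin m, Continuous fun w : (K × (Fin m → ℝ)) × K' => w.1.2 j :=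
        fun j => (continuous_apply j).comp (continuous_snd.comp continuous_fst)
      exact isClosed_eq (d1.add (continuous_finsetSum _ fun j _ => (d5 j).mul (d3 j)))
        (d2.add (continuous_finsetSum _ fun j _ => (d5 j).mul (d4 j)))
  have h1 := isClosedMap_fst_of_compactSpace _ hA
  have h2 : IsClosedMap (Prod.map (Subtype.val : K → E) (id : (Fin m → ℝ) → _)) :=
    (hK.isClosed.isClosedEmbedding_subtypeVal.prodMap .id).isClosedMap
  convert h2 _ h1 using 1
  ext ⟨x, α⟩
  constructor
  · rintro ⟨hx, y, hy, hd, hyy⟩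
    exact ⟨(⟨x, hx⟩, α), ⟨((⟨x, hx⟩, α), ⟨y, hy⟩), ⟨hd, hyy⟩, rfl⟩, rfl⟩
  · rintro ⟨_, ⟨⟨⟨⟨x', hx'⟩, α'⟩, ⟨y, hy⟩⟩, ⟨hd, hyy⟩, rfl⟩, heq⟩
    simp only [Prod.map, Prod.mk.injEq, id] at heq
    obtain ⟨rfl, rfl⟩ := heq
    exact ⟨hx', y, hy, hd, hyy⟩

end

theorem measurableSet_period {E : Type*} [NormedAddCommGroup E] [MeasurableSpace E] [BorelSpace E]
    {X : Set E} (hX : MeasurableSet X) {f : E → E} (hf : ContinuousOn f X) :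
    MeasurableSet {x | x ∈ X ∧ f x = x} := by
  have h1 : IsClosed {x : X | f x = x} :=
    isClosed_eq (continuousOn_iff_continuous_domRestrict.1 hf) continuous_subtype_val
  have h2 := hX.subtype_image h1.measurableSet
  convert h2 using 1
  ext x
  constructor
  · rintro ⟨hx, h⟩; exact ⟨⟨x, hx⟩, h, rfl⟩
  · rintro ⟨⟨x', hx'⟩, h, rfl⟩; exact ⟨hx', h⟩

theorem measurableSet_noperiod {E : Type*} [NormedAddCommGroup E] [MeasurableSpace E] [BorelSpace E]
    {X : Set E} (hX : MeasurableSet X) {T : E → E} (hf : ∀ n : ℕ, ContinuousOn (T^[n]) X) (p : ℕ) :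
    MeasurableSet {x | x ∈ X ∧ ∀ j : ℕ, 1 ≤ j → j < p → T^[j] x ≠ x} := by
  have : {x | x ∈ X ∧ ∀ j : ℕ, 1 ≤ j → j < p → T^[j] x ≠ x} =
      X \ ⋃ (j : ℕ) (_ : 1 ≤ j) (_ : j < p), {x | x ∈ X ∧ T^[j] x = x} := by
    ext x
    simp only [mem_sdiff, mem_iUnion, mem_ofPred_eq, not_exists, not_and]
    constructor
    · rintro ⟨hx, h⟩; exact ⟨hx, fun j h1 h2 _ => h j h1 h2⟩
    · rintro ⟨hx, h⟩; exact ⟨hx, fun j h1 h2 => h j h1 h2 hx⟩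
  rw [this]
  refine hX.diff (MeasurableSet.iUnion fun j => MeasurableSet.iUnion fun _ =>
    MeasurableSet.iUnion fun _ => measurableSet_period hX (hf j))

theorem invariant_core {E : Type*} [NormedAddCommGroup E] [MeasurableSpace E] [BorelSpace E]
    [SecondCountableTopology E] [CompleteSpace E]
    {X : Set E} (hX : MeasurableSet X) (μ : Measure E) [IsFiniteMeasure μ]
    {T : E → E} (hTX : MapsTo T X X) (hTinj : InjOn T X) (hT : ContinuousOn T X)
    (hinv : ∀ Y : Set E, MeasurableSet Y → Y ⊆ X → μ (X ∩ T ⁻¹' Y) = μ Y)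
    {A : Set E} (hA : MeasurableSet A) (hAX : A ⊆ X) (hAμ : μ (X \ A) = 0) :
    ∃ W ⊆ A, MeasurableSet W ∧ μ (X \ W) = 0 ∧ T '' W = W := by
  have himg : ∀ Y : Set E, MeasurableSet Y → Y ⊆ X → MeasurableSet (T '' Y) := fun Y hY hYX =>
    hY.image_of_continuousOn_injOn (hT.mono hYX) (hTinj.mono hYX)
  have hpre : ∀ Y : Set E, MeasurableSet Y → MeasurableSet (X ∩ T ⁻¹' Y) := by
    intro Y hY
    have h1 : Measurable (X.domRestrict T) := (continuousOn_iff_continuous_domRestrict.1 hT).measurable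
    convert hX.subtype_image (h1 hY) using 1
    ext x
    constructor
    · rintro ⟨hx, h⟩; exact ⟨⟨x, hx⟩, h, rfl⟩
    · rintro ⟨⟨x', hx'⟩, h, rfl⟩; exact ⟨hx', h⟩
  -- forward part
  let P : ℕ → Set E := fun n => Nat.rec A (fun _ Y => X ∩ T ⁻¹' Y) n
  have hP0 : P 0 = A := rfl
  have hPs : ∀ n, P (n + 1) = X ∩ T ⁻¹' (P n) := fun n => rfl
  have hPm : ∀ n, MeasurableSet (P n) ∧ P n ⊆ X ∧ μ (X \ P n) = 0 := by
    intro n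
    induction n with
    | zero => exact ⟨hA, hAX, hAμ⟩
    | succ n ih =>
      refine ⟨hpre _ ih.1, inter_subset_left, ?_⟩
      have := hinv (X \ P n) (hX.diff ih.1) sdiff_subset
      rw [ih.2.2] at this
      refine measure_mono_null ?_ this
      rw [hPs]
      rintro x ⟨hx, h⟩
      exact ⟨hx, hTX hx, fun hc => h ⟨hx, hc⟩⟩
  let B : Set E := ⋂ n, P n
  have hBm : MeasurableSet B := MeasurableSet.iInter fun n => (hPm n).1
  have hBX : B ⊆ X := (iInter_subset _ 0).trans hAX
  have hBμ : μ (X \ B) = 0 := by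
    rw [sdiff_iInter]
    exact measure_iUnion_null fun n => (hPm n).2.2
  have hBT : T '' B ⊆ B := by
    rintro _ ⟨x, hx, rfl⟩
    refine mem_iInter.2 fun n => ?_
    exact (mem_iInter.1 hx (n + 1)).2
  -- backward part
  let Q : ℕ → Set E := fun n => Nat.rec B (fun _ Y => T '' Y) n
  have hQ0 : Q 0 = B := rfl
  have hQs : ∀ n, Q (n + 1) = T '' (Q n) := fun n => rfl
  have hQm : ∀ n, MeasurableSet (Q n) ∧ Q n ⊆ X ∧ μ (X \ Q n) = 0 := by
    intro n
    induction n with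
    | zero => exact ⟨hBm, hBX, hBμ⟩
    | succ n ih =>
      have hs : T '' Q n ⊆ X := by
        rintro _ ⟨x, hx, rfl⟩; exact hTX (ih.2.1 hx)
      refine ⟨himg _ ih.1 ih.2.1, hs, ?_⟩
      rw [hQs]
      rw [← hinv (X \ T '' Q n) (hX.diff (himg _ ih.1 ih.2.1)) sdiff_subset]
      refine measure_mono_null ?_ ih.2.2
      rintro x ⟨hx, h⟩
      exact ⟨hx, fun hc => h.2 ⟨x, hc, rfl⟩⟩
  have hQa : ∀ n, Q (n + 1) ⊆ Q n := by
    intro n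
    induction n with
    | zero => exact hBT
    | succ n ih => exact image_mono ih
  refine ⟨⋂ n, Q n, (iInter_subset _ 0).trans (iInter_subset _ 0),
    MeasurableSet.iInter fun n => (hQm n).1, ?_, ?_⟩
  · rw [sdiff_iInter]
    exact measure_iUnion_null fun n => (hQm n).2.2
  · apply Subset.antisymm
    · rintro _ ⟨x, hx, rfl⟩
      exact mem_iInter.2 fun n => hQa n ⟨x, mem_iInter.1 hx n, rfl⟩
    · intro x hx
      obtain ⟨y, hy, rfl⟩ := mem_iInter.1 hx 1
      refine ⟨y, mem_iInter.2 fun n => ?_, rfl⟩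
      obtain ⟨y', hy', h⟩ := mem_iInter.1 hx (n + 1)
      rwa [← hTinj ((hQm n).2.1 hy') (hBX hy) h]

theorem exists_compacts {E : Type*} [NormedAddCommGroup E] [MeasurableSpace E] [BorelSpace E]
    [SecondCountableTopology E] [CompleteSpace E] (μ : Measure E) [IsFiniteMeasure μ]
    {Z : Set E} (hZ : MeasurableSet Z) :
    ∃ K : ℕ → Set E, (∀ n, IsCompact (K n)) ∧ (∀ n, K n ⊆ Z) ∧ μ (Z \ ⋃ n, K n) = 0 := by
  choose K hKZ hK hKμ using fun n : ℕ => hZ.exists_isCompact_sdiff_lt (measure_ne_top μ Z)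
    (ε := ((n : ℝ≥0∞) + 1)⁻¹) (by simp)
  refine ⟨K, hK, hKZ, ?_⟩
  by_contra hne
  obtain ⟨n, hn⟩ := ENNReal.exists_inv_nat_lt hne
  refine absurd hn (not_lt.2 ?_)
  calc _ ≤ μ (Z \ K n) := measure_mono (sdiff_subset_sdiff_right (subset_iUnion K n))
    _ ≤ ((n : ℝ≥0∞) + 1)⁻¹ := (hKμ n).le
    _ ≤ (n : ℝ≥0∞)⁻¹ := by gcongr; exact le_self_add

/-- **Probabilistic Takens delay embedding theorem, invariant measure case (b):**
if moreover `μ` is finite and `T`-invariant, then `X_α` can be chosen with `T(X_α) = X_α`. -/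
theorem probabilistic_takens_invariant_eq {N k m : ℕ} {β : ℝ}
    (hβ : β ∈ Set.Ioc (0 : ℝ) 1)
    (X : Set (EuclideanSpace ℝ (Fin N))) (hX : MeasurableSet X)
    (μ : Measure (EuclideanSpace ℝ (Fin N))) [IsFiniteMeasure μ]
    (hμX : μ Xᶜ = 0)
    (T : EuclideanSpace ℝ (Fin N) → EuclideanSpace ℝ (Fin N))
    (hTX : Set.MapsTo T X X) (hTinj : Set.InjOn T X)
    (hTlip : LocallyHolderOn 1 T X)
    (hXH : μH[β * k] X = 0)
    (hper : ∀ p : ℕ, 1 ≤ p → p < k → ∃ Y : Set (EuclideanSpace ℝ (Fin N)),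
      MeasurableSet Y ∧ μ (PerSet T X p \ Y) = 0 ∧ μH[β * p] Y = 0)
    (h : EuclideanSpace ℝ (Fin N) → ℝ)
    (hh : LocallyHolderOn β h X)
    (hfam : Fin m → EuclideanSpace ℝ (Fin N) → ℝ)
    (hinterp : IsInterpolatingFamily X hfam (2 * k))
    (hfamHolder : ∀ j, LocallyHolderOn β (hfam j) X)
    (hinv : ∀ Y : Set (EuclideanSpace ℝ (Fin N)), MeasurableSet Y → Y ⊆ X →
      μ (X ∩ T ⁻¹' Y) = μ Y) :
    ∀ᵐ α ∂(volume : Measure (Fin m → ℝ)),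
      ∃ X_α : Set (EuclideanSpace ℝ (Fin N)), X_α ⊆ X ∧ MeasurableSet X_α ∧
        μ (X \ X_α) = 0 ∧ T '' X_α = X_α ∧
        Set.InjOn (fun x => fun i : Fin k =>
          h (T^[(i : ℕ)] x) + ∑ j, α j * hfam j (T^[(i : ℕ)] x)) X_α := by
  have hβ0 := hβ.1
  rcases Nat.eq_zero_or_pos k with rfl | hk
  · have hXe : X = ∅ := by
      by_contra hne
      obtain ⟨x, hx⟩ := nonempty_iff_ne_empty.2 hne
      have := measure_mono_null (singleton_subset_iff.2 hx) hXH
      rw [Nat.cast_zero, mul_zero, Measure.hausdorffMeasure_zero_singleton] at this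
      exact one_ne_zero this
    subst hXe
    exact Filter.Eventually.of_forall fun α => ⟨∅, Subset.rfl, MeasurableSet.empty, by simp, by simp, by simp⟩
  have hTn : ∀ n : ℕ, ContinuousOn (T^[n]) X := fun n => (hTlip.iterate' hTX n).continuousOn' one_pos
  have hcomp : ∀ f : EuclideanSpace ℝ (Fin N) → ℝ, LocallyHolderOn β f X → ∀ n : ℕ,
      ContinuousOn (fun y => f (T^[n] y)) X := fun f hf n =>
    (LocallyHolderOn.comp' hβ0 hf (hTlip.iterate' hTX n) (hTX.iterate n)).continuousOn' hβ0
  -- the pieces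
  have hZ : ∀ p : ℕ, ∃ Z : Set (EuclideanSpace ℝ (Fin N)), MeasurableSet Z ∧
      (Z ⊆ {x | x ∈ X ∧ ∀ j : ℕ, 1 ≤ j → j < p → T^[j] x ≠ x}) ∧
      (1 ≤ p → p ≤ k → μH[β * p] Z = 0) ∧ (1 ≤ p → p < k → μ (PerSet T X p \ Z) = 0) ∧
      (p = k → {x | x ∈ X ∧ ∀ j : ℕ, 1 ≤ j → j < p → T^[j] x ≠ x} ⊆ Z) ∧
      (¬ (1 ≤ p ∧ p ≤ k) → Z = ∅) := by
    intro p
    by_cases hp : 1 ≤ p ∧ p ≤ k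
    · rcases hp.2.lt_or_eq with hlt | rfl
      · obtain ⟨Y, hY, hYμ, hYH⟩ := hper p hp.1 hlt
        refine ⟨PerSet T X p ∩ Y, ?_, ?_, ?_, ?_, ?_, ?_⟩
        · refine MeasurableSet.inter ?_ hY
          have : PerSet T X p = {x | x ∈ X ∧ T^[p] x = x} ∩
              {x | x ∈ X ∧ ∀ j : ℕ, 1 ≤ j → j < p → T^[j] x ≠ x} := by
            ext x
            exact ⟨fun hx => ⟨⟨hx.1, hx.2.1⟩, hx.1, hx.2.2⟩, fun hx => ⟨hx.1.1, hx.1.2, hx.2.2⟩⟩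
          rw [this]
          exact (measurableSet_period hX (hTn p)).inter (measurableSet_noperiod hX hTn p)
        · rintro x ⟨hx, -⟩; exact ⟨hx.1, hx.2.2⟩
        · intro _ _; exact measure_mono_null inter_subset_right hYH
        · intro _ _; rwa [sdiff_self_inter]
        · intro h; omega
        · intro h; exact absurd hp h
      · refine ⟨_, measurableSet_noperiod hX hTn p, Subset.rfl, ?_, ?_, ?_, ?_⟩
        · intro _ _; exact measure_mono_null (fun x hx => hx.1) hXH
        · intro _ h; omega
        · intro _; exact Subset.rfl
        · intro h; exact absurd hp h
    · refine ⟨∅, MeasurableSet.empty, empty_subset _, fun _ _ => by simp, fun h1 h2 => ?_, fun h => ?_,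
        fun _ => rfl⟩
      · exact absurd ⟨h1, h2.le⟩ hp
      · exact absurd ⟨by omega, by omega⟩ hp
  choose Z hZm hZs hZH hZμ hZk hZe using hZ
  choose K hKc hKZ hKμ using fun p => exists_compacts μ (hZm p)
  have hKX : ∀ p n, K p n ⊆ X := fun p n x hx => (hZs p (hKZ p n hx)).1
  have hfull : μ (X \ ⋃ p, ⋃ n, K p n) = 0 := by
    have h1 : μ (⋃ p, (Z p \ ⋃ n, K p n)) = 0 := measure_iUnion_null hKμ
    have h2 : μ (⋃ (p : ℕ) (_ : 1 ≤ p) (_ : p < k), (PerSet T X p \ Z p)) = 0 :=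
      measure_iUnion_null fun p => measure_iUnion_null fun hp => measure_iUnion_null fun hp' =>
        hZμ p hp hp'
    refine measure_mono_null ?_ (measure_union_null h1 h2)
    rintro x ⟨hx, hxK⟩
    by_cases hxZ : ∃ p, x ∈ Z p
    · obtain ⟨p, hp⟩ := hxZ
      refine Or.inl (mem_iUnion.2 ⟨p, hp, fun hc => hxK (mem_iUnion.2 ⟨p, hc⟩)⟩)
    · right
      push Not at hxZ
      have hex : ∃ j : ℕ, 1 ≤ j ∧ j < k ∧ T^[j] x = x := by
        by_contra hcon
        push Not at hcon
        exact hxZ k (hZk k rfl ⟨hx, hcon⟩)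
      classical
      have hspec := Nat.find_spec hex
      refine mem_iUnion.2 ⟨Nat.find hex, mem_iUnion.2 ⟨hspec.1, mem_iUnion.2 ⟨hspec.2.1, ?_, hxZ _⟩⟩⟩
      refine ⟨hx, hspec.2.2, fun j h1 h2 hc => ?_⟩
      exact Nat.find_min hex h2 ⟨h1, h2.trans hspec.2.1, hc⟩
  have hae : ∀ q n p n' l : ℕ, p ≤ q → ∀ᵐ α ∂(volume : Measure (Fin m → ℝ)), ∀ᵐ x ∂μ,
      ¬ (x ∈ K q n ∧ ∃ y ∈ K p n', (1 / ((l : ℝ) + 1)) ≤ dist x y ∧ ∀ i : Fin k,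
        h (T^[(i : ℕ)] x) + ∑ j, α j * hfam j (T^[(i : ℕ)] x) =
        h (T^[(i : ℕ)] y) + ∑ j, α j * hfam j (T^[(i : ℕ)] y)) := by
    intro q n p n' l hpq
    have hcl := bad_closed (X := X) (fun (i : Fin k) y => h (T^[(i : ℕ)] y))
      (fun (i : Fin k) j y => hfam j (T^[(i : ℕ)] y)) (fun i => hcomp _ hh _)
      (fun i j => hcomp _ (hfamHolder j) _) (hKc q n) (hKc p n') (hKX q n) (hKX p n')
      (1 / ((l : ℝ) + 1))
    refine (Measure.ae_ae_comm (μ := μ) (ν := (volume : Measure (Fin m → ℝ))) ?_).1 ?_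
    · exact hcl.measurableSet.compl
    · refine Filter.Eventually.of_forall fun x => ?_
      by_cases hx : x ∈ K q n
      swap
      · exact Filter.Eventually.of_forall fun α hc => hx hc.1
      by_cases hp : 1 ≤ p ∧ p ≤ k
      swap
      · refine Filter.Eventually.of_forall fun α hc => ?_
        obtain ⟨_, y, hy, _⟩ := hc
        have := hKZ p n' hy
        rw [hZe p hp] at this
        exact this
      have hxZ := hZs q (hKZ q n hx)
      have hnull := pair_null hβ0 hTX hTinj hTlip hh hinterp hfamHolder hp.1 hp.2 hxZ.1
        (fun j h1 h2 => hxZ.2 j h1 (h2.trans_le hpq)) (hKX p n')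
        (fun y hy => (hZs p (hKZ p n' hy)).2)
        (measure_mono_null (hKZ p n') (hZH p hp.1 hp.2))
      refine measure_mono_null ?_ hnull
      intro α hα
      obtain ⟨_, y, hy, hd, hyy⟩ := not_not.1 hα
      refine ⟨y, hy, ?_, hyy⟩
      rintro rfl
      rw [dist_self] at hd
      have : 0 < 1 / ((l : ℝ) + 1) := by positivity
      linarith
  have hall : ∀ᵐ α ∂(volume : Measure (Fin m → ℝ)), ∀ q n p n' l : ℕ, p ≤ q → ∀ᵐ x ∂μ,
      ¬ (x ∈ K q n ∧ ∃ y ∈ K p n', (1 / ((l : ℝ) + 1)) ≤ dist x y ∧ ∀ i : Fin k,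
        h (T^[(i : ℕ)] x) + ∑ j, α j * hfam j (T^[(i : ℕ)] x) =
        h (T^[(i : ℕ)] y) + ∑ j, α j * hfam j (T^[(i : ℕ)] y)) := by
    simp only [ae_all_iff]
    exact hae
  filter_upwards [hall] with α hα
  have hα2 : ∀ᵐ x ∂μ, (∀ q n p n' l : ℕ, p ≤ q → 
      ¬ (x ∈ K q n ∧ ∃ y ∈ K p n', (1 / ((l : ℝ) + 1)) ≤ dist x y ∧ ∀ i : Fin k,
        h (T^[(i : ℕ)] x) + ∑ j, α j * hfam j (T^[(i : ℕ)] x) =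
        h (T^[(i : ℕ)] y) + ∑ j, α j * hfam j (T^[(i : ℕ)] y))) := by
    simp only [ae_all_iff]
    exact hα
  set G := {x | ∀ q n p n' l : ℕ, p ≤ q → 
      ¬ (x ∈ K q n ∧ ∃ y ∈ K p n', (1 / ((l : ℝ) + 1)) ≤ dist x y ∧ ∀ i : Fin k,
        h (T^[(i : ℕ)] x) + ∑ j, α j * hfam j (T^[(i : ℕ)] x) =
        h (T^[(i : ℕ)] y) + ∑ j, α j * hfam j (T^[(i : ℕ)] y))} with hG
  have hGc : μ Gᶜ = 0 := hα2
  let U := ⋃ p, ⋃ n, K p n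
  have hUm : MeasurableSet U := MeasurableSet.iUnion fun p => MeasurableSet.iUnion fun n =>
    (hKc p n).measurableSet
  let A := U \ toMeasurable μ Gᶜ
  have hAm : MeasurableSet A := hUm.diff (measurableSet_toMeasurable _ _)
  have hAX : A ⊆ X := by
    rintro x ⟨hx, -⟩
    obtain ⟨p, hp⟩ := mem_iUnion.1 hx
    obtain ⟨n, hn⟩ := mem_iUnion.1 hp
    exact hKX p n hn
  have hAμ : μ (X \ A) = 0 := by
    refine measure_mono_null (t := (X \ U) ∪ toMeasurable μ Gᶜ) ?_
      (measure_union_null hfull ((measure_toMeasurable _).trans hGc))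
    rintro x ⟨hx, hxA⟩
    by_cases hxU : x ∈ U
    · right
      by_contra hc
      exact hxA ⟨hxU, hc⟩
    · exact Or.inl ⟨hx, hxU⟩
  obtain ⟨W, hWA, hWm, hWμ, hTW⟩ := invariant_core hX μ hTX hTinj (hTlip.continuousOn' one_pos) hinv
    hAm hAX hAμ
  refine ⟨W, hWA.trans hAX, hWm, hWμ, hTW, ?_⟩
  have hGA : ∀ x ∈ A, x ∈ G := fun x hx => by
    by_contra hc
    exact hx.2 (subset_toMeasurable μ _ hc)
  have key : ∀ x ∈ A, ∀ y ∈ A, ∀ q n p n' : ℕ, p ≤ q → x ∈ K q n → y ∈ K p n' →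
      (∀ i : Fin k, h (T^[(i : ℕ)] x) + ∑ j, α j * hfam j (T^[(i : ℕ)] x) =
        h (T^[(i : ℕ)] y) + ∑ j, α j * hfam j (T^[(i : ℕ)] y)) → x = y := by
    intro x hx y hy q n p n' hpq hxK hyK heq
    by_contra hne
    obtain ⟨l, hl⟩ := exists_nat_one_div_lt (dist_pos.2 hne)
    exact hGA x hx q n p n' l hpq ⟨hxK, y, hyK, hl.le, heq⟩
  intro x hx y hy hxy
  have hxA := hWA hx
  have hyA := hWA hy
  obtain ⟨q, hq⟩ := mem_iUnion.1 hxA.1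
  obtain ⟨n, hn⟩ := mem_iUnion.1 hq
  obtain ⟨p, hp⟩ := mem_iUnion.1 hyA.1
  obtain ⟨n', hn'⟩ := mem_iUnion.1 hp
  have heq : ∀ i : Fin k, h (T^[(i : ℕ)] x) + ∑ j, α j * hfam j (T^[(i : ℕ)] x) =
        h (T^[(i : ℕ)] y) + ∑ j, α j * hfam j (T^[(i : ℕ)] y) := fun i => congrFun hxy i
  rcases le_total p q with hpq | hpq
  · exact key x hxA y hyA q n p n' hpq hn hn' heq
  · exact (key y hyA x hxA p n' q n hpq hn' hn fun i => (heq i).symm).symm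
end
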